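/- arXiv:2511.18190 — 2 statements merged into one kernel-verified Lean document; each statement's English description precedes it below -/
import Mathlib

section
/- Let n ≥ 3, γ > 1/2, T > 0, r > 0. For j = 1,…,n−2 let f_j : [−T,T]^{j} → ℝ be smooth functions vanishing to order two at 0 (so f_j depends only on t₁,…,t_j), and let F : [−T,T]^{n−2} × \bar{D}_r(0) → ℂ be a smooth function vanishing to order three at 0. For 0 < T' ≤ T and 0 < r' ≤ r let M_{T',r'} ⊆ ℂ^n be the image of the map (t₁,…,t_{n−2},w) ↦ (t₁ + i f₁(t₁), t₂ + i f₂(t₁,t₂), …, t_{n−2} + i f_{n−2}(t₁,…,t_{n−2}), w, w\bar w + γ(w² + \bar w²) + F(t₁,…,t_{n−2},w,\bar w)) over (t₁,…,t_{n−2}) ∈ [−T',T']^{n−2}, w ∈ \bar{D}_{r'}(0). Then there exist T' ∈ (0,T] and r' ∈ (0,r] such that the compact set M_{T',r'} is polynomially convex and satisfies 𝒫(M_{T',r'}) = 𝒞(M_{T',r'}); in particular M_{T,r} is locally polynomially convex at 0. -/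
open Complex Metric ComplexConjugate

noncomputable section

/-- A compact set `K ⊆ ℂⁿ` is polynomially convex: every point outside `K` is separated
from `K` by a holomorphic polynomial. -/
def IsPolyConvex {n : ℕ} (K : Set (Fin n → ℂ)) : Prop :=
  ∀ w : Fin n → ℂ, w ∉ K → ∃ P : MvPolynomial (Fin n) ℂ,
    ∀ z ∈ K, ‖MvPolynomial.eval z P‖ < ‖MvPolynomial.eval w P‖

/-- `𝒫(K) = 𝒞(K)`: every continuous function on `K ⊆ ℂⁿ` is a uniform limit on `K` of
(restrictions of) holomorphic polynomials. -/
def PolyDenseInC {n : ℕ} (K : Set (Fin n → ℂ)) : Prop :=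
  ∀ g : K → ℂ, Continuous g → ∀ ε : ℝ, 0 < ε →
    ∃ P : MvPolynomial (Fin n) ℂ, ∀ z : K, ‖MvPolynomial.eval (z : Fin n → ℂ) P - g z‖ < ε

namespace FHP

variable {X : Type*} [TopologicalSpace X] [CompactSpace X]

/-- Uniform approximability by a closed subalgebra implies membership. -/
lemma mem_of_approx (A : Subalgebra ℂ C(X, ℂ)) (hA : IsClosed (A : Set C(X, ℂ))) (g : C(X, ℂ))
    (h : ∀ ε : ℝ, 0 < ε → ∃ a ∈ A, ∀ x, ‖a x - g x‖ ≤ ε) : g ∈ A := by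
  have : g ∈ closure (A : Set C(X, ℂ)) := by
    rw [Metric.mem_closure_iff]
    intro ε hε
    obtain ⟨a, ha, hx⟩ := h (ε / 2) (by positivity)
    refine ⟨a, ha, ?_⟩
    rw [dist_comm]
    refine lt_of_le_of_lt ((ContinuousMap.dist_le (C := ε / 2) (by positivity)).2 ?_) (by linarith)
    intro x
    rw [dist_eq_norm]
    exact hx x
  rwa [hA.closure_eq] at this

/-- Neumann series in a closed subalgebra. -/
lemma neumann (A : Subalgebra ℂ C(X, ℂ)) (hA : IsClosed (A : Set C(X, ℂ))) (w : C(X, ℂ))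
    (hw : w ∈ A) (h : ‖1 - w‖ < 1) : ∃ a ∈ A, a * w = 1 := by
  have : CompleteSpace A := hA.completeSpace_coe
  let w' : A := ⟨w, hw⟩
  have h1 : ‖1 - w'‖ < 1 := h
  have h2 : IsUnit (1 - (1 - w')) := isUnit_one_sub_of_norm_lt_one h1
  rw [sub_sub_cancel] at h2
  obtain ⟨u, hu⟩ := h2
  refine ⟨((u⁻¹ : Aˣ) : A), Subtype.mem _, ?_⟩
  have : ((u⁻¹ : Aˣ) : A) * w' = 1 := by rw [← hu]; exact u.inv_mul
  exact congrArg Subtype.val this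

lemma sector_bound {κ x : ℝ} (hκ0 : 0 ≤ κ) (hκ : κ < 1) (hx : 0 < x) (v : ℂ)
    (hv : -κ * ‖v‖ ≤ v.re) : (1 - κ) * x ≤ ‖v + x‖ := by
  have h1 : ((1 - κ) * x) ^ 2 ≤ ‖v + x‖ ^ 2 := by
    have e1 : ‖v + x‖ ^ 2 = ‖v‖ ^ 2 + 2 * x * v.re + x ^ 2 := by
      rw [Complex.sq_norm, Complex.sq_norm, Complex.normSq_apply, Complex.normSq_apply]
      simp
      ring
    rw [e1]
    nlinarith [sq_nonneg (‖v‖ - κ * x), mul_le_mul_of_nonneg_left hv hx.le, norm_nonneg v,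
      mul_nonneg hκ0 hκ0, mul_pos hx hx, mul_nonneg hκ0 (sub_nonneg.2 hκ.le),
      mul_nonneg (mul_nonneg hκ0 (sub_nonneg.2 hκ.le)) (mul_pos hx hx).le]
  exact le_of_sq_le_sq₀ h1 (norm_nonneg _)
where
  le_of_sq_le_sq₀ {a b : ℝ} (h : a ^ 2 ≤ b ^ 2) (hb : 0 ≤ b) : a ≤ b := by
    nlinarith [sq_nonneg (a - b), abs_le_of_sq_le_sq' h hb]

/-- Resolvents at negative reals of a sectorial element lie in the algebra. -/
lemma resolvent_mem (A : Subalgebra ℂ C(X, ℂ)) (hA : IsClosed (A : Set C(X, ℂ))) (v : C(X, ℂ))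
    (hv : v ∈ A) {κ : ℝ} (hκ0 : 0 ≤ κ) (hκ : κ < 1) (hs : ∀ x, -κ * ‖v x‖ ≤ (v x).re)
    {y : ℝ} (hy : 0 < y) : ∃ a ∈ A, ∀ x, a x * (v x + y) = 1 := by
  classical
  let C : ℝ → C(X, ℂ) := fun y => algebraMap ℂ C(X, ℂ) (y : ℂ)
  have hC : ∀ y x, C y x = (y : ℂ) := fun y x => rfl
  have hCA : ∀ y, C y ∈ A := fun y => A.algebraMap_mem _
  let P : ℝ → Prop := fun y => ∃ a ∈ A, ∀ x, a x * (v x + y) = 1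
  have big : ∀ y : ℝ, 0 < y → ‖v‖ < y → P y := by
    intro y hy hvy
    obtain ⟨a, ha, h1⟩ := neumann A hA (1 + C y⁻¹ * v)
      (A.add_mem A.one_mem (A.mul_mem (hCA _) hv)) (by
        rw [show (1 : C(X, ℂ)) - (1 + C y⁻¹ * v) = -(C y⁻¹ * v) by ring, norm_neg]
        have h3 : ‖C y⁻¹ * v‖ ≤ y⁻¹ * ‖v‖ := by
          rw [ContinuousMap.norm_le _ (by positivity)]
          intro x
          rw [ContinuousMap.mul_apply, norm_mul, hC]
          have := v.norm_coe_le_norm x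
          simp only [norm_real, norm_inv, Real.norm_eq_abs, abs_of_pos hy]
          gcongr
        refine lt_of_le_of_lt h3 ?_
        rw [inv_mul_lt_iff₀ hy]; linarith)
    refine ⟨C y⁻¹ * a, A.mul_mem (hCA _) ha, fun x => ?_⟩
    have h2 := congrArg (fun g : C(X, ℂ) => g x) h1
    simp only [ContinuousMap.mul_apply, ContinuousMap.add_apply, ContinuousMap.one_apply, hC] at h2 ⊢
    rw [← h2]
    have : (y : ℂ) ≠ 0 := by exact_mod_cast hy.ne'
    push_cast
    field_simp
    ring
  have step : ∀ y : ℝ, 0 < y → P y → P ((1 - (1 - κ) / 2) * y) := by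
    intro y hy ⟨a, ha, h1⟩
    have hne : ∀ x, v x + y ≠ 0 := fun x h => by have := h1 x; rw [h] at this; simp at this
    have hy' : 0 < (1 - κ) * y := mul_pos (by linarith) hy
    obtain ⟨b, hb, h2⟩ := neumann A hA (1 - C ((1 - κ) / 2 * y) * a)
      (A.sub_mem A.one_mem (A.mul_mem (hCA _) ha)) (by
        rw [sub_sub_cancel]
        refine lt_of_le_of_lt (b := 1 / 2) ?_ (by norm_num)
        rw [ContinuousMap.norm_le _ (by norm_num)]
        intro x
        have h3 : ‖a x‖ = ‖v x + y‖⁻¹ := by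
          rw [eq_inv_of_mul_eq_one_left (h1 x), norm_inv]
        have h4 := sector_bound hκ0 hκ hy (v x) (hs x)
        rw [ContinuousMap.mul_apply, norm_mul, hC, h3, norm_real, Real.norm_eq_abs,
          abs_of_pos (by nlinarith)]
        rw [← div_eq_mul_inv, div_le_iff₀ (by linarith)]
        linarith)
    refine ⟨b * a, A.mul_mem hb ha, fun x => ?_⟩
    have h3 := congrArg (fun g : C(X, ℂ) => g x) h2
    simp only [ContinuousMap.mul_apply, ContinuousMap.sub_apply, ContinuousMap.one_apply, hC] at h3 ⊢
    rw [← h3]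
    have h4 := h1 x
    push_cast at *
    linear_combination (b x) * h4
  have iter : ∀ n : ℕ, ∀ y : ℝ, 0 < y → P y → P ((1 - (1 - κ) / 2) ^ n * y) := by
    intro n
    induction n with
    | zero => intro y _ h; simpa using h
    | succ n ih =>
      intro y hy h
      have := step _ (mul_pos (pow_pos (by linarith) n) hy) (ih y hy h)
      rwa [← mul_assoc, ← pow_succ'] at this
  set q := (1 - (1 - κ) / 2) with hq
  have hq0 : 0 < q := by rw [hq]; linarith
  have hq1 : q < 1 := by rw [hq]; linarith
  obtain ⟨n, hn⟩ := exists_pow_lt_of_lt_one (x := y / (‖v‖ + 1)) (by positivity) hq1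
  have h5 := iter n (y / q ^ n) (by positivity) (big _ (by positivity) (by
    rw [lt_div_iff₀ (by positivity)] at hn ⊢
    nlinarith [norm_nonneg v, pow_pos hq0 n]))
  rwa [mul_div_cancel₀ _ (by positivity)] at h5

/-- Integrals of continuous families in a closed subalgebra. -/
lemma integral_mem' (A : Subalgebra ℂ C(X, ℂ)) (hA : IsClosed (A : Set C(X, ℂ)))
    {Y : Type*} [TopologicalSpace Y] [CompactSpace Y] [MeasurableSpace Y] [BorelSpace Y]
    (μ : MeasureTheory.Measure Y) [MeasureTheory.IsFiniteMeasure μ]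
    (Φ : C(Y, C(X, ℂ))) (h : ∀ y, Φ y ∈ A) : ∃ a ∈ A, ∀ x, a x = ∫ y, Φ y x ∂μ := by
  let S : Submodule ℝ C(X, ℂ) := (Subalgebra.toSubmodule A).restrictScalars ℝ
  have hS : IsClosed (S : Set C(X, ℂ)) := hA
  have : CompleteSpace S := hS.completeSpace_coe
  let φ : C(Y, S) := ⟨fun y => ⟨Φ y, h y⟩, Φ.continuous.subtype_mk _⟩
  have hi : MeasureTheory.Integrable φ μ := by
    refine MeasureTheory.Integrable.of_bound (C := ‖φ‖) ?_ ?_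
    · rw [← MeasureTheory.Measure.restrict_univ (μ := μ)]
      exact φ.continuous.continuousOn.aestronglyMeasurable_of_isCompact isCompact_univ
        MeasurableSet.univ
    · exact Filter.Eventually.of_forall fun y => φ.norm_coe_le_norm y
  have hi2 : MeasureTheory.Integrable Φ μ := S.subtypeL.integrable_comp hi
  refine ⟨((∫ y, φ y ∂μ : S) : C(X, ℂ)), (∫ y, φ y ∂μ : S).2, fun x => ?_⟩
  have e1 : ((∫ y, φ y ∂μ : S) : C(X, ℂ)) = ∫ y, Φ y ∂μ :=
    (S.subtypeL.integral_comp_comm hi).symm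
  rw [e1]
  exact ContinuousMap.integral_apply hi2 x

/-- Stone-Weierstrass in the form used below. -/
lemma stone_weierstrass (A : Subalgebra ℂ C(X, ℂ)) (hA : IsClosed (A : Set C(X, ℂ)))
    (S : Set C(X, ℂ)) (hS : S ⊆ A) (hS' : ∀ s ∈ S, star s ∈ A)
    (hsep : ∀ x y, (∀ s ∈ S, s x = s y) → x = y) : A = ⊤ := by
  have h1 : (StarAlgebra.adjoin ℂ S).topologicalClosure = ⊤ := by
    apply ContinuousMap.starSubalgebra_topologicalClosure_eq_top_of_separatesPoints
    intro x y hxy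
    by_contra hcon
    apply hxy
    apply hsep
    intro s hs
    by_contra hne
    exact hcon ⟨s, ⟨s, StarAlgebra.subset_adjoin ℂ S hs, rfl⟩, hne⟩
  have h2 : ((StarAlgebra.adjoin ℂ S : StarSubalgebra ℂ C(X, ℂ)) : Set C(X, ℂ)) ⊆ A := by
    have : (StarAlgebra.adjoin ℂ S).toSubalgebra ≤ A := by
      rw [StarAlgebra.adjoin_toSubalgebra, Algebra.adjoin_le_iff]
      rintro s (hs | hs)
      · exact hS hs
      · have := hS' _ hs
        rwa [star_star] at this
    exact this
  rw [eq_top_iff]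
  intro g _
  have h3 : g ∈ (StarAlgebra.adjoin ℂ S).topologicalClosure := by rw [h1]; trivial
  have h4 : g ∈ closure ((StarAlgebra.adjoin ℂ S : StarSubalgebra ℂ C(X, ℂ)) : Set C(X, ℂ)) := h3
  have h5 := closure_mono h2 h4
  rwa [hA.closure_eq] at h5

/-- The logarithm of a sectorial element bounded away from zero. -/
lemma log_mem (A : Subalgebra ℂ C(X, ℂ)) (hA : IsClosed (A : Set C(X, ℂ))) (v : C(X, ℂ))
    (hv : v ∈ A) {κ : ℝ} (hκ0 : 0 ≤ κ) (hκ : κ < 1) (hs : ∀ x, -κ * ‖v x‖ ≤ (v x).re)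
    {δ : ℝ} (hδ : 0 < δ) : ∃ a ∈ A, ∀ x, a x = Complex.log (v x + δ) := by
  have hslit : ∀ x, ∀ y : ℝ, 0 < y → v x + y ∈ slitPlane := by
    intro x y hy
    rw [Complex.mem_slitPlane_iff]
    by_contra hcon
    push Not at hcon
    obtain ⟨h1, h2⟩ := hcon
    simp only [add_re, ofReal_re, add_im, ofReal_im, add_zero] at h1 h2
    have h3 : ‖v x‖ = |(v x).re| := by
      rw [← Complex.re_add_im (v x), h2]; simp
    have h4 := hs x
    rw [h3, abs_of_nonpos (by linarith)] at h4
    nlinarith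
  -- the segment
  have hne : ∀ (τ : unitInterval) x, (1 : ℂ) + (τ : ℝ) * (v x + δ - 1) ≠ 0 := by
    intro τ x
    rcases τ.2.1.eq_or_lt with h | h
    · rw [← h]; simp
    · have hy : 0 < δ + (1 - τ) / (τ : ℝ) :=
        add_pos_of_pos_of_nonneg hδ (div_nonneg (by linarith [τ.2.2]) h.le)
      have h1 := slitPlane_ne_zero (hslit x _ hy)
      have h2 : (1 : ℂ) + (τ : ℝ) * (v x + δ - 1) =
          (τ : ℝ) * (v x + ((δ + (1 - τ) / (τ : ℝ) : ℝ) : ℂ)) := by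
        have : ((τ : ℝ) : ℂ) ≠ 0 := by exact_mod_cast h.ne'
        push_cast
        field_simp
        ring
      rw [h2]
      exact mul_ne_zero (by exact_mod_cast h.ne') h1
  let Φ0 : C(unitInterval × X, ℂ) :=
    ⟨fun p => ((1 : ℂ) + ((p.1 : ℝ) : ℂ) * (v p.2 + δ - 1))⁻¹, by
      apply Continuous.inv₀
      · fun_prop
      · intro p; exact hne p.1 p.2⟩
  have hΦA : ∀ τ, Φ0.curry τ ∈ A := by
    intro τ
    rcases τ.2.1.eq_or_lt with h | h
    · have : Φ0.curry τ = 1 := by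
        ext x
        change ((1 : ℂ) + ((τ : ℝ) : ℂ) * (v x + δ - 1))⁻¹ = 1
        rw [← h]; simp
      rw [this]; exact A.one_mem
    · have hy : 0 < δ + (1 - τ) / (τ : ℝ) :=
        add_pos_of_pos_of_nonneg hδ (div_nonneg (by linarith [τ.2.2]) h.le)
      obtain ⟨a, ha, h1⟩ := resolvent_mem A hA v hv hκ0 hκ hs hy
      have : Φ0.curry τ = (((τ : ℝ) : ℂ)⁻¹) • a := by
        ext x
        change ((1 : ℂ) + ((τ : ℝ) : ℂ) * (v x + δ - 1))⁻¹ = (((τ : ℝ) : ℂ)⁻¹) * a x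
        apply inv_eq_of_mul_eq_one_left
        have h2 := h1 x
        have : ((τ : ℝ) : ℂ) ≠ 0 := by exact_mod_cast h.ne'
        refine Eq.trans ?_ h2
        push_cast
        field_simp
        ring
      rw [this]; exact A.smul_mem ha _
  obtain ⟨a, ha, h1⟩ := integral_mem' A hA MeasureTheory.volume Φ0.curry hΦA
  refine ⟨(v + algebraMap ℂ C(X, ℂ) (δ - 1)) * a,
    A.mul_mem (A.add_mem hv (A.algebraMap_mem _)) ha, fun x => ?_⟩
  have h2 := Complex.log_eq_integral (z := v x + δ - 1) (by
    rw [add_sub_cancel]; exact hslit x δ hδ)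
  rw [add_sub_cancel] at h2
  rw [h2, ContinuousMap.mul_apply, h1]
  congr 1
  · rw [ContinuousMap.add_apply]
    change v x + ((δ : ℂ) - 1) = _
    ring
  · rw [intervalIntegral.integral_of_le zero_le_one, ← MeasureTheory.integral_Icc_eq_integral_Ioc,
      ← MeasureTheory.integral_subtype_comap measurableSet_Icc]
    rfl

/-- Exponentials. -/
lemma exp_mem (A : Subalgebra ℂ C(X, ℂ)) (hA : IsClosed (A : Set C(X, ℂ))) (v : C(X, ℂ))
    (hv : v ∈ A) : ∃ a ∈ A, ∀ x, a x = Complex.exp (v x) := by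
  have h0 := NormedSpace.exp_series_hasSum_exp' (𝕂 := ℂ) v
  refine ⟨NormedSpace.exp v, ?_, fun x => ?_⟩
  · exact hA.mem_of_tendsto h0 (Filter.Eventually.of_forall fun s =>
      A.sum_mem fun n _ => A.smul_mem (A.pow_mem hv n) _)
  · have h1 : HasSum (fun n : ℕ => ((n.factorial : ℂ)⁻¹ • v ^ n) x) (NormedSpace.exp v x) :=
      h0.map (ContinuousMap.evalAlgHom (R := ℂ) ℂ x) (ContinuousEvalConst.continuous_eval_const x)
    have h2 := NormedSpace.exp_series_hasSum_exp' (𝕂 := ℂ) (v x)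
    rw [Complex.exp_eq_exp_ℂ]
    exact h1.unique h2

/-- Square roots in a sector. -/
lemma sqrt_mem (A : Subalgebra ℂ C(X, ℂ)) (hA : IsClosed (A : Set C(X, ℂ))) (s : C(X, ℂ))
    (hs2 : s * s ∈ A) {c : ℝ} (hc0 : 0 < c) (hc1 : c ≤ 1) (hs : ∀ x, c * ‖s x‖ ≤ (s x).re) :
    s ∈ A := by
  apply mem_of_approx A hA
  intro ε hε
  set δ := ε ^ 2 / (1 + 2 / c) with hδ
  have hδ0 : 0 < δ := by positivity
  obtain ⟨l, hl, h1⟩ := log_mem A hA (s * s) hs2 (κ := 1 - c ^ 2) (by nlinarith) (by nlinarith) (by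
    intro x
    have e1 : ‖(s * s) x‖ = ‖s x‖ ^ 2 := by rw [ContinuousMap.mul_apply, norm_mul, sq]
    have e2 : ((s * s) x).re = 2 * (s x).re ^ 2 - ‖s x‖ ^ 2 := by
      rw [ContinuousMap.mul_apply, Complex.sq_norm, Complex.normSq_apply, Complex.mul_re]; ring
    rw [e1, e2]
    have h3 : (c * ‖s x‖) ^ 2 ≤ (s x).re ^ 2 :=
      pow_le_pow_left₀ (by positivity) (hs x) 2
    nlinarith [sq_nonneg (c * ‖s x‖)]) hδ0
  obtain ⟨a, ha, h2⟩ := exp_mem A hA ((1 / 2 : ℂ) • l) (A.smul_mem hl _)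
  refine ⟨a, ha, fun x => ?_⟩
  have ea : a x = Complex.exp (Complex.log (s x * s x + δ) / 2) := by
    rw [h2, ContinuousMap.smul_apply, h1, ContinuousMap.mul_apply, smul_eq_mul]; congr 1; ring
  have hne : s x * s x + δ ≠ 0 := by
    intro h
    have hre := congrArg Complex.re h
    have him := congrArg Complex.im h
    simp at hre him
    have h3 := hs x
    rcases lt_or_ge 0 (s x).re with h4 | h4
    · have : (s x).im = 0 := by nlinarith
      rw [this] at hre; nlinarith
    · have : ‖s x‖ = 0 := by nlinarith [norm_nonneg (s x)]
      rw [norm_eq_zero] at this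
      rw [this] at hre; simp at hre; linarith
  have ha2 : a x * a x = s x * s x + δ := by
    rw [ea, ← Complex.exp_add, add_halves, Complex.exp_log hne]
  have har : 0 ≤ (a x).re := by
    rw [ea, Complex.exp_re]
    apply mul_nonneg (Real.exp_pos _).le
    have e : (Complex.log (s x * s x + δ) / 2).im = (s x * s x + δ).arg / 2 := by
      rw [← Complex.log_im]; simp
    rw [e]
    apply Real.cos_nonneg_of_mem_Icc
    constructor <;> linarith [Complex.neg_pi_lt_arg (s x * s x + δ), Complex.arg_le_pi (s x * s x + δ)]
  have k1 : ‖a x - s x‖ * ‖a x + s x‖ = δ := by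
    rw [← norm_mul, show (a x - s x) * (a x + s x) = (δ : ℂ) by linear_combination ha2]
    simp [abs_of_pos hδ0]
  have k2 : c * ‖s x‖ ≤ ‖a x + s x‖ := by
    have := Complex.re_le_norm (a x + s x)
    rw [Complex.add_re] at this
    linarith [hs x]
  have k3 : ‖a x - s x‖ ≤ (1 + 2 / c) * ‖a x + s x‖ := by
    have e : a x - s x = (a x + s x) - 2 * s x := by ring
    have : ‖a x - s x‖ ≤ ‖a x + s x‖ + 2 * ‖s x‖ := by
      rw [e]; refine (norm_sub_le _ _).trans ?_; simp
    have k4 : ‖s x‖ ≤ ‖a x + s x‖ / c := by rw [le_div_iff₀ hc0]; linarith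
    calc _ ≤ _ := this
      _ ≤ ‖a x + s x‖ + 2 * (‖a x + s x‖ / c) := by linarith
      _ = _ := by ring
  have k5 : ‖a x - s x‖ ^ 2 ≤ ε ^ 2 := by
    have : ε ^ 2 = (1 + 2 / c) * δ := by rw [hδ]; field_simp
    rw [this, ← k1]
    nlinarith [norm_nonneg (a x - s x)]
  exact abs_le_of_sq_le_sq' k5 hε.le |>.2

end FHP

namespace FHP
open MeasureTheory

lemma integrableOn_inv_norm (R : ℝ) : IntegrableOn (fun u : ℂ => ‖u‖⁻¹) (closedBall 0 R) := by
  have h := locallyIntegrable_of_norm_le_rpow (E := ℂ) (F := ℝ) (μ := volume)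
    (f := fun u : ℂ => ‖u‖⁻¹) (C := 1) (α := 1) (by simp) (by simp)
    (Filter.Eventually.of_forall fun x => by simp [Real.rpow_neg_one])
    (by fun_prop)
  exact h.integrableOn_isCompact (isCompact_closedBall 0 R)

lemma integrableOn_inv_sub (z : ℂ) (R : ℝ) :
    IntegrableOn (fun b : ℂ => (z - b)⁻¹) (closedBall 0 R) := by
  have h := locallyIntegrable_of_norm_le_rpow (E := ℂ) (F := ℂ) (μ := volume)
    (f := fun u : ℂ => u⁻¹) (C := 1) (α := 1) (by simp) (by simp)
    (Filter.Eventually.of_forall fun x => by simp [Real.rpow_neg_one])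
    (by fun_prop)
  have h2 := h.integrableOn_isCompact (isCompact_closedBall z R)
  rw [← integrable_indicator_iff measurableSet_closedBall] at h2 ⊢
  have h3 := h2.comp_sub_left z
  refine h3.congr (Filter.Eventually.of_forall fun b => ?_)
  simp [Set.indicator]

lemma circle_inner (z : ℂ) (ρ : ℝ) (hρ : 0 < ρ) (hne : ρ ≠ ‖z‖) :
    ∫ θ in Set.Ioo (-Real.pi) Real.pi, (z - circleMap 0 ρ θ)⁻¹ =
      if ρ < ‖z‖ then 2 * Real.pi / z else 0 := by
  have e1 : ∫ θ in Set.Ioo (-Real.pi) Real.pi, (z - circleMap 0 ρ θ)⁻¹ =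
      ∫ θ in (0 : ℝ)..(2 * Real.pi), (z - circleMap 0 ρ θ)⁻¹ := by
    rw [← integral_Ioc_eq_integral_Ioo, ← intervalIntegral.integral_of_le (by linarith [Real.pi_pos])]
    have hp : Function.Periodic (fun θ => (z - circleMap 0 ρ θ)⁻¹) (2 * Real.pi) := by
      intro θ; simp only [periodic_circleMap 0 ρ θ]
    have := hp.intervalIntegral_add_eq (-Real.pi) 0
    rw [zero_add] at this
    rw [← this]
    congr 1; ring
  rw [e1]
  split_ifs with h
  · have hd : DifferentiableOn ℂ (fun b : ℂ => (z - b)⁻¹) (closedBall 0 |ρ|) := by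
      intro b hb
      have : z - b ≠ 0 := by
        intro h0
        rw [sub_eq_zero] at h0
        rw [mem_closedBall_zero_iff, ← h0, abs_of_pos hρ] at hb
        linarith
      fun_prop (disch := assumption)
    have h2 := (hd.diffContOnCl_ball (U := closedBall 0 |ρ|) subset_rfl).circleAverage
    rw [Real.circleAverage_def] at h2
    rw [sub_zero] at h2
    have hpi : (Real.pi : ℂ) ≠ 0 := by exact_mod_cast Real.pi_ne_zero
    rw [div_eq_mul_inv, ← h2]
    simp only [real_smul]
    push_cast
    field_simp
  · have h' : ‖z‖ < ρ := lt_of_le_of_ne (not_lt.1 h) (Ne.symm hne)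
    have hb : ∀ θ, z - circleMap 0 ρ θ ≠ 0 := by
      intro θ h0
      rw [sub_eq_zero] at h0
      have := congrArg norm h0
      rw [norm_circleMap_zero, abs_of_pos hρ] at this
      linarith
    have hb0 : ∀ θ, circleMap 0 ρ θ ≠ 0 := fun θ => circleMap_ne_center hρ.ne'
    by_cases hz : z = 0
    · subst hz
      have h3 : (∮ b in C(0, ρ), (b - 0) ^ (-2 : ℤ)) = 0 :=
        circleIntegral.integral_sub_zpow_of_ne (by norm_num) _ _ _
      rw [circleIntegral] at h3
      have e : ∀ θ, deriv (circleMap 0 ρ) θ • (circleMap 0 ρ θ - 0) ^ (-2 : ℤ) =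
          (-I) * (0 - circleMap 0 ρ θ)⁻¹ := by
        intro θ
        have := hb0 θ
        simp only [deriv_circleMap, smul_eq_mul, sub_zero, zero_sub]
        rw [zpow_neg]
        field_simp
      simp only [e] at h3
      rw [intervalIntegral.integral_const_mul] at h3
      exact (mul_eq_zero.1 h3).resolve_left (by simp)
    · have h3 : (∮ b in C(0, ρ), (b - z)⁻¹) = 2 * Real.pi * I :=
        circleIntegral.integral_sub_inv_of_mem_ball (by simpa using h')
      rw [circleIntegral] at h3
      have e : ∀ θ, deriv (circleMap 0 ρ) θ • (circleMap 0 ρ θ - z)⁻¹ =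
          I - I * z * (z - circleMap 0 ρ θ)⁻¹ := by
        intro θ
        have h5 := hb θ
        have h6 : circleMap 0 ρ θ - z ≠ 0 := by rw [← neg_sub]; exact neg_ne_zero.2 h5
        simp only [deriv_circleMap, smul_eq_mul]
        have h7 : (circleMap 0 ρ θ - z)⁻¹ = - (z - circleMap 0 ρ θ)⁻¹ := by
          rw [← neg_sub, inv_neg]
        rw [h7]
        field_simp
        ring
      simp only [e] at h3
      have hc : Continuous fun θ => (z - circleMap 0 ρ θ)⁻¹ :=
        Continuous.inv₀ (by fun_prop) hb
      rw [intervalIntegral.integral_sub (by simp) ((by fun_prop : Continuous fun θ => I * z * (z - circleMap 0 ρ θ)⁻¹).intervalIntegrable _ _),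
        intervalIntegral.integral_const_mul] at h3
      simp at h3
      exact h3.resolve_left hz

lemma disc_integral (z : ℂ) (R : ℝ) (hz : ‖z‖ ≤ R) :
    ∫ b in closedBall (0 : ℂ) R, (z - b)⁻¹ = Real.pi * conj z := by
  have hintg := integrableOn_inv_sub z R
  rw [← integral_indicator measurableSet_closedBall, ← Complex.integral_comp_polarCoord_symm]
  rw [← integrable_indicator_iff measurableSet_closedBall] at hintg
  set g : ℂ → ℂ := (closedBall (0 : ℂ) R).indicator fun b => (z - b)⁻¹ with hg
  have hgm : Measurable g := by
    apply Measurable.indicator _ measurableSet_closedBall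
    fun_prop
  have hpolar : ∀ p : ℝ × ℝ, Complex.polarCoord.symm p = circleMap 0 p.1 p.2 := by
    intro p
    rw [Complex.polarCoord_symm_apply, circleMap, Complex.exp_mul_I, zero_add]
    push_cast
    rfl
  have hcm : Measurable fun p : ℝ × ℝ => circleMap 0 p.1 p.2 := by
    unfold circleMap
    fun_prop
  have hpi : IntegrableOn (fun p : ℝ × ℝ => p.1 • g (Complex.polarCoord.symm p)) polarCoord.target
      (volume.prod volume) := by
    refine ⟨?_, ?_⟩
    · apply Measurable.aestronglyMeasurable
      simp only [hpolar]
      exact measurable_fst.smul (hgm.comp hcm)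
    · have h1 := Complex.lintegral_comp_polarCoord_symm (fun b => ‖g b‖ₑ)
      have h2 := hintg.2
      rw [HasFiniteIntegral, ← h1] at h2
      rw [HasFiniteIntegral]
      refine lt_of_le_of_lt (le_of_eq ?_) h2
      apply setLIntegral_congr_fun polarCoord.open_target.measurableSet
      intro p hp
      have hp1 : 0 < p.1 := hp.1
      simp only
      rw [enorm_smul, Real.enorm_of_nonneg hp1.le, smul_eq_mul]
  rw [polarCoord_target] at *
  rw [Measure.volume_eq_prod, setIntegral_prod _ hpi]
  simp only [hpolar]
  have hin : ∀ᵐ ρ : ℝ ∂(volume.restrict (Set.Ioi (0 : ℝ))),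
      (∫ θ in Set.Ioo (-Real.pi) Real.pi, ρ • g (circleMap 0 ρ θ)) =
        (Set.Ioo 0 ‖z‖).indicator (fun ρ : ℝ => (ρ : ℂ) * (2 * Real.pi / z)) ρ := by
    have hne : ∀ᵐ ρ : ℝ ∂(volume.restrict (Set.Ioi (0 : ℝ))), ρ ≠ ‖z‖ :=
      ae_restrict_of_ae (Measure.ae_ne volume ‖z‖)
    filter_upwards [hne, ae_restrict_mem measurableSet_Ioi] with ρ h1 h2
    have h2 : 0 < ρ := h2
    rw [integral_smul]
    by_cases hR : ρ ≤ R
    · have : ∀ θ, g (circleMap 0 ρ θ) = (z - circleMap 0 ρ θ)⁻¹ := by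
        intro θ
        rw [hg, Set.indicator_of_mem]
        simp [abs_of_pos h2, hR]
      simp only [this]
      rw [circle_inner z ρ h2 h1]
      by_cases h3 : ρ < ‖z‖
      · rw [Set.indicator_of_mem (by exact ⟨h2, h3⟩), if_pos h3]; simp
      · rw [Set.indicator_of_notMem (by intro h; exact h3 h.2), if_neg h3]; simp
    · have : ∀ θ, g (circleMap 0 ρ θ) = 0 := by
        intro θ
        rw [hg, Set.indicator_of_notMem]
        simp [abs_of_pos h2]
        linarith
      simp only [this]
      rw [Set.indicator_of_notMem (by intro h; have := h.2; linarith)]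
      simp
  rw [integral_congr_ae hin, setIntegral_indicator measurableSet_Ioo]
  have e : Set.Ioi (0 : ℝ) ∩ Set.Ioo 0 ‖z‖ = Set.Ioo 0 ‖z‖ := by
    ext x; simp
  rw [e, ← integral_Ioc_eq_integral_Ioo, ← intervalIntegral.integral_of_le (norm_nonneg z),
    intervalIntegral.integral_mul_const, intervalIntegral.integral_ofReal, integral_id]
  by_cases h0 : z = 0
  · simp [h0]
  · have h3 : ((‖z‖ : ℝ) : ℂ) ^ 2 = z * conj z := by
      rw [Complex.mul_conj, Complex.normSq_eq_norm_sq]; push_cast; rfl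
    push_cast
    rw [h3]
    field_simp
    ring

/-- the error kernel integral tends to zero -/
lemma kernel_small (R c ε : ℝ) (hc : 0 < c) (hε : 0 < ε) : ∃ δ : ℝ, 0 < δ ∧
    ∫ u in closedBall (0 : ℂ) R, δ / (c * ‖u‖ ^ 2 + δ) * ‖u‖⁻¹ < ε := by
  have h : Filter.Tendsto (fun δ : ℝ => ∫ u in closedBall (0 : ℂ) R,
      δ / (c * ‖u‖ ^ 2 + δ) * ‖u‖⁻¹) (nhdsWithin 0 (Set.Ioi 0)) (nhds (∫ u in closedBall (0 : ℂ) R, (0 : ℝ))) := by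
    refine tendsto_integral_filter_of_dominated_convergence (fun u : ℂ => ‖u‖⁻¹) ?_ ?_
      (integrableOn_inv_norm R) ?_
    · filter_upwards with δ
      apply Measurable.aestronglyMeasurable
      fun_prop
    · filter_upwards [self_mem_nhdsWithin] with δ hδ
      have hδ : 0 < δ := hδ
      filter_upwards with u
      rw [norm_mul, norm_inv, norm_norm]
      have : ‖δ / (c * ‖u‖ ^ 2 + δ)‖ ≤ 1 := by
        rw [Real.norm_of_nonneg (by positivity), div_le_one (by positivity)]
        have : 0 ≤ c * ‖u‖ ^ 2 := by positivity
        linarith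
      calc _ ≤ 1 * ‖u‖⁻¹ := by gcongr
        _ = _ := one_mul _
    · filter_upwards with u
      by_cases hu : u = 0
      · simp [hu]
      · have hu' : 0 < ‖u‖ := norm_pos_iff.2 hu
        have : ContinuousAt (fun δ : ℝ => δ / (c * ‖u‖ ^ 2 + δ) * ‖u‖⁻¹) 0 := by
          have : c * ‖u‖ ^ 2 + 0 ≠ 0 := by positivity
          fun_prop (disch := assumption)
        have h2 := this.tendsto
        simp only [zero_div, zero_mul] at h2
        exact h2.mono_left nhdsWithin_le_nhds
  simp only [integral_zero] at h
  have h2 := (h.eventually (gt_mem_nhds hε)).and self_mem_nhdsWithin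
  obtain ⟨δ, h3, h4⟩ := h2.exists
  exact ⟨δ, h4, h3⟩

end FHP

namespace FHP
open MeasureTheory

/-- For `H` close to `conj (z - b)`, the function `conj z` is in the algebra. -/
lemma conj_mem {X : Type*} [TopologicalSpace X] [CompactSpace X]
    (A : Subalgebra ℂ C(X, ℂ)) (hA : IsClosed (A : Set C(X, ℂ))) (z : C(X, ℂ)) (hz : z ∈ A)
    (R : ℝ) (hzR : ∀ x, ‖z x‖ ≤ R) (H : C(closedBall (0 : ℂ) R × X, ℂ))
    (hH : ∀ b, H.curry b ∈ A) (k : ℝ) (hk : k < 1)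
    (hHk : ∀ (b : closedBall (0 : ℂ) R) x, ‖H (b, x) - conj (z x - b)‖ ≤ k * ‖z x - b‖) : star z ∈ A := by
  have hre : ∀ (b : closedBall (0 : ℂ) R) x, (1 - k) * ‖z x - b‖ ^ 2 ≤ ((z x - b) * H (b, x)).re := by
    intro b x
    have e : (z x - b) * H (b, x) = (z x - b) * conj (z x - b) +
        (z x - b) * (H (b, x) - conj (z x - b)) := by ring
    have h1 : ((z x - (b : ℂ)) * conj (z x - b)).re = ‖z x - b‖ ^ 2 := by
      rw [Complex.mul_conj, Complex.normSq_eq_norm_sq, Complex.ofReal_re]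
    have h2 := (abs_le.1 (Complex.abs_re_le_norm ((z x - b) * (H (b, x) - conj (z x - b))))).1
    rw [norm_mul] at h2
    rw [e, Complex.add_re, h1]
    nlinarith [hHk b x, norm_nonneg (z x - b)]
  have hre0 : ∀ (b : closedBall (0 : ℂ) R) x, 0 ≤ ((z x - b) * H (b, x)).re := fun b x =>
    le_trans (mul_nonneg (by linarith) (by positivity)) (hre b x)
  have hlow : ∀ (b : closedBall (0 : ℂ) R) x (δ : ℝ), 0 < δ → (1 - k) * ‖z x - b‖ ^ 2 + δ ≤ ‖(z x - b) * H (b, x) + δ‖ := by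
    intro b x δ hδ
    have h1 := Complex.re_le_norm ((z x - b) * H (b, x) + δ)
    rw [Complex.add_re, Complex.ofReal_re] at h1
    linarith [hre b x]
  have hne : ∀ (b : closedBall (0 : ℂ) R) x (δ : ℝ), 0 < δ → (z x - b) * H (b, x) + δ ≠ 0 := by
    intro b x δ hδ h
    have h1 := hlow b x δ hδ
    rw [h, norm_zero] at h1
    have : 0 ≤ (1 - k) * ‖z x - b‖ ^ 2 := mul_nonneg (by linarith) (by positivity)
    linarith
  let μ : Measure (closedBall (0 : ℂ) R) := Measure.comap Subtype.val volume
  have hfin : IsFiniteMeasure μ := by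
    refine ⟨?_⟩
    rw [comap_subtype_coe_apply measurableSet_closedBall, Set.image_univ, Subtype.range_coe]
    exact measure_closedBall_lt_top
  have key : ((Real.pi : ℂ) • star z) ∈ A := by
    apply mem_of_approx A hA
    intro ε hε
    obtain ⟨δ, hδ, hker⟩ := kernel_small (2 * R) (1 - k) ε (by linarith) hε
    let Ψ : C(closedBall (0 : ℂ) R × X, ℂ) :=
      ⟨fun p => H p * ((z p.2 - p.1) * H p + δ)⁻¹, by
        apply Continuous.mul H.continuous
        apply Continuous.inv₀
        · fun_prop
        · intro p; exact hne p.1 p.2 δ hδ⟩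
    have hΨ : ∀ b, Ψ.curry b ∈ A := by
      intro b
      let g : C(X, ℂ) := (z - algebraMap ℂ C(X, ℂ) (b : ℂ)) * H.curry b
      have hg : g ∈ A := A.mul_mem (A.sub_mem hz (A.algebraMap_mem _)) (hH b)
      have hgx : ∀ x, g x = (z x - b) * H (b, x) := fun x => rfl
      obtain ⟨a, ha, h1⟩ := resolvent_mem A hA g hg (κ := 0) le_rfl one_pos
        (by intro x; rw [hgx]; simpa using hre0 b x) hδ
      have : Ψ.curry b = H.curry b * a := by
        ext x
        change H (b, x) * ((z x - b) * H (b, x) + δ)⁻¹ = H (b, x) * a x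
        congr 1
        apply inv_eq_of_mul_eq_one_left
        rw [← h1 x, hgx]
      rw [this]
      exact A.mul_mem (hH b) ha
    obtain ⟨a, ha, h1⟩ := integral_mem' A hA μ Ψ.curry hΨ
    refine ⟨a, ha, fun x => ?_⟩
    have e1 : ((Real.pi : ℂ) • star z) x = ∫ b : closedBall (0 : ℂ) R, (z x - b)⁻¹ ∂μ := by
      have h2 := disc_integral (z x) R (hzR x)
      rw [← integral_subtype_comap measurableSet_closedBall] at h2
      exact h2.symm
    have i1 : Integrable (fun b : closedBall (0 : ℂ) R => (z x - b)⁻¹) μ := by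
      have := integrableOn_inv_sub (z x) R
      exact (integrableOn_iff_comap_subtypeVal measurableSet_closedBall).1 this
    have i2 : Integrable (fun b : closedBall (0 : ℂ) R => Ψ.curry b x) μ := by
      refine Integrable.of_bound (C := ‖Ψ‖) ?_ (Filter.Eventually.of_forall fun y => Ψ.norm_coe_le_norm (y, x))
      apply Continuous.aestronglyMeasurable
      exact Ψ.continuous.comp (by fun_prop)
    set K : ℂ → ℝ := fun u => δ / ((1 - k) * ‖u‖ ^ 2 + δ) * ‖u‖⁻¹ with hK
    have hKnn : ∀ u, 0 ≤ K u := by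
      intro u
      have : 0 ≤ (1 - k) * ‖u‖ ^ 2 := mul_nonneg (by linarith) (by positivity)
      positivity
    have hKm : Measurable K := by rw [hK]; fun_prop
    have hKi : IntegrableOn K (closedBall 0 (2 * R)) := by
      refine Integrable.mono' (integrableOn_inv_norm (2 * R)) hKm.aestronglyMeasurable
        (Filter.Eventually.of_forall fun u => ?_)
      rw [Real.norm_of_nonneg (hKnn u)]
      have h0 : 0 ≤ (1 - k) * ‖u‖ ^ 2 := mul_nonneg (by linarith) (by positivity)
      have : δ / ((1 - k) * ‖u‖ ^ 2 + δ) ≤ 1 := by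
        rw [div_le_one (by positivity)]; linarith
      calc K u ≤ 1 * ‖u‖⁻¹ := by rw [hK]; dsimp only; gcongr
        _ = _ := one_mul _
    have hpt : ∀ b : closedBall (0 : ℂ) R, (b : ℂ) ≠ z x →
        ‖Ψ.curry b x - (z x - b)⁻¹‖ ≤ K (z x - b) := by
      intro b hb
      have hb' : z x - b ≠ 0 := sub_ne_zero.2 (Ne.symm hb)
      have hn := hne b x δ hδ
      have e : Ψ.curry b x - (z x - b)⁻¹ =
          - (δ * ((z x - b) * H (b, x) + δ)⁻¹ * (z x - b)⁻¹) := by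
        change H (b, x) * ((z x - b) * H (b, x) + δ)⁻¹ - (z x - b)⁻¹ = _
        generalize hN : (z x - b) * H (b, x) + δ = N at hn
        generalize z x - b = y at *
        have : (δ : ℂ) = N - y * H (b, x) := by rw [← hN]; ring
        rw [this]
        field_simp
        ring
      rw [e, norm_neg, norm_mul, norm_mul, norm_inv, norm_inv, Complex.norm_real,
        Real.norm_of_nonneg hδ.le]
      have h0 : 0 ≤ (1 - k) * ‖z x - b‖ ^ 2 := mul_nonneg (by linarith) (by positivity)
      have h1 := hlow b x δ hδ
      change _ ≤ δ / ((1 - k) * ‖z x - b‖ ^ 2 + δ) * ‖z x - b‖⁻¹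
      rw [div_eq_mul_inv]
      gcongr
    -- the translated kernel
    have hsub : IntegrableOn (fun b : ℂ => K (z x - b)) (closedBall 0 R) ∧
        ∫ b in closedBall (0 : ℂ) R, K (z x - b) ≤ ∫ u in closedBall (0 : ℂ) (2 * R), K u := by
      have hKi2 := hKi
      rw [← integrable_indicator_iff measurableSet_closedBall] at hKi2
      have h3 := hKi2.comp_sub_left (z x)
      have h4 : ∀ b ∈ closedBall (0 : ℂ) R,
          K (z x - b) = (closedBall (0 : ℂ) (2 * R)).indicator K (z x - b) := by
        intro b hb
        rw [Set.indicator_of_mem]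
        rw [mem_closedBall_zero_iff] at hb ⊢
        have := norm_sub_le (z x) b
        linarith [hzR x]
      constructor
      · exact (h3.integrableOn (s := closedBall 0 R)).congr_fun (fun b hb => (h4 b hb).symm)
          measurableSet_closedBall
      · rw [setIntegral_congr_fun measurableSet_closedBall h4,
          ← integral_indicator (measurableSet_closedBall (x := (0 : ℂ)) (ε := 2 * R)),
          ← integral_sub_left_eq_self ((closedBall (0 : ℂ) (2 * R)).indicator K) volume (z x)]
        apply setIntegral_le_integral h3
        exact Filter.Eventually.of_forall fun b => Set.indicator_nonneg (fun u _ => hKnn u) _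
    have hae : ∀ᵐ b : closedBall (0 : ℂ) R ∂μ, (b : ℂ) ≠ z x := by
      have h5 := (ae_restrict_iff_subtype (μ := (volume : Measure ℂ)) (s := closedBall (0 : ℂ) R) measurableSet_closedBall (p := fun b => b ≠ z x)).1
        (ae_restrict_of_ae (Measure.ae_ne volume (z x)))
      exact h5
    rw [e1, h1, ← integral_sub i2 i1]
    refine (norm_integral_le_of_norm_le (g := fun b : closedBall (0 : ℂ) R => K (z x - b)) ?_ ?_).trans ?_
    · exact (integrableOn_iff_comap_subtypeVal measurableSet_closedBall).1 hsub.1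
    · filter_upwards [hae] with b hb
      exact hpt b hb
    · have h6 := integral_subtype_comap (μ := (volume : Measure ℂ)) (s := closedBall (0 : ℂ) R) measurableSet_closedBall (fun b => K (z x - b))
      change ∫ b : closedBall (0 : ℂ) R, K (z x - b) ∂μ = _ at h6
      rw [h6]
      linarith [hsub.2]
  have := A.smul_mem key ((Real.pi : ℂ)⁻¹)
  rwa [smul_smul, inv_mul_cancel₀ (by exact_mod_cast Real.pi_ne_zero), one_smul] at this

end FHP

namespace FHP

/-- principal square root of `1 + u` -/
def sq (u : ℂ) : ℂ := exp (log (1 + u) / 2)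

lemma sq_mul_self {u : ℂ} (hu : ‖u‖ ≤ 1 / 2) : sq u * sq u = 1 + u := by
  have h : 1 + u ≠ 0 := by
    intro h
    have : u = -1 := by linear_combination h
    rw [this] at hu
    norm_num at hu
  rw [sq, ← Complex.exp_add, add_halves, Complex.exp_log h]

lemma sq_re_nonneg (u : ℂ) : 0 ≤ (sq u).re := by
  rw [sq, Complex.exp_re]
  apply mul_nonneg (Real.exp_pos _).le
  have h1 : (log (1 + u) / 2).im = arg (1 + u) / 2 := by
    have : (log (1 + u) / 2) = ((1 / 2 : ℝ) : ℂ) * log (1 + u) := by push_cast; ring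
    rw [this, Complex.im_ofReal_mul, Complex.log_im]; ring
  rw [h1]
  apply Real.cos_nonneg_of_neg_pi_div_two_le_of_le
  · linarith [Complex.neg_pi_lt_arg (1 + u)]
  · linarith [Complex.arg_le_pi (1 + u)]

lemma sq_sub_one {u : ℂ} (hu : ‖u‖ ≤ 1 / 2) : ‖sq u - 1‖ ≤ ‖u‖ := by
  have h1 : (sq u - 1) * (sq u + 1) = u := by linear_combination sq_mul_self hu
  have h2 : 1 ≤ ‖sq u + 1‖ := by
    have := Complex.re_le_norm (sq u + 1)
    rw [Complex.add_re, Complex.one_re] at this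
    linarith [sq_re_nonneg u]
  have h3 : ‖sq u - 1‖ * ‖sq u + 1‖ = ‖u‖ := by rw [← norm_mul, h1]
  nlinarith [norm_nonneg (sq u - 1)]

lemma sq_re {u : ℂ} (hu : ‖u‖ ≤ 1 / 2) : 1 / 2 ≤ (sq u).re := by
  have h1 := (abs_le.1 (Complex.abs_re_le_norm (sq u - 1))).1
  rw [Complex.sub_re, Complex.one_re] at h1
  linarith [sq_sub_one hu]

lemma sq_sub_sq {u v : ℂ} (hu : ‖u‖ ≤ 1 / 2) (hv : ‖v‖ ≤ 1 / 2) : ‖sq u - sq v‖ ≤ ‖u - v‖ := by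
  have h1 : (sq u - sq v) * (sq u + sq v) = u - v := by
    linear_combination sq_mul_self hu - sq_mul_self hv
  have h2 : 1 ≤ ‖sq u + sq v‖ := by
    have := Complex.re_le_norm (sq u + sq v)
    rw [Complex.add_re] at this
    linarith [sq_re hu, sq_re hv]
  have h3 : ‖sq u - sq v‖ * ‖sq u + sq v‖ = ‖u - v‖ := by rw [← norm_mul, h1]
  nlinarith [norm_nonneg (sq u - sq v)]

lemma sq_zero : sq 0 = 1 := by simp [sq]

/-- the real linear form `conj z + a z` -/
def Lf (a : ℝ) (z : ℂ) : ℂ := conj z + a * z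

lemma Lf_sub (a : ℝ) (z w : ℂ) : Lf a z - Lf a w = Lf a (z - w) := by
  simp only [Lf, map_sub]; ring

lemma Lf_lower {a : ℝ} (ha : 0 ≤ a) (z : ℂ) : (1 - a) * ‖z‖ ≤ ‖Lf a z‖ := by
  have h := norm_sub_norm_le (conj z) (-((a : ℂ) * z))
  rw [norm_neg, norm_mul, Complex.norm_real, Real.norm_of_nonneg ha, sub_neg_eq_add,
    Complex.norm_conj] at h
  rw [Lf]; linarith

lemma Lf_upper {a : ℝ} (ha : 0 ≤ a) (ha1 : a ≤ 1) (z : ℂ) : ‖Lf a z‖ ≤ 2 * ‖z‖ := by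
  have h := norm_add_le (conj z) ((a : ℂ) * z)
  rw [norm_mul, Complex.norm_real, Real.norm_of_nonneg ha, Complex.norm_conj] at h
  rw [Lf]; nlinarith [norm_nonneg z]

/-- the square root of `L(z)^2 + g` -/
def zt (a : ℝ) (z g : ℂ) : ℂ := Lf a z * sq (g / Lf a z ^ 2)

/-- the size of the perturbation -/
def ep (a : ℝ) : ℝ := (1 - a) ^ 5 / 40

lemma ep_pos {a : ℝ} (ha1 : a < 1) : 0 < ep a := by
  have : 0 < 1 - a := by linarith
  rw [ep]; positivity

lemma quot_bound {a : ℝ} (ha : 0 < a) (ha1 : a < 1) {z g : ℂ} (hg : ‖g‖ ≤ ep a * ‖z‖ ^ 2) :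
    ‖g / Lf a z ^ 2‖ ≤ (1 - a) ^ 3 / 40 := by
  have hc : 0 < 1 - a := by linarith
  have h1 := Lf_lower ha.le z
  rw [norm_div, norm_pow]
  by_cases hz : z = 0
  · subst hz
    have : Lf a 0 = 0 := by simp [Lf]
    rw [this]; simp; positivity
  have hz' : 0 < ‖z‖ := norm_pos_iff.2 hz
  have h2 : ((1 - a) * ‖z‖) ^ 2 ≤ ‖Lf a z‖ ^ 2 := by gcongr
  have h3 : 0 < ((1 - a) * ‖z‖) ^ 2 := by positivity
  rw [div_le_iff₀ (by linarith)]
  calc ‖g‖ ≤ ep a * ‖z‖ ^ 2 := hg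
    _ = (1 - a) ^ 3 / 40 * ((1 - a) * ‖z‖) ^ 2 := by rw [ep]; ring
    _ ≤ _ := by gcongr

lemma quot_bound' {a : ℝ} (ha : 0 < a) (ha1 : a < 1) {z g : ℂ} (hg : ‖g‖ ≤ ep a * ‖z‖ ^ 2) :
    ‖g / Lf a z ^ 2‖ ≤ 1 / 2 := by
  refine (quot_bound ha ha1 hg).trans ?_
  have : (1 - a) ^ 3 ≤ 1 := pow_le_one₀ (by linarith) (by linarith)
  linarith

lemma zt_sq {a : ℝ} (ha : 0 < a) (ha1 : a < 1) {z g : ℂ} (hg : ‖g‖ ≤ ep a * ‖z‖ ^ 2) :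
    zt a z g * zt a z g = Lf a z ^ 2 + g := by
  by_cases hz : z = 0
  · subst hz
    have h0 : Lf a 0 = 0 := by simp [Lf]
    have h1 : g = 0 := by simpa using hg
    simp [zt, h0, h1]
  have h : Lf a z ≠ 0 := by
    intro h
    have h1 := Lf_lower ha.le z
    rw [h, norm_zero] at h1
    have := norm_pos_iff.2 hz
    nlinarith
  calc zt a z g * zt a z g = Lf a z ^ 2 * (sq (g / Lf a z ^ 2) * sq (g / Lf a z ^ 2)) := by
        rw [zt]; ring
    _ = _ := by
      rw [sq_mul_self (quot_bound' ha ha1 hg)]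
      field_simp

lemma zt_lip_aux {a : ℝ} (ha : 0 < a) (ha1 : a < 1) {z z' g g' : ℂ}
    (hg : ‖g‖ ≤ ep a * ‖z‖ ^ 2) (hg' : ‖g'‖ ≤ ep a * ‖z'‖ ^ 2) (hzz : ‖z'‖ ≤ ‖z‖)
    (hgg : ‖g - g'‖ ≤ ep a * ‖z‖ * ‖z - z'‖) :
    ‖zt a z g - zt a z' g' - conj (z - z')‖ ≤ (1 + a) / 2 * ‖z - z'‖ := by
  have hc : 0 < 1 - a := by linarith
  by_cases hz : z = 0
  · subst hz
    have : z' = 0 := by simpa using hzz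
    subst this
    simp [zt, Lf]
  have hz0 : 0 < ‖z‖ := norm_pos_iff.2 hz
  set c := 1 - a with hcdef
  have hl1 := Lf_lower ha.le z
  have hl1' := Lf_lower ha.le z'
  have hl2 := Lf_upper ha.le ha1.le z
  have hl2' := Lf_upper ha.le ha1.le z'
  have hd := Lf_upper ha.le ha1.le (z - z')
  rw [← Lf_sub] at hd
  have hu := quot_bound ha ha1 hg
  have hu2 := quot_bound' ha ha1 hg
  have hu2' := quot_bound' ha ha1 hg'
  set l := Lf a z with hl
  set l' := Lf a z' with hl'
  set D := ‖z - z'‖ with hD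
  have hD0 : 0 ≤ D := norm_nonneg _
  have hc3 : c ^ 3 ≤ c := by
    have : c ^ 2 ≤ 1 := pow_le_one₀ hc.le (by linarith)
    nlinarith
  have hl0 : 0 < ‖l‖ := by
    have : 0 < c * ‖z‖ := by positivity
    linarith
  have ep0 := ep_pos ha1
  -- second term
  have hT2 : ‖l'‖ * ‖g / l ^ 2 - g' / l' ^ 2‖ ≤ 9 * c / 20 * D := by
    by_cases hz' : z' = 0
    · have : l' = 0 := by rw [hl', hz']; simp [Lf]
      rw [this, norm_zero, zero_mul]; positivity
    have hz0' : 0 < ‖z'‖ := norm_pos_iff.2 hz'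
    have hl0' : 0 < ‖l'‖ := by
      have : 0 < c * ‖z'‖ := by positivity
      linarith
    have hln : l ≠ 0 := norm_pos_iff.1 hl0
    have hln' : l' ≠ 0 := norm_pos_iff.1 hl0'
    have e : g / l ^ 2 - g' / l' ^ 2 = (g - g') / l ^ 2 - g' * (l - l') * (l + l') / (l ^ 2 * l' ^ 2) := by
      field_simp; ring
    have h1 : ‖(g - g') / l ^ 2‖ ≤ ep a * ‖z‖ * D / (c * ‖z‖) ^ 2 := by
      rw [norm_div, norm_pow]; gcongr
    have hs : ‖l + l'‖ ≤ 4 * ‖z‖ := (norm_add_le _ _).trans (by linarith)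
    have h2 : ‖g' * (l - l') * (l + l') / (l ^ 2 * l' ^ 2)‖ ≤
        (ep a * ‖z'‖ ^ 2) * (2 * D) * (4 * ‖z‖) / ((c * ‖z‖) ^ 2 * (c * ‖z'‖) ^ 2) := by
      rw [norm_div, norm_mul, norm_mul, norm_mul, norm_pow, norm_pow]; gcongr
    have h3 : ‖g / l ^ 2 - g' / l' ^ 2‖ ≤ (c ^ 3 / 40 + c / 5) * D / ‖z‖ := by
      rw [e]
      refine (norm_sub_le _ _).trans ((add_le_add h1 h2).trans (le_of_eq ?_))
      rw [ep]; field_simp; ring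
    calc ‖l'‖ * ‖g / l ^ 2 - g' / l' ^ 2‖ ≤ (2 * ‖z‖) * ((c ^ 3 / 40 + c / 5) * D / ‖z‖) := by
          gcongr; linarith
      _ = (c ^ 3 / 20 + 2 * c / 5) * D := by field_simp; ring
      _ ≤ _ := by gcongr; linarith
  have e : zt a z g - zt a z' g' - conj (z - z') = a * (z - z') +
      ((l - l') * (sq (g / l ^ 2) - 1) + l' * (sq (g / l ^ 2) - sq (g' / l' ^ 2))) := by
    have : l - l' = conj (z - z') + a * (z - z') := by rw [hl, hl', Lf_sub, Lf]
    rw [zt, zt, ← hl, ← hl']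
    linear_combination this
  rw [e]
  calc _ ≤ ‖(a : ℂ) * (z - z')‖ + (‖(l - l') * (sq (g / l ^ 2) - 1)‖ +
        ‖l' * (sq (g / l ^ 2) - sq (g' / l' ^ 2))‖) :=
        (norm_add_le _ _).trans (by gcongr; exact norm_add_le _ _)
    _ ≤ a * D + ((2 * D) * (c / 40) + 9 * c / 20 * D) := by
        gcongr ?_ + (?_ + ?_)
        · rw [norm_mul, Complex.norm_real, Real.norm_of_nonneg ha.le]
        · rw [norm_mul]
          gcongr
          refine (sq_sub_one hu2).trans (hu.trans ?_)
          linarith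
        · rw [norm_mul]
          refine le_trans ?_ hT2
          gcongr
          exact sq_sub_sq hu2 hu2'
    _ ≤ _ := by
        have : a = 1 - c := by rw [hcdef]; ring
        rw [this]; nlinarith

lemma zt_lip {a : ℝ} (ha : 0 < a) (ha1 : a < 1) {z z' g g' : ℂ}
    (hg : ‖g‖ ≤ ep a * ‖z‖ ^ 2) (hg' : ‖g'‖ ≤ ep a * ‖z'‖ ^ 2)
    (hgg : ‖g - g'‖ ≤ ep a * max ‖z‖ ‖z'‖ * ‖z - z'‖) :
    ‖zt a z g - zt a z' g' - conj (z - z')‖ ≤ (1 + a) / 2 * ‖z - z'‖ := by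
  rcases le_total ‖z'‖ ‖z‖ with h | h
  · rw [max_eq_left h] at hgg
    exact zt_lip_aux ha ha1 hg hg' h hgg
  · rw [max_eq_right h, norm_sub_rev, norm_sub_rev z] at hgg
    have := zt_lip_aux ha ha1 hg' hg h hgg
    rw [norm_sub_rev z]
    have e : zt a z g - zt a z' g' - conj (z - z') = -(zt a z' g' - zt a z g - conj (z' - z)) := by
      simp only [map_sub]; ring
    rwa [e, norm_neg]

lemma zt_norm_le {a : ℝ} (ha : 0 < a) (ha1 : a < 1) {z g : ℂ} (hg : ‖g‖ ≤ ep a * ‖z‖ ^ 2) :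
    ‖zt a z g‖ ≤ 2 * ‖z‖ := by
  have h := zt_lip (z' := 0) (g' := 0) ha ha1 hg (by simp) (by
    rw [norm_zero, max_eq_left (norm_nonneg _), sub_zero, sub_zero]; rwa [mul_assoc, ← _root_.sq])
  have h0 : zt a 0 0 = 0 := by simp [zt, Lf]
  rw [h0, sub_zero, sub_zero] at h
  have h1 := norm_sub_norm_le (zt a z g) (conj z)
  rw [Complex.norm_conj] at h1
  nlinarith [norm_nonneg z]

lemma sq_continuousOn : ContinuousOn sq (closedBall 0 (1 / 2)) := by
  have : LipschitzOnWith 1 sq (closedBall 0 (1 / 2)) := by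
    apply LipschitzOnWith.of_dist_le_mul
    intro u hu v hv
    rw [mem_closedBall_zero_iff] at hu hv
    rw [dist_eq_norm, dist_eq_norm]
    simpa using sq_sub_sq hu hv
  exact this.continuousOn

lemma zt_continuous {Y : Type*} [TopologicalSpace Y] {a : ℝ} (ha : 0 < a) (ha1 : a < 1)
    {z g : Y → ℂ} (hz : Continuous z) (hgc : Continuous g)
    (hg : ∀ y, ‖g y‖ ≤ ep a * ‖z y‖ ^ 2) : Continuous fun y => zt a (z y) (g y) := by
  rw [continuous_iff_continuousAt]
  intro y
  by_cases h0 : z y = 0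
  · have h1 : zt a (z y) (g y) = 0 := by
      have := zt_norm_le ha ha1 (hg y)
      rw [h0, norm_zero, mul_zero] at this
      rw [h0]; exact norm_le_zero_iff.1 this
    rw [ContinuousAt, h1]
    apply squeeze_zero_norm (a := fun y => 2 * ‖z y‖) (fun y => zt_norm_le ha ha1 (hg y))
    have : Filter.Tendsto (fun y => 2 * ‖z y‖) (nhds y) (nhds (2 * ‖z y‖)) :=
      (continuous_const.mul hz.norm).continuousAt
    simpa [h0] using this
  · have hl : Continuous fun y => Lf a (z y) := by
      unfold Lf
      exact (Complex.continuous_conj.comp hz).add (continuous_const.mul hz)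
    have hl0 : Lf a (z y) ≠ 0 := by
      intro h
      have h1 := Lf_lower ha.le (z y)
      rw [h, norm_zero] at h1
      have := norm_pos_iff.2 h0
      nlinarith
    have hq : ContinuousAt (fun y => g y / Lf a (z y) ^ 2) y :=
      hgc.continuousAt.div (hl.continuousAt.pow 2) (pow_ne_zero 2 hl0)
    have hsq : ContinuousAt sq (g y / Lf a (z y) ^ 2) := by
      apply sq_continuousOn.continuousAt
      have hlt : ‖g y / Lf a (z y) ^ 2‖ < 1 / 2 := by
        refine (quot_bound ha ha1 (hg y)).trans_lt ?_
        have : (1 - a) ^ 3 ≤ 1 := pow_le_one₀ (by linarith) (by linarith)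
        linarith
      exact Filter.mem_of_superset (isOpen_ball.mem_nhds (mem_ball_zero_iff.2 hlt))
        ball_subset_closedBall
    unfold zt
    exact hl.continuousAt.mul (ContinuousAt.comp (f := fun y => g y / Lf a (z y) ^ 2) hsq hq)

end FHP

namespace FHP

/-- functions of real-valued generators in the algebra -/
lemma comp_mem {X Y : Type*} [TopologicalSpace X] [CompactSpace X] [TopologicalSpace Y]
    [CompactSpace Y]
    (A : Subalgebra ℂ C(X, ℂ)) (hA : IsClosed (A : Set C(X, ℂ))) (π : C(X, Y))
    (S : Set C(Y, ℂ)) (hS : ∀ s ∈ S, s.comp π ∈ A) (hS' : ∀ s ∈ S, star s = s)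
    (hsep : ∀ x y, (∀ s ∈ S, s x = s y) → x = y) (ψ : C(Y, ℂ)) : ψ.comp π ∈ A := by
  let φ : C(Y, ℂ) →ₐ[ℂ] C(X, ℂ) := ContinuousMap.compRightAlgHom ℂ ℂ π
  have hφ : Continuous φ := ContinuousMap.continuous_precomp π
  have h : A.comap φ = ⊤ := by
    apply stone_weierstrass (A.comap φ) (hA.preimage hφ) S (fun s hs => hS s hs) _ hsep
    intro s hs
    rw [hS' s hs]
    exact hS s hs
  have : ψ ∈ A.comap φ := by rw [h]; trivial
  exact this

/-- parameter cube -/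
abbrev Cb (m : ℕ) (T : ℝ) := closedBall (0 : Fin m → ℝ) T

/-- coordinate function on the cube -/
def cf {m : ℕ} {T : ℝ} (i : Fin m) : C(Cb m T, ℂ) :=
  ⟨fun t => ((t.1 i : ℝ) : ℂ),
    Complex.continuous_ofReal.comp ((continuous_apply i).comp continuous_subtype_val)⟩

lemma cf_star {m : ℕ} {T : ℝ} (i : Fin m) : star (cf i : C(Cb m T, ℂ)) = cf i := by
  ext t
  simp [cf]

lemma cf_sep {m : ℕ} {T : ℝ} (x y : Cb m T)
    (h : ∀ s ∈ Set.range (cf : Fin m → C(Cb m T, ℂ)), s x = s y) : x = y := by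
  ext i
  have := h (cf i) ⟨i, rfl⟩
  exact Complex.ofReal_injective this

/-- truncation of coordinates -/
def trunc {m : ℕ} {T : ℝ} (hT : 0 ≤ T) (j : Fin m) : C(Cb m T, Cb m T) :=
  ⟨fun t => ⟨fun i => if i < j then t.1 i else 0, by
    rw [mem_closedBall_zero_iff, pi_norm_le_iff_of_nonneg hT]
    intro i
    have := (pi_norm_le_iff_of_nonneg hT).1 (mem_closedBall_zero_iff.1 t.2) i
    split_ifs
    · exact this
    · simpa using hT⟩, by
    apply Continuous.subtype_mk
    apply continuous_pi
    intro i
    split_ifs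
    · exact (continuous_apply i).comp continuous_subtype_val
    · exact continuous_const⟩

lemma update_mem {m : ℕ} {T : ℝ} (hT : 0 ≤ T) (t : Cb m T) (j : Fin m) {s : ℝ} (hs : |s| ≤ 2 * T) :
    Function.update t.1 j s ∈ closedBall (0 : Fin m → ℝ) (2 * T) := by
  rw [mem_closedBall_zero_iff, pi_norm_le_iff_of_nonneg (by linarith)]
  intro i
  have := (pi_norm_le_iff_of_nonneg hT).1 (mem_closedBall_zero_iff.1 t.2) i
  by_cases h : i = j
  · subst h; simpa using hs
  · rw [Function.update_of_ne h]; linarith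

lemma coords_mem {m : ℕ} {T r : ℝ} (hT : 0 < T)
    (A : Subalgebra ℂ C(Cb m T × closedBall (0 : ℂ) r, ℂ))
    (hA : IsClosed (A : Set C(Cb m T × closedBall (0 : ℂ) r, ℂ)))
    (f : Fin m → (Fin m → ℝ) → ℝ)
    (hfdep : ∀ j, ∀ t t' : Fin m → ℝ, (∀ i, i ≤ j → t i = t' i) → f j t = f j t')
    (hf0 : ∀ j, f j 0 = 0)
    (hfL : ∀ j, ∀ t ∈ closedBall (0 : Fin m → ℝ) (2 * T),
      ∀ t' ∈ closedBall (0 : Fin m → ℝ) (2 * T), |f j t - f j t'| ≤ 1 / 4 * ‖t - t'‖)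
    (zf : Fin m → C(Cb m T × closedBall (0 : ℂ) r, ℂ)) (hzA : ∀ j, zf j ∈ A)
    (hzf : ∀ j x, zf j x = (x.1.1 j : ℂ) + (f j x.1.1 : ℂ) * Complex.I) :
    ∀ ψ : C(Cb m T, ℂ), ψ.comp ContinuousMap.fst ∈ A := by
  have hfc : ∀ j, ContinuousOn (f j) (closedBall (0 : Fin m → ℝ) (2 * T)) := by
    intro j
    have : LipschitzOnWith (1 / 4) (f j) (closedBall (0 : Fin m → ℝ) (2 * T)) := by
      apply LipschitzOnWith.of_dist_le_mul
      intro u hu v hv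
      rw [dist_eq_norm, dist_eq_norm]
      simpa using hfL j u hu v hv
    exact this.continuousOn
  have hmemT : ∀ t : Cb m T, t.1 ∈ closedBall (0 : Fin m → ℝ) (2 * T) := fun t =>
    closedBall_subset_closedBall (by linarith) t.2
  have key : ∀ j : Fin m, (cf j : C(Cb m T, ℂ)).comp ContinuousMap.fst ∈ A := by
    intro j
    induction j using WellFoundedLT.induction with
    | ind j ih =>
    -- bound for z
    have hzR : ∀ x, ‖zf j x‖ ≤ 2 * T := by
      intro x
      rw [hzf]
      have h1 := hfL j x.1.1 (hmemT _) 0 (by simp; linarith)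
      rw [hf0, sub_zero, sub_zero] at h1
      have h2 : ‖x.1.1‖ ≤ T := mem_closedBall_zero_iff.1 x.1.2
      have h3 := norm_le_pi_norm x.1.1 j
      rw [Real.norm_eq_abs] at h3
      refine (norm_add_le _ _).trans ?_
      rw [norm_mul, Complex.norm_I, mul_one, Complex.norm_real, Complex.norm_real,
        Real.norm_eq_abs, Real.norm_eq_abs]
      linarith
    have hbre : ∀ b : closedBall (0 : ℂ) (2 * T), |(b : ℂ).re| ≤ 2 * T := fun b =>
      (Complex.abs_re_le_norm _).trans (mem_closedBall_zero_iff.1 b.2)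
    let Φ : closedBall (0 : ℂ) (2 * T) × Cb m T → closedBall (0 : Fin m → ℝ) (2 * T) :=
      fun p => ⟨Function.update p.2.1 j (p.1 : ℂ).re, update_mem hT.le p.2 j (hbre p.1)⟩
    have hΦ : Continuous Φ := by
      apply Continuous.subtype_mk
      apply Continuous.update
      · fun_prop
      · exact Complex.continuous_re.comp (by fun_prop)
    have hfr : Continuous ((closedBall (0 : Fin m → ℝ) (2 * T)).domRestrict (f j)) :=
      continuousOn_iff_continuous_domRestrict.1 (hfc j)
    let fΦ : C(closedBall (0 : ℂ) (2 * T) × Cb m T, ℂ) :=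
      ⟨fun p => ((f j (Function.update p.2.1 j (p.1 : ℂ).re) : ℝ) : ℂ),
        Complex.continuous_ofReal.comp (hfr.comp hΦ)⟩
    let H : C(closedBall (0 : ℂ) (2 * T) × (Cb m T × closedBall (0 : ℂ) r), ℂ) :=
      ⟨fun p => zf j p.2 - (conj (p.1 : ℂ) + 2 * Complex.I * fΦ (p.1, p.2.1)), by
        apply Continuous.sub (by fun_prop)
        apply Continuous.add
        · exact Complex.continuous_conj.comp (by fun_prop)
        · fun_prop⟩
    have hst : star (zf j) ∈ A := by
      apply conj_mem A hA (zf j) (hzA j) (2 * T) hzR H _ (1 / 2) (by norm_num)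
      · intro b x
        have e : H (b, x) - conj (zf j x - b) = 2 * Complex.I *
            ((f j x.1.1 - f j (Function.update x.1.1 j (b : ℂ).re) : ℝ) : ℂ) := by
          change zf j x - (conj (b : ℂ) + 2 * Complex.I *
            ((f j (Function.update x.1.1 j (b : ℂ).re) : ℝ) : ℂ)) - conj (zf j x - b) = _
          rw [hzf, map_sub, map_add, map_mul, Complex.conj_I, Complex.conj_ofReal,
            Complex.conj_ofReal]
          push_cast
          ring
        have h1 := hfL j x.1.1 (hmemT _) _ (update_mem hT.le x.1 j (hbre b))
        have h2 : ‖x.1.1 - Function.update x.1.1 j (b : ℂ).re‖ ≤ |x.1.1 j - (b : ℂ).re| := by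
          rw [pi_norm_le_iff_of_nonneg (abs_nonneg _)]
          intro i
          by_cases h : i = j
          · subst h; simp
          · simp [Function.update_of_ne h]
        have h3 : |x.1.1 j - (b : ℂ).re| ≤ ‖zf j x - b‖ := by
          have := Complex.abs_re_le_norm (zf j x - b)
          rw [hzf] at this
          rw [hzf]
          simpa using this
        rw [e, norm_mul, norm_mul, Complex.norm_I, Complex.norm_real, Real.norm_eq_abs]
        norm_num
        linarith
      · intro b
        let ψ : C(Cb m T, ℂ) := fΦ.curry b
        have hψ : ψ.comp ContinuousMap.fst =
            ψ.comp ((trunc hT.le j).comp (ContinuousMap.fst : C(Cb m T × closedBall (0 : ℂ) r, _))) := by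
          ext x
          change ((f j (Function.update x.1.1 j (b : ℂ).re) : ℝ) : ℂ) =
            ((f j (Function.update (trunc hT.le j x.1).1 j (b : ℂ).re) : ℝ) : ℂ)
          congr 1
          apply hfdep
          intro i hi
          by_cases h : i = j
          · subst h; simp
          · rw [Function.update_of_ne h, Function.update_of_ne h]
            have : i < j := lt_of_le_of_ne hi h
            simp [trunc, this]
        have hψA : ψ.comp ContinuousMap.fst ∈ A := by
          rw [hψ]
          apply comp_mem A hA _ (Set.range cf) _ _ cf_sep
          · rintro _ ⟨i, rfl⟩
            by_cases h : i < j
            · have : (cf i).comp ((trunc hT.le j).comp (ContinuousMap.fst : C(Cb m T × closedBall (0 : ℂ) r, _)))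
                  = (cf i).comp ContinuousMap.fst := by
                ext x; simp [trunc, h, cf]
              rw [this]; exact ih i h
            · have : (cf i).comp ((trunc hT.le j).comp (ContinuousMap.fst : C(Cb m T × closedBall (0 : ℂ) r, _)))
                  = 0 := by
                ext x; simp [trunc, h, cf]
              rw [this]; exact A.zero_mem
          · rintro _ ⟨i, rfl⟩
            exact cf_star i
        have e : H.curry b = zf j - (algebraMap ℂ _ (conj (b : ℂ)) +
            algebraMap ℂ _ (2 * Complex.I) * ψ.comp ContinuousMap.fst) := by
          ext x; rfl
        rw [e]
        exact A.sub_mem (hzA j) (A.add_mem (A.algebraMap_mem _)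
          (A.mul_mem (A.algebraMap_mem _) hψA))
    have e : (cf j : C(Cb m T, ℂ)).comp ContinuousMap.fst = (1 / 2 : ℂ) • (zf j + star (zf j)) := by
      ext x
      change ((x.1.1 j : ℝ) : ℂ) = (1 / 2 : ℂ) * (zf j x + conj (zf j x))
      rw [hzf, map_add, map_mul, Complex.conj_I, Complex.conj_ofReal, Complex.conj_ofReal]
      ring
    rw [e]
    exact A.smul_mem (A.add_mem (hzA j) hst) _
  intro ψ
  apply comp_mem A hA _ (Set.range cf) _ _ cf_sep
  · rintro _ ⟨i, rfl⟩
    exact key i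
  · rintro _ ⟨i, rfl⟩
    exact cf_star i

end FHP

namespace FHP

/-- the algebra `A + A s` when `s^2 ∈ A` -/
def quadExt {X : Type*} [TopologicalSpace X] (A : Subalgebra ℂ C(X, ℂ)) (s : C(X, ℂ))
    (hs : s * s ∈ A) : Subalgebra ℂ C(X, ℂ) where
  carrier := {f | ∃ a ∈ A, ∃ b ∈ A, f = a + b * s}
  mul_mem' := by
    rintro _ _ ⟨a, ha, b, hb, rfl⟩ ⟨a', ha', b', hb', rfl⟩
    exact ⟨a * a' + b * b' * (s * s), A.add_mem (A.mul_mem ha ha') (A.mul_mem (A.mul_mem hb hb') hs),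
      a * b' + b * a', A.add_mem (A.mul_mem ha hb') (A.mul_mem hb ha'), by ring⟩
  add_mem' := by
    rintro _ _ ⟨a, ha, b, hb, rfl⟩ ⟨a', ha', b', hb', rfl⟩
    exact ⟨a + a', A.add_mem ha ha', b + b', A.add_mem hb hb', by ring⟩
  algebraMap_mem' := fun r => ⟨algebraMap ℂ _ r, A.algebraMap_mem r, 0, A.zero_mem, by ring⟩

/-- second coordinate -/
def wc {m : ℕ} {T r : ℝ} : C(Cb m T × closedBall (0 : ℂ) r, ℂ) :=
  ⟨fun x => (x.2 : ℂ), by fun_prop⟩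

lemma top_of_star {m : ℕ} {T r : ℝ}
    (A : Subalgebra ℂ C(Cb m T × closedBall (0 : ℂ) r, ℂ))
    (hA : IsClosed (A : Set C(Cb m T × closedBall (0 : ℂ) r, ℂ)))
    (ht : ∀ ψ : C(Cb m T, ℂ), ψ.comp ContinuousMap.fst ∈ A)
    (hw : wc ∈ A) (hw' : star wc ∈ A) : A = ⊤ := by
  apply stone_weierstrass A hA
    (insert wc (Set.range fun ψ : C(Cb m T, ℂ) => ψ.comp ContinuousMap.fst))
  · intro s hs
    rcases hs with rfl | ⟨ψ, rfl⟩
    · exact hw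
    · exact ht ψ
  · intro s hs
    rcases hs with rfl | ⟨ψ, rfl⟩
    · exact hw'
    · have := ht (star ψ)
      exact this
  · intro x y h
    have h1 := h wc (Set.mem_insert _ _)
    have h2 : x.1 = y.1 := cf_sep x.1 y.1 (by
      rintro _ ⟨i, rfl⟩
      exact h ((cf i).comp ContinuousMap.fst) (Set.mem_insert_of_mem _ ⟨cf i, rfl⟩))
    exact Prod.ext h2 (Subtype.ext h1)

lemma main_top {m : ℕ} {T r : ℝ}
    (A : Subalgebra ℂ C(Cb m T × closedBall (0 : ℂ) r, ℂ))
    (hA : IsClosed (A : Set C(Cb m T × closedBall (0 : ℂ) r, ℂ)))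
    (ht : ∀ ψ : C(Cb m T, ℂ), ψ.comp ContinuousMap.fst ∈ A)
    (hw : wc ∈ A) {a : ℝ} (ha : 0 < a) (ha1 : a < 1) (w0 : C(Cb m T, ℂ))
    (G Q : C(Cb m T × closedBall (0 : ℂ) r, ℂ)) (hQ : Q ∈ A)
    (hQG : ∀ x, Q x = Lf a (x.2 - w0 x.1) ^ 2 + G x)
    (hG : ∀ x, ‖G x‖ ≤ ep a * ‖(x.2 : ℂ) - w0 x.1‖ ^ 2)
    (hGG : ∀ t (w w' : closedBall (0 : ℂ) r), ‖G (t, w) - G (t, w')‖ ≤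
      ep a * max ‖(w : ℂ) - w0 t‖ ‖(w' : ℂ) - w0 t‖ * ‖(w : ℂ) - w'‖) : A = ⊤ := by
  let z : C(Cb m T × closedBall (0 : ℂ) r, ℂ) := wc - w0.comp ContinuousMap.fst
  have hz : z ∈ A := A.sub_mem hw (ht w0)
  have hzx : ∀ x, z x = x.2 - w0 x.1 := fun x => rfl
  let ζ : C(Cb m T × closedBall (0 : ℂ) r, ℂ) :=
    ⟨fun x => zt a (z x) (G x), zt_continuous ha ha1 z.continuous G.continuous hG⟩
  have hζx : ∀ x, ζ x = zt a (x.2 - w0 x.1) (G x) := fun x => rfl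
  have hζ2 : ζ * ζ = Q := by
    ext x
    change ζ x * ζ x = Q x
    rw [hζx, hQG, zt_sq ha ha1 (hG x)]
  have hζA : ζ * ζ ∈ A := hζ2 ▸ hQ
  have hlip0 : ∀ x, ‖ζ x - conj (z x)‖ ≤ (1 + a) / 2 * ‖z x‖ := by
    intro x
    have h := zt_lip (z' := 0) (g' := 0) ha ha1 (hG x) (by simp) (by
      rw [norm_zero, max_eq_left (norm_nonneg _), sub_zero, sub_zero]
      rw [mul_assoc, ← _root_.sq]; exact hG x)
    have h0 : zt a 0 0 = 0 := by simp [zt, Lf]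
    rwa [h0, sub_zero, sub_zero] at h
  have hzζ : z * ζ ∈ A := by
    apply sqrt_mem A hA (z * ζ) (c := (1 - a) / 4) _ (by linarith) (by linarith)
    · intro x
      change (1 - a) / 4 * ‖z x * ζ x‖ ≤ (z x * ζ x).re
      have e : z x * ζ x = z x * conj (z x) + z x * (ζ x - conj (z x)) := by ring
      have h1 : (z x * conj (z x)).re = ‖z x‖ ^ 2 := by
        rw [Complex.mul_conj, Complex.normSq_eq_norm_sq, Complex.ofReal_re]
      have h2 := (abs_le.1 (Complex.abs_re_le_norm (z x * (ζ x - conj (z x))))).1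
      rw [norm_mul] at h2
      have h3 : ‖z x * ζ x‖ ≤ ‖z x‖ * (2 * ‖z x‖) := by
        rw [norm_mul]
        gcongr
        exact zt_norm_le ha ha1 (hG x)
      have h4 : (1 - a) / 4 * ‖z x * ζ x‖ ≤ (1 - a) / 4 * (‖z x‖ * (2 * ‖z x‖)) := by
        apply mul_le_mul_of_nonneg_left h3; linarith
      rw [e, Complex.add_re, h1, ← e]
      have h5 := mul_le_mul_of_nonneg_left (hlip0 x) (norm_nonneg (z x))
      nlinarith
    · have : z * ζ * (z * ζ) = z * z * (ζ * ζ) := by ring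
      rw [this]
      exact A.mul_mem (A.mul_mem hz hz) hζA
  let B := (quadExt A ζ hζA).topologicalClosure
  have hAB0 : ∀ f ∈ A, f ∈ quadExt A ζ hζA := fun f hf => ⟨f, hf, 0, A.zero_mem, by ring⟩
  have hB0 : quadExt A ζ hζA ≤ B := Subalgebra.le_topologicalClosure _
  have hAB : ∀ f ∈ A, f ∈ B := fun f hf => hB0 (hAB0 f hf)
  have hζB : ζ ∈ B := hB0 ⟨0, A.zero_mem, 1, A.one_mem, by ring⟩
  have hB : IsClosed (B : Set C(Cb m T × closedBall (0 : ℂ) r, ℂ)) :=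
    Subalgebra.isClosed_topologicalClosure _
  have hzB : ∀ f ∈ B, z * f ∈ A := by
    have hcl : IsClosed {f : C(Cb m T × closedBall (0 : ℂ) r, ℂ) | z * f ∈ A} :=
      hA.preimage (continuous_const.mul continuous_id)
    have hsub : (quadExt A ζ hζA : Set C(Cb m T × closedBall (0 : ℂ) r, ℂ)) ⊆ {f | z * f ∈ A} := by
      rintro _ ⟨p, hp, q, hq, rfl⟩
      have : z * (p + q * ζ) = z * p + q * (z * ζ) := by ring
      change z * (p + q * ζ) ∈ A
      rw [this]
      exact A.add_mem (A.mul_mem hz hp) (A.mul_mem hq hzζ)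
    intro f hf
    exact closure_minimal hsub hcl hf
  have hBtop : B = ⊤ := by
    apply top_of_star B hB (fun ψ => hAB _ (ht ψ)) (hAB _ hw)
    let H : C(closedBall (0 : ℂ) r × (Cb m T × closedBall (0 : ℂ) r), ℂ) :=
      ⟨fun p => ζ p.2 - ζ (p.2.1, p.1), by fun_prop⟩
    apply conj_mem B hB wc (hAB _ hw) r (fun x => mem_closedBall_zero_iff.1 x.2.2) H _
      ((1 + a) / 2) (by linarith)
    · intro b x
      change ‖ζ x - ζ (x.1, b) - conj ((x.2 : ℂ) - b)‖ ≤ (1 + a) / 2 * ‖(x.2 : ℂ) - b‖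
      have e : (x.2 : ℂ) - w0 x.1 - (b - w0 x.1) = x.2 - b := by ring
      have h := zt_lip ha ha1 (hG x) (hG (x.1, b)) (by rw [e]; exact hGG x.1 x.2 b)
      rw [e] at h
      exact h
    · intro b
      let ψ : C(Cb m T, ℂ) := ⟨fun t => ζ (t, b), by fun_prop⟩
      have : H.curry b = ζ - ψ.comp ContinuousMap.fst := by ext x; rfl
      rw [this]
      exact B.sub_mem hζB (hAB _ (ht ψ))
  have hstar : star z ∈ A := by
    apply mem_of_approx A hA
    intro ε hε
    have hpos : ∀ x, 0 < ‖z x‖ ^ 2 + ε ^ 2 := fun x => by positivity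
    let q : C(Cb m T × closedBall (0 : ℂ) r, ℂ) :=
      ⟨fun x => conj (z x) ^ 2 / ((‖z x‖ ^ 2 + ε ^ 2 : ℝ) : ℂ), by
        apply Continuous.div
        · exact (Complex.continuous_conj.comp z.continuous).pow 2
        · exact Complex.continuous_ofReal.comp (by fun_prop)
        · intro x
          exact_mod_cast (hpos x).ne'⟩
    refine ⟨z * q, hzB q (by rw [hBtop]; trivial), fun x => ?_⟩
    change ‖z x * (conj (z x) ^ 2 / ((‖z x‖ ^ 2 + ε ^ 2 : ℝ) : ℂ)) - conj (z x)‖ ≤ ε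
    have hne : ((‖z x‖ ^ 2 + ε ^ 2 : ℝ) : ℂ) ≠ 0 := by exact_mod_cast (hpos x).ne'
    have hzz : z x * conj (z x) = ((‖z x‖ ^ 2 : ℝ) : ℂ) := by
      rw [Complex.mul_conj, Complex.normSq_eq_norm_sq]
    have e : z x * (conj (z x) ^ 2 / ((‖z x‖ ^ 2 + ε ^ 2 : ℝ) : ℂ)) - conj (z x) =
        -(conj (z x) * ((ε ^ 2 / (‖z x‖ ^ 2 + ε ^ 2) : ℝ) : ℂ)) := by
      rw [Complex.ofReal_div]
      field_simp
      rw [hzz]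
      push_cast
      ring
    rw [e, norm_neg, norm_mul, Complex.norm_conj, Complex.norm_real, Real.norm_of_nonneg (by positivity),
      mul_div_assoc', div_le_iff₀ (hpos x)]
    nlinarith [sq_nonneg (‖z x‖ - ε), mul_nonneg hε.le (norm_nonneg (z x)), norm_nonneg (z x)]
  apply top_of_star A hA ht hw
  have : star wc = star z + (star w0).comp ContinuousMap.fst := by
    ext x
    change conj (x.2 : ℂ) = conj ((x.2 : ℂ) - w0 x.1) + conj (w0 x.1)
    rw [map_sub]; ring
  rw [this]
  exact A.add_mem hstar (ht _)

end FHP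

namespace FHP

open scoped NNReal

/-- `Lf` as a continuous linear map -/
def LfC (a : ℝ) : ℂ →L[ℝ] ℂ := (Complex.conjCLE : ℂ →L[ℝ] ℂ) + a • ContinuousLinearMap.id ℝ ℂ

lemma LfC_apply (a : ℝ) (z : ℂ) : LfC a z = Lf a z := by
  simp [LfC, Lf]

/-- antiholomorphic coefficient functional -/
def Lam (E : Type*) [NormedAddCommGroup E] [NormedSpace ℝ E] : ((E × ℂ) →L[ℝ] ℂ) →L[ℝ] ℂ :=
  (1 / 2 : ℝ) • (ContinuousLinearMap.apply ℝ ℂ ((0, 1) : E × ℂ) +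
    (ContinuousLinearMap.mul ℝ ℂ Complex.I).comp
      (ContinuousLinearMap.apply ℝ ℂ ((0, Complex.I) : E × ℂ)))

/-- holomorphic coefficient functional -/
def Lam' (E : Type*) [NormedAddCommGroup E] [NormedSpace ℝ E] : ((E × ℂ) →L[ℝ] ℂ) →L[ℝ] ℂ :=
  (1 / 2 : ℝ) • (ContinuousLinearMap.apply ℝ ℂ ((0, 1) : E × ℂ) -
    (ContinuousLinearMap.mul ℝ ℂ Complex.I).comp
      (ContinuousLinearMap.apply ℝ ℂ ((0, Complex.I) : E × ℂ)))

lemma lam_decomp {E : Type*} [NormedAddCommGroup E] [NormedSpace ℝ E] (D : (E × ℂ) →L[ℝ] ℂ)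
    (v : ℂ) : D (0, v) = Lam' E D * v + Lam E D * conj v := by
  have hv : ((0, v) : E × ℂ) = v.re • ((0, 1) : E × ℂ) + v.im • ((0, Complex.I) : E × ℂ) := by
    ext
    · simp
    · simp
  have h1 : D (0, v) = v.re * D (0, 1) + v.im * D (0, Complex.I) := by
    rw [hv, map_add, map_smul, map_smul]; simp
  have e1 : Lam E D = 1 / 2 * (D (0, 1) + Complex.I * D (0, Complex.I)) := by
    simp [Lam]; ring
  have e2 : Lam' E D = 1 / 2 * (D (0, 1) - Complex.I * D (0, Complex.I)) := by
    simp [Lam']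
  rw [h1, e1, e2]
  have hc : conj v = v.re - v.im * Complex.I := by
    apply Complex.ext <;> simp
  have hv2 : v = v.re + v.im * Complex.I := (Complex.re_add_im v).symm
  rw [hc]
  conv_rhs => rw [hv2]
  simp only [Complex.add_re, Complex.add_im, Complex.ofReal_re, Complex.ofReal_im, Complex.mul_re,
    Complex.mul_im, Complex.I_re, Complex.I_im]
  ring_nf
  rw [Complex.I_sq]
  ring

lemma exists_w0 {E : Type*} [NormedAddCommGroup E] [NormedSpace ℝ E] [CompleteSpace E]
    (G : E × ℂ → ℂ) (hG : ContDiffAt ℝ 2 G 0) (h1 : fderiv ℝ G 0 = 0)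
    (h2 : fderiv ℝ (fderiv ℝ G) 0 = 0) {a : ℝ} (ha : 0 < a) (ha1 : a < 1) :
    ∃ w0 : E → ℂ, w0 0 = 0 ∧ (∀ᶠ t in nhds 0, ContinuousAt w0 t) ∧
      ∀ᶠ t in nhds 0, 2 * Lf a (w0 t) + Lam E (fderiv ℝ G (t, w0 t)) = 0 := by
  have hD : ContDiffAt ℝ 1 (fderiv ℝ G) 0 := hG.fderiv_right (by norm_num)
  let Φ : E × ℂ → ℂ := fun x => ((2 : ℝ) • LfC a) x.2 + Lam E (fderiv ℝ G x)
  have hΦ : ContDiffAt ℝ 1 Φ 0 := by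
    apply ContDiffAt.add
    · exact ((2 : ℝ) • LfC a).contDiff.contDiffAt.comp _ contDiffAt_snd
    · exact (Lam E).contDiff.contDiffAt.comp _ hD
  have hΦ' : fderiv ℝ Φ 0 = ((2 : ℝ) • LfC a).comp (ContinuousLinearMap.snd ℝ E ℂ) := by
    have e1 : HasFDerivAt (fun x : E × ℂ => ((2 : ℝ) • LfC a) x.2)
        (((2 : ℝ) • LfC a).comp (ContinuousLinearMap.snd ℝ E ℂ)) 0 :=
      (((2 : ℝ) • LfC a).comp (ContinuousLinearMap.snd ℝ E ℂ)).hasFDerivAt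
    have e2 : HasFDerivAt (𝕜 := ℝ) (fderiv ℝ G) 0 0 := by
      have := (hD.differentiableAt (by norm_num)).hasFDerivAt
      rwa [h2] at this
    have e3 := (Lam E).hasFDerivAt.comp (0 : E × ℂ) e2
    have e4 := (e1.add e3).fderiv
    rw [ContinuousLinearMap.comp_zero, add_zero] at e4
    exact e4
  have hinv : (fderiv ℝ Φ 0 ∘L .inr ℝ E ℂ).IsInvertible := by
    rw [hΦ']
    have hinj : Function.Injective ((2 : ℝ) • LfC a : ℂ →L[ℝ] ℂ).toLinearMap := by
      rw [← LinearMap.ker_eq_bot, LinearMap.ker_eq_bot']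
      intro v hv
      have hv' : (2 : ℝ) • Lf a v = 0 := by
        rw [← LfC_apply]; exact hv
      have h3 : Lf a v = 0 := by simpa using hv'
      have h4 := Lf_lower ha.le v
      rw [h3, norm_zero] at h4
      have : ‖v‖ ≤ 0 := by
        by_contra hcon
        push Not at hcon
        nlinarith
      exact norm_le_zero_iff.1 this
    refine ⟨(LinearEquiv.ofInjectiveEndo _ hinj).toContinuousLinearEquiv, ?_⟩
    ext v
    all_goals rfl
  refine ⟨hΦ.implicitFunction one_ne_zero hinv, hΦ.implicitFunction_apply_self one_ne_zero hinv,
    ?_, ?_⟩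
  · have h := hΦ.contDiffAt_implicitFunction one_ne_zero hinv
    have h' := h.eventually (by simp)
    filter_upwards [h'] with t ht
    exact ht.continuousAt
  · have h := hΦ.eventually_apply_implicitFunction one_ne_zero hinv
    filter_upwards [h] with t ht
    have h0 : Φ 0 = 0 := by
      simp [Φ, h1]
    rw [h0] at ht
    rw [← ht]
    simp [Φ, LfC_apply]

end FHP

namespace FHP

open scoped NNReal

lemma exists_data {m : ℕ} (G1 : (Fin m → ℝ) × ℂ → ℂ) (hG : ContDiffAt ℝ 2 G1 0)
    (h1 : fderiv ℝ G1 0 = 0) (h2 : fderiv ℝ (fderiv ℝ G1) 0 = 0) {a : ℝ} (ha : 0 < a) (ha1 : a < 1)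
    {ε : ℝ} (hε : 0 < ε) : ∃ ρ > 0, ∃ τ > 0, ∀ T r : ℝ, T ≤ τ → r ≤ ρ →
    ∃ (w0 c p : C(Cb m T, ℂ)) (G : C(Cb m T × closedBall (0 : ℂ) r, ℂ)),
      (∀ x, G1 (x.1.1, x.2.1) = c x.1 + p x.1 * (x.2 - w0 x.1) -
        2 * Lf a (w0 x.1) * conj (x.2 - w0 x.1) + G x) ∧
      (∀ x, ‖G x‖ ≤ ε * ‖(x.2 : ℂ) - w0 x.1‖ ^ 2) ∧
      (∀ t (w w' : closedBall (0 : ℂ) r), ‖G (t, w) - G (t, w')‖ ≤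
        ε * max ‖(w : ℂ) - w0 t‖ ‖(w' : ℂ) - w0 t‖ * ‖(w : ℂ) - w'‖) := by
  have hD : ContDiffAt ℝ 1 (fderiv ℝ G1) 0 := hG.fderiv_right (by norm_num)
  have hS := hD.hasStrictFDerivAt one_ne_zero
  rw [h2] at hS
  obtain ⟨s, hs, hLip⟩ := hS.exists_lipschitzOnWith_of_nnnorm_lt ⟨ε, hε.le⟩ (by
    rw [nnnorm_zero]; exact hε)
  have hdiff : ∀ᶠ x in nhds (0 : (Fin m → ℝ) × ℂ), DifferentiableAt ℝ G1 x := by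
    filter_upwards [hG.eventually (by simp)] with x hx
    exact hx.differentiableAt (by norm_num)
  obtain ⟨ρ, hρ, hball⟩ := Metric.nhds_basis_closedBall.mem_iff.1 (Filter.inter_mem hs hdiff)
  obtain ⟨w0, hw00, hw0c, hw0e⟩ := exists_w0 G1 hG h1 h2 ha ha1
  have hw0b : ∀ᶠ t in nhds (0 : Fin m → ℝ), ‖w0 t‖ < ρ := by
    have hc : ContinuousAt w0 0 := hw0c.self_of_nhds
    have := hc.norm.eventually_lt_const (u := ρ) (by simpa [hw00] using hρ)
    exact this
  obtain ⟨τ, hτ, hball2⟩ := Metric.nhds_basis_closedBall.mem_iff.1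
    ((hw0c.and hw0e).and hw0b)
  refine ⟨ρ, hρ, min τ ρ, lt_min hτ hρ, fun T r hT hr => ?_⟩
  have hmem : ∀ (t : Cb m T) (w : ℂ), ‖w‖ ≤ ρ → (t.1, w) ∈ closedBall (0 : (Fin m → ℝ) × ℂ) ρ := by
    intro t w hw
    rw [mem_closedBall_zero_iff, Prod.norm_def]
    exact max_le ((mem_closedBall_zero_iff.1 t.2).trans (hT.trans (min_le_right _ _))) hw
  have htm : ∀ t : Cb m T, (ContinuousAt w0 t ∧
      2 * Lf a (w0 t) + Lam _ (fderiv ℝ G1 (t.1, w0 t)) = 0) ∧ ‖w0 t‖ < ρ := by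
    intro t
    exact hball2 (closedBall_subset_closedBall (hT.trans (min_le_left _ _)) t.2)
  have hG1c : ContinuousOn G1 (closedBall 0 ρ) := fun x hx =>
    (DifferentiableAt.continuousAt (𝕜 := ℝ) (hball hx).2).continuousWithinAt
  have hDc : ContinuousOn (fderiv ℝ G1) (closedBall 0 ρ) :=
    hLip.continuousOn.mono fun x hx => (hball hx).1
  have hw0C : Continuous fun t : Cb m T => w0 t.1 := by
    rw [continuous_iff_continuousAt]
    intro t
    exact ContinuousAt.comp (f := Subtype.val) (htm t).1.1 continuous_subtype_val.continuousAt
  have hpair : Continuous fun t : Cb m T => ((t.1, w0 t.1) : (Fin m → ℝ) × ℂ) :=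
    continuous_subtype_val.prodMk hw0C
  have hpm : ∀ t : Cb m T, ((t.1, w0 t.1) : (Fin m → ℝ) × ℂ) ∈ closedBall (0 : (Fin m → ℝ) × ℂ) ρ :=
    fun t => hmem t _ (htm t).2.le
  have hDw : Continuous fun t : Cb m T => fderiv ℝ G1 (t.1, w0 t.1) :=
    hDc.comp_continuous hpair hpm
  let w0C : C(Cb m T, ℂ) := ⟨fun t => w0 t.1, hw0C⟩
  let c : C(Cb m T, ℂ) := ⟨fun t => G1 (t.1, w0 t.1), hG1c.comp_continuous hpair hpm⟩
  let p : C(Cb m T, ℂ) := ⟨fun t => Lam' _ (fderiv ℝ G1 (t.1, w0 t.1)),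
    (Lam' _).continuous.comp hDw⟩
  have hrm : ∀ w : closedBall (0 : ℂ) r, ‖(w : ℂ)‖ ≤ ρ := fun w =>
    (mem_closedBall_zero_iff.1 w.2).trans hr
  let G : C(Cb m T × closedBall (0 : ℂ) r, ℂ) :=
    ⟨fun x => G1 (x.1.1, x.2.1) - G1 (x.1.1, w0 x.1.1) -
      fderiv ℝ G1 (x.1.1, w0 x.1.1) (0, x.2.1 - w0 x.1.1), by
      apply Continuous.sub
      · apply Continuous.sub
        · refine hG1c.comp_continuous (f := fun x : Cb m T × closedBall (0 : ℂ) r =>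
            ((x.1.1, x.2.1) : (Fin m → ℝ) × ℂ)) ?_ (fun x => hmem x.1 x.2.1 (hrm x.2))
          fun_prop
        · exact c.continuous.comp continuous_fst
      · apply Continuous.clm_apply
        · exact hDw.comp continuous_fst
        · apply Continuous.prodMk continuous_const
          apply Continuous.sub (by fun_prop)
          exact hw0C.comp continuous_fst⟩
  -- the key mean value estimate
  have hmv : ∀ (t : Cb m T) (w w' : ℂ), ‖w‖ ≤ ρ → ‖w'‖ ≤ ρ →
      ‖G1 (t.1, w) - G1 (t.1, w') - fderiv ℝ G1 (t.1, w0 t.1) (0, w - w')‖ ≤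
        ε * max ‖w - w0 t.1‖ ‖w' - w0 t.1‖ * ‖w - w'‖ := by
    intro t w w' hw hw'
    set M := max ‖w - w0 t.1‖ ‖w' - w0 t.1‖ with hM
    have hconv : Convex ℝ (closedBall (0 : ℂ) ρ ∩ closedBall (w0 t.1) M) :=
      (convex_closedBall _ _).inter (convex_closedBall _ _)
    have hder : ∀ u ∈ closedBall (0 : ℂ) ρ ∩ closedBall (w0 t.1) M,
        HasFDerivWithinAt (fun u => G1 (t.1, u))
          ((fderiv ℝ G1 (t.1, u)).comp (ContinuousLinearMap.inr ℝ (Fin m → ℝ) ℂ))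
          (closedBall (0 : ℂ) ρ ∩ closedBall (w0 t.1) M) u := by
      intro u hu
      have hd : DifferentiableAt ℝ G1 (t.1, u) :=
        (hball (hmem t u (mem_closedBall_zero_iff.1 hu.1))).2
      have := hd.hasFDerivAt.comp u (hasFDerivAt_prodMk_right t.1 u)
      exact this.hasFDerivWithinAt
    have hbd : ∀ u ∈ closedBall (0 : ℂ) ρ ∩ closedBall (w0 t.1) M,
        ‖(fderiv ℝ G1 (t.1, u)).comp (ContinuousLinearMap.inr ℝ (Fin m → ℝ) ℂ) -
          (fderiv ℝ G1 (t.1, w0 t.1)).comp (ContinuousLinearMap.inr ℝ (Fin m → ℝ) ℂ)‖ ≤ ε * M := by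
      intro u hu
      rw [← ContinuousLinearMap.sub_comp]
      have hl := hLip.dist_le_mul _ (hball (hmem t u (mem_closedBall_zero_iff.1 hu.1))).1 _
        (hball (hpm t)).1
      rw [dist_eq_norm, dist_eq_norm] at hl
      have e : ((t.1, u) : (Fin m → ℝ) × ℂ) - (t.1, w0 t.1) = (0, u - w0 t.1) := by simp
      have hn : ‖((t.1, u) : (Fin m → ℝ) × ℂ) - (t.1, w0 t.1)‖ ≤ M := by
        rw [e, Prod.norm_def]
        have := hu.2
        rw [mem_closedBall, dist_eq_norm] at this
        simp only [norm_zero]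
        exact max_le ((norm_nonneg _).trans this) this
      refine (ContinuousLinearMap.opNorm_comp_le _ _).trans ?_
      have hinr : ‖ContinuousLinearMap.inr ℝ (Fin m → ℝ) ℂ‖ ≤ 1 := by
        apply ContinuousLinearMap.opNorm_le_bound _ zero_le_one
        intro x
        simp [Prod.norm_def]
      have hl' : ‖fderiv ℝ G1 (t.1, u) - fderiv ℝ G1 (t.1, w0 t.1)‖ ≤ ε * M :=
        hl.trans (mul_le_mul_of_nonneg_left hn hε.le)
      calc _ ≤ (ε * M) * 1 := by gcongr
        _ = _ := mul_one _
    have hwm : w ∈ closedBall (0 : ℂ) ρ ∩ closedBall (w0 t.1) M :=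
      ⟨mem_closedBall_zero_iff.2 hw, by rw [mem_closedBall, dist_eq_norm]; exact le_max_left _ _⟩
    have hwm' : w' ∈ closedBall (0 : ℂ) ρ ∩ closedBall (w0 t.1) M :=
      ⟨mem_closedBall_zero_iff.2 hw', by rw [mem_closedBall, dist_eq_norm]; exact le_max_right _ _⟩
    have := hconv.norm_image_sub_le_of_norm_hasFDerivWithin_le' hder hbd hwm' hwm
    simpa using this
  refine ⟨w0C, c, p, G, ?_, ?_, ?_⟩
  · intro x
    have h3 := lam_decomp (fderiv ℝ G1 (x.1.1, w0 x.1.1)) (x.2.1 - w0 x.1.1)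
    have h4 := (htm x.1).1.2
    change G1 (x.1.1, x.2.1) = G1 (x.1.1, w0 x.1.1) + Lam' _ (fderiv ℝ G1 (x.1.1, w0 x.1.1)) *
      (x.2.1 - w0 x.1.1) - 2 * Lf a (w0 x.1.1) * conj (x.2.1 - w0 x.1.1) +
      (G1 (x.1.1, x.2.1) - G1 (x.1.1, w0 x.1.1) -
      fderiv ℝ G1 (x.1.1, w0 x.1.1) (0, x.2.1 - w0 x.1.1))
    rw [h3]
    linear_combination (conj (x.2.1 - w0 x.1.1)) * h4
  · intro x
    have := hmv x.1 x.2.1 (w0 x.1.1) (hrm x.2) (htm x.1).2.le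
    rw [sub_self (w0 x.1.1), norm_zero, max_eq_left (norm_nonneg _), mul_assoc, ← _root_.sq] at this
    exact this
  · intro t w w'
    have h3 := hmv t w.1 w'.1 (hrm w) (hrm w')
    have e : G (t, w) - G (t, w') =
        G1 (t.1, w.1) - G1 (t.1, w'.1) - fderiv ℝ G1 (t.1, w0 t.1) (0, w.1 - w'.1) := by
      have e1 : ((0, w.1 - w'.1) : (Fin m → ℝ) × ℂ) = (0, w.1 - w0 t.1) - (0, w'.1 - w0 t.1) := by
        simp
      rw [e1, map_sub]
      change (G1 (t.1, w.1) - G1 (t.1, w0 t.1) - fderiv ℝ G1 (t.1, w0 t.1) (0, w.1 - w0 t.1)) -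
        (G1 (t.1, w'.1) - G1 (t.1, w0 t.1) - fderiv ℝ G1 (t.1, w0 t.1) (0, w'.1 - w0 t.1)) = _
      ring
    rw [e]
    exact h3

lemma exists_lip {m : ℕ} (f : Fin m → (Fin m → ℝ) → ℝ) (hf : ∀ j, ContDiffAt ℝ 1 (f j) 0)
    (hf1 : ∀ j, fderiv ℝ (f j) 0 = 0) : ∃ δ > 0, ∀ j, ∀ t ∈ closedBall (0 : Fin m → ℝ) δ,
      ∀ t' ∈ closedBall (0 : Fin m → ℝ) δ, |f j t - f j t'| ≤ 1 / 4 * ‖t - t'‖ := by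
  have : ∀ j, ∃ s ∈ nhds (0 : Fin m → ℝ), LipschitzOnWith (1 / 4) (f j) s := by
    intro j
    have h := (hf j).hasStrictFDerivAt one_ne_zero
    rw [hf1] at h
    exact h.exists_lipschitzOnWith_of_nnnorm_lt (1 / 4) (by rw [nnnorm_zero]; norm_num)
  choose s hs hL using this
  obtain ⟨δ, hδ, hb⟩ := Metric.nhds_basis_closedBall.mem_iff.1 (Filter.iInter_mem.2 hs)
  refine ⟨δ, hδ, fun j t ht t' ht' => ?_⟩
  have := (hL j).dist_le_mul t (Set.mem_iInter.1 (hb ht) j) t' (Set.mem_iInter.1 (hb ht') j)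
  rw [dist_eq_norm, dist_eq_norm] at this
  simpa using this

end FHP

namespace FHP

lemma polyConvex_of_dense {n : ℕ} (K : Set (Fin n → ℂ)) (hK : IsCompact K) (hd : PolyDenseInC K) :
    IsPolyConvex K := by
  intro w hw
  have hpos : ∀ z : K, 0 < ∑ l, ‖z.1 l - w l‖ ^ 2 := by
    intro z
    have hne : z.1 ≠ w := fun h => hw (h ▸ z.2)
    obtain ⟨l, hl⟩ := Function.ne_iff.1 hne
    refine Finset.sum_pos' (fun i _ => by positivity) ⟨l, Finset.mem_univ _, ?_⟩
    have : 0 < ‖z.1 l - w l‖ := norm_pos_iff.2 (sub_ne_zero.2 hl)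
    positivity
  obtain ⟨C, hC⟩ := hK.isBounded.exists_norm_le
  set ε : ℝ := 1 / (2 * (n * (|C| + ‖w‖) + 1)) with hε
  have hε0 : 0 < ε := by positivity
  have hcont : ∀ i : Fin n, Continuous fun z : K =>
      conj (z.1 i - w i) / ((∑ l, ‖z.1 l - w l‖ ^ 2 : ℝ) : ℂ) := by
    intro i
    apply Continuous.div
    · exact Complex.continuous_conj.comp
        (((continuous_apply i).comp continuous_subtype_val).sub continuous_const)
    · apply Complex.continuous_ofReal.comp
      apply continuous_finsetSum
      intro l _
      exact (((continuous_apply l).comp continuous_subtype_val).sub continuous_const).norm.pow 2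
    · intro z
      exact_mod_cast (hpos z).ne'
  choose P hP using fun i => hd _ (hcont i) ε hε0
  refine ⟨1 - ∑ i, (MvPolynomial.X i - MvPolynomial.C (w i)) * P i, fun z hz => ?_⟩
  have e1 : MvPolynomial.eval w (1 - ∑ i, (MvPolynomial.X i - MvPolynomial.C (w i)) * P i) = 1 := by
    simp
  rw [e1, norm_one]
  let z' : K := ⟨z, hz⟩
  have hs : ((∑ l, ‖z l - w l‖ ^ 2 : ℝ) : ℂ) ≠ 0 := by exact_mod_cast (hpos z').ne'
  have e2 : ∑ i, (z i - w i) * (conj (z i - w i) / ((∑ l, ‖z l - w l‖ ^ 2 : ℝ) : ℂ)) = 1 := by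
    have : ∀ i, (z i - w i) * (conj (z i - w i) / ((∑ l, ‖z l - w l‖ ^ 2 : ℝ) : ℂ)) =
        ((‖z i - w i‖ ^ 2 : ℝ) : ℂ) / ((∑ l, ‖z l - w l‖ ^ 2 : ℝ) : ℂ) := by
      intro i
      rw [mul_div_assoc', Complex.mul_conj, Complex.normSq_eq_norm_sq]
    simp_rw [this]
    rw [← Finset.sum_div, ← Complex.ofReal_sum, div_self hs]
  have e3 : MvPolynomial.eval z (1 - ∑ i, (MvPolynomial.X i - MvPolynomial.C (w i)) * P i) =
      - ∑ i, (z i - w i) * (MvPolynomial.eval z (P i) -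
        conj (z i - w i) / ((∑ l, ‖z l - w l‖ ^ 2 : ℝ) : ℂ)) := by
    simp only [mul_sub, Finset.sum_sub_distrib] at e2 ⊢
    simp only [map_sub, map_one, map_sum, map_mul, MvPolynomial.eval_X, MvPolynomial.eval_C] at e2 ⊢
    rw [e2]; ring
  rw [e3, norm_neg]
  have hzw : ∀ i, ‖z i - w i‖ ≤ |C| + ‖w‖ := by
    intro i
    refine (norm_sub_le _ _).trans (add_le_add ?_ (norm_le_pi_norm w i))
    exact ((norm_le_pi_norm z i).trans (hC z hz)).trans (le_abs_self C)
  calc _ ≤ ∑ i : Fin n, (|C| + ‖w‖) * ε := by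
        refine (norm_sum_le _ _).trans (Finset.sum_le_sum fun i _ => ?_)
        rw [norm_mul]
        have := (hP i z').le
        exact mul_le_mul (hzw i) this (norm_nonneg _) (by positivity)
    _ = n * (|C| + ‖w‖) * ε := by simp; ring
    _ < 1 := by
        rw [hε, mul_one_div, div_lt_one (by positivity)]
        have : 0 ≤ n * (|C| + ‖w‖) := by positivity
        linarith

lemma dense_of_top {n : ℕ} {X : Type*} [TopologicalSpace X] [CompactSpace X]
    (φ : Fin n → C(X, ℂ)) (h : (MvPolynomial.aeval φ : MvPolynomial (Fin n) ℂ →ₐ[ℂ] C(X, ℂ)).range.topologicalClosure = ⊤)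
    (K : Set (Fin n → ℂ)) (hK : K = Set.range fun x i => φ i x) : PolyDenseInC K := by
  intro g hg ε hε
  have hmem : ∀ x, (fun i => φ i x) ∈ K := fun x => by rw [hK]; exact ⟨x, rfl⟩
  let G : C(X, ℂ) := ⟨fun x => g ⟨fun i => φ i x, hmem x⟩, by
    apply hg.comp
    apply Continuous.subtype_mk
    exact continuous_pi fun i => (φ i).continuous⟩
  have hG : G ∈ (MvPolynomial.aeval φ : MvPolynomial (Fin n) ℂ →ₐ[ℂ] C(X, ℂ)).range.topologicalClosure := by
    rw [h]; trivial
  obtain ⟨_, ⟨P, rfl⟩, hP⟩ := Metric.mem_closure_iff.1 hG ε hε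
  refine ⟨P, fun z => ?_⟩
  obtain ⟨z, hz⟩ := z
  have hz' := hz
  rw [hK] at hz'
  obtain ⟨x, rfl⟩ := hz'
  rw [dist_comm, dist_eq_norm] at hP
  have h1 := (ContinuousMap.norm_coe_le_norm _ x).trans_lt hP
  have e : (MvPolynomial.aeval φ P : C(X, ℂ)) x = MvPolynomial.eval (fun i => φ i x) P := by
    let ev : C(X, ℂ) →ₐ[ℂ] ℂ := ContinuousMap.evalAlgHom ℂ ℂ x
    have : ev (MvPolynomial.aeval φ P) = MvPolynomial.aeval (fun i => ev (φ i)) P := by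
      rw [← MvPolynomial.comp_aeval_apply]
    exact this
  rw [← e]
  exact h1

lemma fderiv_data {E : Type*} [NormedAddCommGroup E] [NormedSpace ℝ E] {V : Type*}
    [NormedAddCommGroup V] [NormedSpace ℝ V] (F : E → V) (x : E) :
    (iteratedFDeriv ℝ 1 F x = 0 → fderiv ℝ F x = 0) ∧
    (iteratedFDeriv ℝ 2 F x = 0 → fderiv ℝ (fderiv ℝ F) x = 0) := by
  constructor
  · intro h
    rw [← norm_eq_zero, ← norm_iteratedFDeriv_one, h, norm_zero]
  · intro h
    ext u v
    have := iteratedFDeriv_two_apply (𝕜 := ℝ) F x ![u, v]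
    rw [h] at this
    simpa using this.symm

end FHP

namespace FHP

lemma alg_top {m : ℕ} {T r γ : ℝ} (hT : 0 < T) (hγ : 1 / 2 < γ)
    (A : Subalgebra ℂ C(Cb m T × closedBall (0 : ℂ) r, ℂ))
    (hA : IsClosed (A : Set C(Cb m T × closedBall (0 : ℂ) r, ℂ)))
    (ht : ∀ ψ : C(Cb m T, ℂ), ψ.comp ContinuousMap.fst ∈ A)
    (hw : wc ∈ A) (h0 : C(Cb m T × closedBall (0 : ℂ) r, ℂ)) (hh0 : h0 ∈ A)
    (F : (Fin m → ℝ) × ℂ → ℂ)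
    (hh : ∀ x, h0 x = (x.2 : ℂ) * conj (x.2 : ℂ) + (γ : ℂ) * ((x.2 : ℂ) ^ 2 + (conj (x.2 : ℂ)) ^ 2)
      + F (x.1.1, x.2.1))
    (w0 c p : C(Cb m T, ℂ)) (G : C(Cb m T × closedBall (0 : ℂ) r, ℂ))
    (hF : ∀ x, γ⁻¹ • F (x.1.1, x.2.1) = c x.1 + p x.1 * (x.2 - w0 x.1) -
        2 * Lf (1 / (2 * γ)) (w0 x.1) * conj (x.2 - w0 x.1) + G x)
    (hG : ∀ x, ‖G x‖ ≤ ep (1 / (2 * γ)) * ‖(x.2 : ℂ) - w0 x.1‖ ^ 2)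
    (hGG : ∀ t (w w' : closedBall (0 : ℂ) r), ‖G (t, w) - G (t, w')‖ ≤
      ep (1 / (2 * γ)) * max ‖(w : ℂ) - w0 t‖ ‖(w' : ℂ) - w0 t‖ * ‖(w : ℂ) - w'‖) : A = ⊤ := by
  have hγ0 : 0 < γ := by linarith
  set a : ℝ := 1 / (2 * γ) with ha
  have ha0 : 0 < a := by positivity
  have ha1 : a < 1 := by rw [ha, div_lt_one (by positivity)]; linarith
  let Lw : C(Cb m T, ℂ) := ⟨fun t => Lf a (w0 t), by
    unfold Lf
    exact (Complex.continuous_conj.comp w0.continuous).add (continuous_const.mul w0.continuous)⟩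
  let e1 : C(Cb m T, ℂ) := (2 * (a : ℂ)) • Lw + p
  let e2 : C(Cb m T, ℂ) := Lw * Lw + c
  let Q : C(Cb m T × closedBall (0 : ℂ) r, ℂ) :=
    ((γ : ℂ)⁻¹) • h0 + ((a : ℂ) ^ 2 - 1) • (wc * wc) -
      e1.comp ContinuousMap.fst * (wc - w0.comp ContinuousMap.fst) - e2.comp ContinuousMap.fst
  have hQ : Q ∈ A := by
    apply A.sub_mem _ (ht _)
    apply A.sub_mem
    · exact A.add_mem (A.smul_mem hh0 _) (A.smul_mem (A.mul_mem hw hw) _)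
    · exact A.mul_mem (ht _) (A.sub_mem hw (ht _))
  refine main_top A hA ht hw ha0 ha1 w0 G Q hQ ?_ hG hGG
  intro x
  have h1 := hF x
  rw [Complex.real_smul, Complex.ofReal_inv] at h1
  change (γ : ℂ)⁻¹ * h0 x + ((a : ℂ) ^ 2 - 1) * ((x.2 : ℂ) * (x.2 : ℂ)) -
    (2 * (a : ℂ) * Lf a (w0 x.1) + p x.1) * ((x.2 : ℂ) - w0 x.1) -
      (Lf a (w0 x.1) * Lf a (w0 x.1) + c x.1) = _
  have hg : (γ : ℂ) ≠ 0 := by exact_mod_cast hγ0.ne'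
  have hga : (γ : ℂ)⁻¹ = 2 * a := by
    rw [ha]; push_cast; field_simp
  have hgg : (γ : ℂ)⁻¹ * γ = 1 := inv_mul_cancel₀ hg
  rw [hh]
  simp only [Lf, map_sub] at h1 ⊢
  linear_combination h1 + ((x.2 : ℂ) * conj (x.2 : ℂ)) * hga +
    ((x.2 : ℂ) ^ 2 + (conj (x.2 : ℂ)) ^ 2) * hgg

lemma smul_data {E : Type*} [NormedAddCommGroup E] [NormedSpace ℝ E]
    {V : Type*} [NormedAddCommGroup V] [NormedSpace ℝ V] (F : E → V) (c : ℝ)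
    {x : E} (h1 : fderiv ℝ F x = 0) (h2 : fderiv ℝ (fderiv ℝ F) x = 0) :
    fderiv ℝ (fun x => c • F x) x = 0 ∧ fderiv ℝ (fderiv ℝ (fun x => c • F x)) x = 0 := by
  have hsm : fderiv ℝ (fun x => c • F x) = c • fderiv ℝ F := fderiv_const_smul_field (f := F) c
  have hsm2 : fderiv ℝ (c • fderiv ℝ F) = c • fderiv ℝ (fderiv ℝ F) :=
    fderiv_const_smul_field (f := fderiv ℝ F) c
  refine ⟨?_, ?_⟩
  · rw [hsm, Pi.smul_apply, h1]
    ext u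
    simp
  · rw [hsm, hsm2, Pi.smul_apply, h2]
    ext u v
    simp

end FHP

/-- **flat hyperbolic point.** Let `n ≥ 3`, `γ > 1/2`, `T, r > 0`. Let
`f_j : [−T,T]^{n−2} → ℝ` (`j = 1,…,n−2`) be smooth functions vanishing to order two at `0`,
where `f_j` depends only on `t₁,…,t_j`, and let `F : [−T,T]^{n−2} × D̄_r(0) → ℂ` be smooth
vanishing to order three at `0`. For `0 < T' ≤ T`, `0 < r' ≤ r` let `M_{T',r'} ⊆ ℂⁿ` be the
image of `(t,w) ↦ (t₁ + i f₁(t), …, t_{n−2} + i f_{n−2}(t), w, w w̄ + γ(w² + w̄²) + F(t,w))`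
over `t ∈ [−T',T']^{n−2}`, `w ∈ D̄_{r'}(0)`. Then there are `T' ∈ (0,T]` and `r' ∈ (0,r]`
such that `M_{T',r'}` is polynomially convex and satisfies `𝒫 = 𝒞`; in particular
`M_{T,r}` is locally polynomially convex at `0`. -/
theorem flat_hyperbolic_point_locally_polyConvex
    (n : ℕ) (hn : 3 ≤ n) (γ T r : ℝ) (hγ : 1/2 < γ) (hT : 0 < T) (hr : 0 < r)
    (f : Fin (n - 2) → (Fin (n - 2) → ℝ) → ℝ)
    (hfdep : ∀ j, ∀ t t' : Fin (n - 2) → ℝ, (∀ i, i ≤ j → t i = t' i) → f j t = f j t')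
    (hfs : ∀ j, ContDiffOn ℝ (⊤ : ℕ∞) (f j) (Set.univ.pi fun _ => Set.Icc (-T) T))
    (hf2 : ∀ j, ∀ k : ℕ, k ≤ 1 → iteratedFDeriv ℝ k (f j) 0 = 0)
    (F : ((Fin (n - 2) → ℝ) × ℂ) → ℂ)
    (hFs : ContDiffOn ℝ (⊤ : ℕ∞) F
      ((Set.univ.pi fun _ => Set.Icc (-T) T) ×ˢ closedBall (0 : ℂ) r))
    (hF3 : ∀ k : ℕ, k ≤ 2 → iteratedFDeriv ℝ k F 0 = 0)
    (M : ℝ → ℝ → Set (Fin n → ℂ))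
    (hM : ∀ T' r' : ℝ, M T' r' = { z : Fin n → ℂ | ∃ t : Fin (n - 2) → ℝ, ∃ w : ℂ,
      (∀ j, |t j| ≤ T') ∧ ‖w‖ ≤ r' ∧
      z = fun i : Fin n =>
        if h : (i : ℕ) < n - 2 then
          (t ⟨i.1, h⟩ : ℂ) + (f ⟨i.1, h⟩ t : ℂ) * Complex.I
        else if (i : ℕ) = n - 2 then w
        else w * conj w + (γ : ℂ) * (w ^ 2 + (conj w) ^ 2) + F (t, w) }) :
    ∃ T' : ℝ, 0 < T' ∧ T' ≤ T ∧ ∃ r' : ℝ, 0 < r' ∧ r' ≤ r ∧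
      IsPolyConvex (M T' r') ∧ PolyDenseInC (M T' r') := by
  obtain ⟨m, rfl⟩ : ∃ m, n = m + 2 := ⟨n - 2, by omega⟩
  change Fin m → (Fin m → ℝ) → ℝ at f
  change (Fin m → ℝ) × ℂ → ℂ at F
  have hγ0 : 0 < γ := by linarith
  have ha0 : 0 < 1 / (2 * γ) := by positivity
  have ha1 : 1 / (2 * γ) < 1 := by rw [div_lt_one (by positivity)]; linarith
  -- neighbourhoods
  have hcube : (Set.univ.pi fun _ : Fin m => Set.Icc (-T) T) ∈ nhds (0 : Fin m → ℝ) := by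
    apply set_pi_mem_nhds Set.finite_univ
    intro i _
    exact Icc_mem_nhds (by simpa using hT) (by simpa using hT)
  have hfc : ∀ j : Fin m, ContDiffAt ℝ 1 (f j) 0 := fun j =>
    ((hfs j).contDiffAt hcube).of_le (by exact_mod_cast le_top)
  have hFc : ContDiffAt ℝ 2 F 0 := by
    refine (hFs.contDiffAt ?_).of_le (WithTop.coe_le_coe.2 (le_top : (2 : ℕ∞) ≤ ⊤))
    exact prod_mem_nhds hcube (closedBall_mem_nhds 0 hr)
  obtain ⟨δ, hδ, hL⟩ := FHP.exists_lip f hfc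
    (fun j => (FHP.fderiv_data (f j) 0).1 (hf2 j 1 le_rfl))
  have hf0 : ∀ j : Fin m, f j 0 = 0 := by
    intro j
    have h1 := hf2 j 0 (by norm_num)
    have h2 := iteratedFDeriv_zero_apply (𝕜 := ℝ) (f := f j) (x := 0) 0
    rw [h1] at h2
    exact h2.symm
  have hF1 : fderiv ℝ F 0 = 0 := (FHP.fderiv_data F 0).1 (hF3 1 (by norm_num))
  have hF2 : fderiv ℝ (fderiv ℝ F) 0 = 0 := (FHP.fderiv_data F 0).2 (hF3 2 le_rfl)
  obtain ⟨ρ, hρ, τ, hτ, hdata⟩ := FHP.exists_data (m := m) (fun x => γ⁻¹ • F x)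
    (hFc.const_smul _) (FHP.smul_data F γ⁻¹ hF1 hF2).1 (FHP.smul_data F γ⁻¹ hF1 hF2).2
    ha0 ha1 (FHP.ep_pos ha1)
  set T' := min T (min τ (δ / 2)) with hT'
  set r' := min r ρ with hr'
  have hT'0 : 0 < T' := lt_min hT (lt_min hτ (by positivity))
  have hr'0 : 0 < r' := lt_min hr hρ
  have hT'T : T' ≤ T := min_le_left _ _
  have hr'r : r' ≤ r := min_le_left _ _
  have hT'δ : 2 * T' ≤ δ := by
    have : T' ≤ δ / 2 := (min_le_right _ _).trans (min_le_right _ _)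
    linarith
  obtain ⟨w0, c, p, G, hF', hG, hGG⟩ := hdata T' r' ((min_le_right _ _).trans (min_le_left _ _))
    (min_le_right _ _)
  refine ⟨T', hT'0, hT'T, r', hr'0, hr'r, ?_⟩
  have hcubem : ∀ t : FHP.Cb m T', t.1 ∈ (Set.univ.pi fun _ : Fin m => Set.Icc (-T) T) := by
    intro t i _
    have h1 := (pi_norm_le_iff_of_nonneg hT'0.le).1 (mem_closedBall_zero_iff.1 t.2) i
    rw [Real.norm_eq_abs] at h1
    exact abs_le.1 (h1.trans hT'T)
  let zf : Fin m → C(FHP.Cb m T' × closedBall (0 : ℂ) r', ℂ) := fun j =>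
    ⟨fun x => (x.1.1 j : ℂ) + (f j x.1.1 : ℂ) * Complex.I, by
      apply Continuous.add
      · exact Complex.continuous_ofReal.comp
          ((continuous_apply j).comp (continuous_subtype_val.comp continuous_fst))
      · apply Continuous.mul _ continuous_const
        apply Complex.continuous_ofReal.comp
        exact ((hfs j).continuousOn).comp_continuous (continuous_subtype_val.comp continuous_fst)
          (fun x => hcubem x.1)⟩
  let h0 : C(FHP.Cb m T' × closedBall (0 : ℂ) r', ℂ) :=
    ⟨fun x => (x.2 : ℂ) * conj (x.2 : ℂ) + (γ : ℂ) * ((x.2 : ℂ) ^ 2 + (conj (x.2 : ℂ)) ^ 2)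
      + F (x.1.1, x.2.1), by
      have hc : Continuous fun x : FHP.Cb m T' × closedBall (0 : ℂ) r' => conj (x.2 : ℂ) :=
        Complex.continuous_conj.comp (continuous_subtype_val.comp continuous_snd)
      apply Continuous.add
      · fun_prop
      · refine hFs.continuousOn.comp_continuous (f := fun x : FHP.Cb m T' × closedBall (0 : ℂ) r' =>
            ((x.1.1, x.2.1) : (Fin m → ℝ) × ℂ)) (by fun_prop) (fun x => ⟨hcubem x.1, ?_⟩)
        exact closedBall_subset_closedBall hr'r x.2.2⟩
  let φ : Fin (m + 2) → C(FHP.Cb m T' × closedBall (0 : ℂ) r', ℂ) := fun i =>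
    if h : (i : ℕ) < m then zf ⟨i.1, h⟩ else if (i : ℕ) = m then FHP.wc else h0
  let A := (MvPolynomial.aeval φ :
    MvPolynomial (Fin (m + 2)) ℂ →ₐ[ℂ] C(FHP.Cb m T' × closedBall (0 : ℂ) r', ℂ)).range.topologicalClosure
  have hA : IsClosed (A : Set C(FHP.Cb m T' × closedBall (0 : ℂ) r', ℂ)) :=
    Subalgebra.isClosed_topologicalClosure _
  have hφA : ∀ i, φ i ∈ A := fun i =>
    Subalgebra.le_topologicalClosure _ ⟨MvPolynomial.X i, MvPolynomial.aeval_X φ i⟩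
  have hzA : ∀ j, zf j ∈ A := by
    intro j
    have h1 := hφA ⟨j.1, by omega⟩
    have h2 : φ ⟨j.1, by omega⟩ = zf j := dif_pos j.2
    rwa [h2] at h1
  have hwA : FHP.wc ∈ A := by
    have h1 := hφA ⟨m, by omega⟩
    have h2 : φ ⟨m, by omega⟩ = FHP.wc := by simp [φ]
    rwa [h2] at h1
  have h0A : h0 ∈ A := by
    have h1 := hφA ⟨m + 1, by omega⟩
    have h2 : φ ⟨m + 1, by omega⟩ = h0 := by simp [φ]
    rwa [h2] at h1
  have ht : ∀ ψ : C(FHP.Cb m T', ℂ), ψ.comp ContinuousMap.fst ∈ A := by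
    refine FHP.coords_mem hT'0 A hA f hfdep hf0 ?_ zf hzA (fun j x => rfl)
    intro j t ht t' ht'
    exact hL j t (closedBall_subset_closedBall hT'δ ht) t' (closedBall_subset_closedBall hT'δ ht')
  have htop : A = ⊤ :=
    FHP.alg_top hT'0 hγ A hA ht hwA h0 h0A F (fun x => rfl) w0 c p G hF' hG hGG
  have hrange : M T' r' = Set.range fun x i => φ i x := by
    rw [hM]
    ext z
    have hφx : ∀ (x : FHP.Cb m T' × closedBall (0 : ℂ) r') (i : Fin (m + 2)), φ i x =
        if h : (i : ℕ) < m then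
          (x.1.1 ⟨i.1, h⟩ : ℂ) + (f ⟨i.1, h⟩ x.1.1 : ℂ) * Complex.I
        else if (i : ℕ) = m then (x.2 : ℂ)
        else (x.2 : ℂ) * conj (x.2 : ℂ) + (γ : ℂ) * ((x.2 : ℂ) ^ 2 + (conj (x.2 : ℂ)) ^ 2)
          + F (x.1.1, x.2.1) := by
      intro x i
      simp only [φ]
      split_ifs <;> rfl
    constructor
    · rintro ⟨t, w, ht, hw, rfl⟩
      refine ⟨(⟨t, mem_closedBall_zero_iff.2 ((pi_norm_le_iff_of_nonneg hT'0.le).2 ht)⟩,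
        ⟨w, mem_closedBall_zero_iff.2 hw⟩), ?_⟩
      funext i
      exact hφx _ i
    · rintro ⟨x, rfl⟩
      refine ⟨x.1.1, x.2.1, (pi_norm_le_iff_of_nonneg hT'0.le).1 (mem_closedBall_zero_iff.1 x.1.2),
        mem_closedBall_zero_iff.1 x.2.2, ?_⟩
      funext i
      exact hφx x i
  have hd : PolyDenseInC (M T' r') := FHP.dense_of_top φ htop _ hrange
  refine ⟨FHP.polyConvex_of_dense _ ?_ hd, hd⟩
  rw [hrange]
  exact isCompact_range (continuous_pi fun i => (φ i).continuous)
end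
end

section
/- Let γ > 1/2, R > 0, and let F : \bar{D}_R(0) → ℂ be a smooth function vanishing to order three at 0. Choose r ∈ (0,R] such that ‖F‖_{C²(\bar{D}_r(0))} ≤ (2γ−1)³/(2¹⁴ γ³). Define M_r = { (z, z\bar z + γ(z² + \bar z²) + F(z,\bar z)) : z ∈ \bar{D}_r(0) } ⊆ ℂ². Then M_r is polynomially convex and satisfies 𝒫(M_r) = 𝒞(M_r). -/
open Complex Metric ComplexConjugate

noncomputable section

/-- Directional partial derivative (over ℝ) of `F : ℂ → ℂ` along `v`;
`pd 1 F = F_x` and `pd Complex.I F = F_y`. -/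
def pd (v : ℂ) (F : ℂ → ℂ) : ℂ → ℂ := fun z => fderiv ℝ F z v

/-- `B` is a bound for all partial derivatives of order `≤ 2` of `F` (w.r.t. the real
coordinates `x, y`) on the set `s`; i.e. `‖F‖_{C²(s)} ≤ B`. -/
def IsC2Bound (F : ℂ → ℂ) (s : Set ℂ) (B : ℝ) : Prop :=
  ∀ z ∈ s, ‖F z‖ ≤ B ∧ ‖pd 1 F z‖ ≤ B ∧ ‖pd Complex.I F z‖ ≤ B ∧
    ‖pd 1 (pd 1 F) z‖ ≤ B ∧ ‖pd Complex.I (pd 1 F) z‖ ≤ B ∧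
    ‖pd 1 (pd Complex.I F) z‖ ≤ B ∧ ‖pd Complex.I (pd Complex.I F) z‖ ≤ B


lemma aux_resolvent {X : Type*} [TopologicalSpace X] [CompactSpace X]
    (S : Subalgebra ℂ C(X, ℂ)) (hS : IsClosed (S : Set C(X, ℂ))) (q : S)
    (hq : ∀ x, ∀ s : ℝ, 0 < s → (q : C(X, ℂ)) x + (s : ℂ) ≠ 0) (s : ℝ) (hs : 0 < s) :
    (-(s : ℂ)) ∉ spectrum ℂ q := by
  intro hmem
  have := hS
  have hb := Subalgebra.spectrum_isBounded_connectedComponentIn S q hmem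
  set ray : Set ℂ := (fun t : ℝ => (-(t : ℂ))) '' Set.Ioi 0 with hray
  have hconn : IsPreconnected ray :=
    isPreconnected_Ioi.image _ (by fun_prop)
  have hsub : ray ⊆ (spectrum ℂ (q : C(X, ℂ)))ᶜ := by
    rintro _ ⟨t, ht, rfl⟩ h
    rw [ContinuousMap.spectrum_eq_range] at h
    obtain ⟨x, hx⟩ := h
    exact hq x t ht (by rw [hx]; simp)
  have h1 : ray ⊆ connectedComponentIn (spectrum ℂ (q : C(X, ℂ)))ᶜ (-(s : ℂ)) :=
    hconn.subset_connectedComponentIn ⟨s, hs, rfl⟩ hsub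
  have h2 := hb.subset h1
  obtain ⟨C, hC⟩ := h2.exists_norm_le
  have := hC (-((|C| + 1 : ℝ) : ℂ)) ⟨|C| + 1, Set.mem_Ioi.2 (by positivity), rfl⟩
  rw [norm_neg, Complex.norm_real, Real.norm_of_nonneg (by positivity)] at this
  linarith [le_abs_self C]

lemma aux_inv {X : Type*} [TopologicalSpace X] [CompactSpace X]
    (S : Subalgebra ℂ C(X, ℂ)) (hS : IsClosed (S : Set C(X, ℂ))) (q : C(X, ℂ)) (hqS : q ∈ S)
    (hq : ∀ x, ∀ s : ℝ, 0 < s → q x + (s : ℂ) ≠ 0) (s : ℝ) (hs : 0 < s) :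
    ∃ p ∈ S, ∀ x, p x * (q x + s) = 1 := by
  have h := aux_resolvent S hS ⟨q, hqS⟩ hq s hs
  rw [spectrum.notMem_iff] at h
  obtain ⟨u, hu⟩ := h
  refine ⟨-((↑u⁻¹ : S) : C(X, ℂ)), S.neg_mem (↑u⁻¹ : S).2, fun x => ?_⟩
  have h1 : ((↑u⁻¹ : S) * (u : S)) = 1 := u.inv_mul
  rw [hu] at h1
  have h2 := congrArg (fun f : S => (f : C(X, ℂ)) x) h1
  simp [Algebra.algebraMap_eq_smul_one] at h2
  simp
  linear_combination h2

lemma mem_of_approx {X : Type*} [TopologicalSpace X] [CompactSpace X]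
    (S : Subalgebra ℂ C(X, ℂ)) (hS : IsClosed (S : Set C(X, ℂ))) (Q : C(X, ℂ))
    (h : ∀ δ : ℝ, 0 < δ → ∃ p ∈ S, ∀ x, ‖Q x - p x‖ ≤ δ) : Q ∈ S := by
  have : Q ∈ closure (S : Set C(X, ℂ)) := by
    rw [Metric.mem_closure_iff]
    intro ε hε
    obtain ⟨p, hp, hpx⟩ := h (ε / 2) (by positivity)
    refine ⟨p, hp, lt_of_le_of_lt ?_ (half_lt_self hε)⟩
    rw [ContinuousMap.dist_le (by positivity)]
    intro x; rw [dist_eq_norm]; exact hpx x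
  rwa [hS.closure_eq] at this

/-- the recursion pair -/
def abPair {R : Type*} [CommRing R] (q : R) : ℕ → R × R
  | 0 => (1, 0)
  | n + 1 => ((abPair q n).1 + q * (abPair q n).2, (abPair q n).1 + (abPair q n).2)

lemma abPair_spec {R : Type*} [CommRing R] (q Q : R) (h : Q * Q = q) (n : ℕ) :
    (abPair q n).1 + Q * (abPair q n).2 = (1 + Q) ^ n ∧
    (abPair q n).1 - Q * (abPair q n).2 = (1 - Q) ^ n := by
  induction n with
  | zero => simp [abPair]
  | succ n ih =>
    obtain ⟨h1, h2⟩ := ih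
    simp only [abPair, pow_succ, ← h1, ← h2, ← h]
    constructor <;> ring

lemma abPair_map {R T : Type*} [CommRing R] [CommRing T] (f : R →+* T) (q : R) (n : ℕ) :
    f (abPair q n).1 = (abPair (f q) n).1 ∧ f (abPair q n).2 = (abPair (f q) n).2 := by
  induction n with
  | zero => simp [abPair]
  | succ n ih => simp [abPair, ih.1, ih.2]

lemma norm_one_sub_lt {Q : ℂ} (h : 0 < Q.re) : ‖1 - Q‖ < ‖1 + Q‖ := by
  have : ‖1 - Q‖ ^ 2 < ‖1 + Q‖ ^ 2 := by
    rw [← Complex.normSq_eq_norm_sq, ← Complex.normSq_eq_norm_sq, normSq_apply, normSq_apply]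
    simp
    nlinarith
  exact lt_of_pow_lt_pow_left₀ 2 (norm_nonneg _) this

lemma csqrt_spec {w : ℂ} (hw : w ∈ slitPlane) :
    0 < (w ^ (1 / 2 : ℂ)).re ∧ w ^ (1 / 2 : ℂ) * w ^ (1 / 2 : ℂ) = w := by
  have h0 := slitPlane_ne_zero hw
  constructor
  · rw [cpow_def_of_ne_zero h0, Complex.exp_re]
    apply mul_pos (Real.exp_pos _)
    apply Real.cos_pos_of_mem_Ioo
    have h1 := Complex.neg_pi_lt_arg w
    have h2 := Complex.arg_le_pi w
    have h3 : arg w ≠ Real.pi := by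
      rw [mem_slitPlane_iff_arg] at hw; exact hw.1
    have h4 : arg w < Real.pi := lt_of_le_of_ne h2 h3
    have : (Complex.log w * (1/2)).im = arg w / 2 := by
      have : (1/2 : ℂ) = ((1/2 : ℝ) : ℂ) := by norm_num
      rw [this, Complex.im_mul_ofReal, Complex.log_im]; ring
    rw [this]
    constructor <;> linarith
  · rw [← Complex.cpow_add _ _ h0]; norm_num

lemma abPair_snd_ne {w : ℂ} (hw : w ∈ slitPlane) {n : ℕ} (hn : n ≠ 0) :
    (abPair w n).2 ≠ 0 := by
  obtain ⟨h1, h2⟩ := csqrt_spec hw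
  obtain ⟨h3, h4⟩ := abPair_spec w _ h2 n
  intro h
  rw [h] at h3 h4
  have h5 := norm_one_sub_lt h1
  have : ‖1 - w ^ (1 / 2 : ℂ)‖ ^ n < ‖1 + w ^ (1 / 2 : ℂ)‖ ^ n :=
    pow_lt_pow_left₀ h5 (norm_nonneg _) hn
  rw [← norm_pow, ← norm_pow, ← h3, ← h4] at this
  simp at this

lemma slit_of_not_neg {w : ℂ} (hw : ∀ s : ℝ, 0 < s → w ≠ -(s : ℂ)) {ε : ℝ} (hε : 0 < ε) :
    w + ε ∈ slitPlane := by
  rw [mem_slitPlane_iff]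
  by_contra! h
  have him : w.im = 0 := by simpa using h.2
  have hre : w.re + ε ≤ 0 := by simpa using h.1
  exact hw (-w.re) (by linarith) (by apply Complex.ext <;> simp [him])

lemma aux_bunit {X : Type*} [TopologicalSpace X] [CompactSpace X]
    (S : Subalgebra ℂ C(X, ℂ)) (hS : IsClosed (S : Set C(X, ℂ))) (q : S)
    (hq : ∀ x, ∀ s : ℝ, 0 < s → (q : C(X, ℂ)) x + (s : ℂ) ≠ 0) (ε : ℝ) (hε : 0 < ε)
    (n : ℕ) (hn : n ≠ 0) :
    IsUnit (abPair (q + algebraMap ℂ S ε) n).2 := by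
  have : CompleteSpace S := hS.completeSpace_coe
  by_contra h
  obtain ⟨f, hf⟩ := WeakDual.CharacterSpace.exists_apply_eq_zero h
  let φ : S →ₐ[ℂ] ℂ := WeakDual.CharacterSpace.toAlgHom f
  have hφ : φ (abPair (q + algebraMap ℂ S ε) n).2 = 0 := hf
  have h1 := (abPair_map (φ : S →+* ℂ) (q + algebraMap ℂ S ε) n).2
  have h2 : (φ : S →+* ℂ) (q + algebraMap ℂ S ε) = φ q + ε := by simp
  rw [h2] at h1
  refine abPair_snd_ne (slit_of_not_neg (w := φ q) ?_ hε) hn (h1.symm.trans hφ)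
  intro s hs he
  apply aux_resolvent S hS q hq s hs
  rw [← he]
  exact AlgHom.apply_mem_spectrum φ q

lemma aux_sqrt_close {a b : ℂ} {ε : ℝ} (ha : 0 < a.re) (hb : 0 ≤ b.re) (hε : 0 < ε)
    (h : a * a = b * b + ε) : ‖a - b‖ ^ 2 ≤ ε := by
  have hi := congrArg Complex.im h
  have hr := congrArg Complex.re h
  simp at hi hr
  have h1 : a.re * a.im = b.re * b.im := by linarith
  have h2 : 0 ≤ a.re * (a.im * b.im) := by
    have : a.re * (a.im * b.im) = b.re * (b.im * b.im) := by linear_combination b.im * h1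
    rw [this]; exact mul_nonneg hb (mul_self_nonneg _)
  have h3 : 0 ≤ a.im * b.im := nonneg_of_mul_nonneg_right h2 ha
  have h4 : ‖a - b‖ ≤ ‖a + b‖ := by
    apply le_of_sq_le_sq _ (norm_nonneg _)
    rw [← Complex.normSq_eq_norm_sq, ← Complex.normSq_eq_norm_sq, normSq_apply, normSq_apply]
    simp
    nlinarith [mul_nonneg ha.le hb]
  have h5 : ‖a - b‖ * ‖a + b‖ = ε := by
    rw [← norm_mul, show (a - b) * (a + b) = (ε : ℂ) by linear_combination h, Complex.norm_real,
      Real.norm_of_nonneg hε.le]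
  nlinarith [norm_nonneg (a - b)]

/-- If `Q² ∈ S` and `Q` has values in the right half plane (touching the axis only at 0),
then `Q ∈ S`. -/
lemma aux_sqrt_mem {X : Type*} [TopologicalSpace X] [CompactSpace X]
    (S : Subalgebra ℂ C(X, ℂ)) (hS : IsClosed (S : Set C(X, ℂ))) (Q : C(X, ℂ))
    (hQS : Q * Q ∈ S) (hQ : ∀ x, 0 ≤ (Q x).re) (hQ0 : ∀ x, (Q x).re = 0 → Q x = 0) :
    Q ∈ S := by
  have hneg : ∀ x, ∀ s : ℝ, 0 < s → (Q * Q) x + (s : ℂ) ≠ 0 := by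
    intro x s hs h
    have hi := congrArg Complex.im h
    have hr := congrArg Complex.re h
    simp at hi hr
    rcases eq_or_lt_of_le (hQ x) with h0 | h0
    · have := hQ0 x h0.symm
      simp [this] at hr
      linarith
    · have : (Q x).im = 0 := by
        have : (Q x).re * (Q x).im = 0 := by linarith
        rcases mul_eq_zero.1 this with h | h
        · linarith
        · exact h
      rw [this] at hr
      nlinarith
  have hslit : ∀ x, ∀ ε : ℝ, 0 < ε → (Q * Q) x + (ε : ℂ) ∈ slitPlane := fun x ε hε =>
    slit_of_not_neg (fun s hs h => hneg x s hs (by rw [h]; simp)) hε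
  -- shifted roots lie in S
  have key : ∀ ε : ℝ, 0 < ε → ∃ P ∈ S, ∀ x, 0 < (P x).re ∧ P x * P x = Q x * Q x + ε := by
    intro ε hε
    let P : C(X, ℂ) := ⟨fun x => ((Q * Q) x + ε) ^ (1 / 2 : ℂ), by
      apply Continuous.cpow _ continuous_const
      · intro x; exact hslit x ε hε
      · fun_prop⟩
    have hP : ∀ x, 0 < (P x).re ∧ P x * P x = Q x * Q x + ε := fun x => csqrt_spec (hslit x ε hε)
    refine ⟨P, ?_, hP⟩
    rcases isEmpty_or_nonempty X with hX | hX
    · have : P = 0 := by ext x; exact hX.elim x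
      rw [this]; exact S.zero_mem
    have hne : ∀ x, 1 + P x ≠ 0 := by
      intro x h
      have := congrArg Complex.re h
      simp at this
      linarith [(hP x).1]
    have hcont : Continuous fun x => ‖1 - P x‖ / ‖1 + P x‖ := by
      apply Continuous.div (by fun_prop) (by fun_prop)
      intro x; simpa using hne x
    obtain ⟨x0, -, hx0⟩ := isCompact_univ.exists_isMaxOn Set.univ_nonempty hcont.continuousOn
    set θ := ‖1 - P x0‖ / ‖1 + P x0‖ with hθ
    have hθ0 : 0 ≤ θ := by positivity
    have hθ1 : θ < 1 := by
      rw [hθ, div_lt_one (norm_pos_iff.2 (hne x0))]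
      exact norm_one_sub_lt (hP x0).1
    have hθx : ∀ x, ‖1 - P x‖ ≤ θ * ‖1 + P x‖ := by
      intro x
      rw [← div_le_iff₀ (norm_pos_iff.2 (hne x))]
      exact hx0 (Set.mem_univ x)
    have hlim : Filter.Tendsto (fun n : ℕ => 2 * ‖P‖ * θ ^ n / (1 - θ ^ n)) Filter.atTop
        (nhds 0) := by
      have h1 := tendsto_pow_atTop_nhds_zero_of_lt_one hθ0 hθ1
      have h2 : Filter.Tendsto (fun n : ℕ => 2 * ‖P‖ * θ ^ n / (1 - θ ^ n)) Filter.atTop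
        (nhds (2 * ‖P‖ * 0 / (1 - 0))) := by
        apply Filter.Tendsto.div (h1.const_mul _) (h1.const_sub _) (by norm_num)
      simpa using h2
    apply mem_of_approx S hS
    intro δ hδ
    obtain ⟨n, hn1, hn⟩ := ((hlim.eventually_lt_const hδ).and
      (Filter.eventually_ge_atTop 1)).exists
    have hn0 : n ≠ 0 := by omega
    let q : S := ⟨Q * Q, hQS⟩
    obtain ⟨u, hu⟩ := aux_bunit S hS q hneg ε hε n hn0
    refine ⟨((abPair (q + algebraMap ℂ S ε) n).1 * (↑u⁻¹ : S) : S), Subtype.property _,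
      fun x => ?_⟩
    let ev : S →+* ℂ := (Pi.evalRingHom (fun _ : X => ℂ) x).comp
      ((ContinuousMap.coeFnRingHom : C(X, ℂ) →+* (X → ℂ)).comp (S.val : S →+* C(X, ℂ)))
    have hev : ∀ f : S, ev f = (f : C(X, ℂ)) x := fun f => rfl
    rw [← hev]
    obtain ⟨m1, m2⟩ := abPair_map ev (q + algebraMap ℂ S ε) n
    have hq : ev (q + algebraMap ℂ S ε) = Q x * Q x + ε := by
      rw [hev]; simp [q, Algebra.algebraMap_eq_smul_one]
    rw [hq] at m1 m2
    obtain ⟨s1, s2⟩ := abPair_spec _ _ (hP x).2 n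
    rw [← m1, ← m2] at s1 s2
    rw [← hu] at s1 s2
    set a := ev (abPair (q + algebraMap ℂ S ε) n).1
    set b := ev u
    have hbi : b * ev (↑u⁻¹ : S) = 1 := by
      simp only [b]; rw [← map_mul]; simp
    rw [map_mul]
    change ‖P x - a * ev (↑u⁻¹ : S)‖ ≤ δ
    have hb0 : b ≠ 0 := left_ne_zero_of_mul_eq_one hbi
    have hinv : ev (↑u⁻¹ : S) = b⁻¹ := eq_inv_of_mul_eq_one_right hbi
    rw [hinv]
    have e1 : P x - a * b⁻¹ = - ((1 - P x) ^ n * b⁻¹) := by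
      rw [← s2]; field_simp; ring
    rw [e1, norm_neg, norm_mul, norm_inv, norm_pow]
    have e2 : 2 * P x * b = (1 + P x) ^ n - (1 - P x) ^ n := by rw [← s1, ← s2]; ring
    have e3 : ‖1 + P x‖ ^ n - ‖1 - P x‖ ^ n ≤ 2 * ‖P x‖ * ‖b‖ := by
      have := norm_sub_norm_le ((1 + P x) ^ n) ((1 - P x) ^ n)
      rw [← e2, norm_mul, norm_mul, norm_pow, norm_pow] at this
      simpa using this
    have e4 : ‖1 - P x‖ ^ n ≤ θ ^ n * ‖1 + P x‖ ^ n := by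
      rw [← mul_pow]; exact pow_le_pow_left₀ (norm_nonneg _) (hθx x) n
    have e5 : 0 < ‖1 + P x‖ ^ n := pow_pos (norm_pos_iff.2 (hne x)) n
    have e6 : θ ^ n < 1 := pow_lt_one₀ hθ0 hθ1 hn0
    have e7 : ‖P x‖ ≤ ‖P‖ := P.norm_coe_le_norm x
    have e8 : 0 < ‖b‖ := norm_pos_iff.2 hb0
    refine le_trans ?_ hn1.le
    rw [← div_eq_mul_inv, div_le_div_iff₀ e8 (by linarith)]
    have e9 : (1 - θ ^ n) * ‖1 + P x‖ ^ n ≤ 2 * ‖P‖ * ‖b‖ := by nlinarith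
    calc ‖1 - P x‖ ^ n * (1 - θ ^ n) ≤ θ ^ n * ‖1 + P x‖ ^ n * (1 - θ ^ n) :=
          mul_le_mul_of_nonneg_right e4 (by linarith)
      _ = θ ^ n * ((1 - θ ^ n) * ‖1 + P x‖ ^ n) := by ring
      _ ≤ θ ^ n * (2 * ‖P‖ * ‖b‖) := mul_le_mul_of_nonneg_left e9 (by positivity)
      _ = 2 * ‖P‖ * θ ^ n * ‖b‖ := by ring
  apply mem_of_approx S hS
  intro δ hδ
  obtain ⟨P, hPS, hP⟩ := key (δ ^ 2) (by positivity)
  refine ⟨P, hPS, fun x => ?_⟩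
  have := aux_sqrt_close (hP x).1 (hQ x) (by positivity) (hP x).2
  rw [norm_sub_rev]
  exact le_of_sq_le_sq this hδ.le
open MeasureTheory

lemma integrableOn_inv_norm (R : ℝ) :
    IntegrableOn (fun b : ℂ => ‖b‖⁻¹) (closedBall 0 R) := by
  have h : IntegrableOn (fun b : ℂ => ‖b‖⁻¹) (ball 0 (R + 1)) := by
    rw [integrableOn_fun_norm_addHaar (μ := (volume : Measure ℂ)) (f := fun y => y⁻¹)]
    have h1 : IntegrableOn (fun _ : ℝ => (1 : ℝ)) (Set.Ioo 0 (R + 1)) := by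
      simp
    refine h1.congr_fun ?_ measurableSet_Ioo
    intro y hy
    have : y ≠ 0 := hy.1.ne'
    simp [this]
  exact h.mono_set (closedBall_subset_ball (by linarith))

lemma circle_inner (z : ℂ) (ρ : ℝ) (hρ : 0 < ρ) (h : ρ ≠ ‖z‖) :
    ∫ θ in Set.Ioo (-Real.pi) Real.pi, (z - Complex.polarCoord.symm (ρ, θ))⁻¹
      = if ρ < ‖z‖ then 2 * Real.pi / z else 0 := by
  have h1 : ∀ θ : ℝ, Complex.polarCoord.symm (ρ, θ) = circleMap 0 ρ θ := by
    intro θ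
    simp [circleMap, Complex.exp_mul_I]
  simp only [h1]
  rw [← integral_Ioc_eq_integral_Ioo, ← intervalIntegral.integral_of_le (by linarith [Real.pi_pos])]
  have h2 : Function.Periodic (fun θ : ℝ => (z - circleMap 0 ρ θ)⁻¹) (2 * Real.pi) := by
    intro θ
    simp only [periodic_circleMap 0 ρ θ]
  have h3 := h2.intervalIntegral_add_eq (-Real.pi) 0
  rw [show -Real.pi + 2 * Real.pi = Real.pi by ring, zero_add] at h3
  rw [h3]
  have h4 : ∫ θ in (0 : ℝ)..(2 * Real.pi), (z - circleMap 0 ρ θ)⁻¹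
      = (2 * Real.pi) * Real.circleAverage (fun a => (z - a)⁻¹) 0 ρ := by
    rw [Real.circleAverage]
    have : (Real.pi : ℂ) ≠ 0 := by exact_mod_cast Real.pi_ne_zero
    simp
    field_simp
  rw [h4]
  split_ifs with hlt
  · have hd : DiffContOnCl ℂ (fun a => (z - a)⁻¹) (ball 0 |ρ|) := by
      rw [abs_of_pos hρ]
      apply DifferentiableOn.diffContOnCl
      rw [closure_ball _ hρ.ne']
      intro a ha
      have : z - a ≠ 0 := by
        intro h0
        have : z = a := sub_eq_zero.1 h0
        rw [this] at hlt
        simp at ha; linarith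
      apply DifferentiableAt.differentiableWithinAt
      fun_prop (disch := assumption)
    rw [hd.circleAverage]
    simp [div_eq_mul_inv]
  · have hlt' : ‖z‖ < ρ := lt_of_le_of_ne (not_lt.1 hlt) (Ne.symm h)
    rw [Real.circleAverage_eq_circleIntegral hρ.ne']
    suffices hh : (∮ a in C(0, ρ), (a - 0)⁻¹ • (z - a)⁻¹) = 0 by
      rw [hh]; simp
    by_cases hz : z = 0
    · have := circleIntegral.integral_sub_zpow_of_ne (n := -2) (by norm_num) 0 0 ρ
      suffices e : (∮ a in C(0, ρ), (a - 0)⁻¹ • (z - a)⁻¹)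
          = ∮ a in C(0, ρ), (-1 : ℂ) • (a - 0) ^ (-2 : ℤ) by
        rw [e, circleIntegral.integral_smul, this, smul_zero]
      congr 1
      ext a
      rw [hz]; simp
      by_cases ha : a = 0
      · simp [ha]
      · have : a ^ (-2 : ℤ) = (a ^ 2)⁻¹ := by rw [zpow_neg]; norm_cast
        first
        | rw [this, pow_two, mul_inv]
        | rw [pow_two, mul_inv]
    · have e1 := circleIntegral.integral_sub_center_inv 0 hρ.ne'
      have e2 := circleIntegral.integral_sub_inv_of_mem_ball (c := 0) (w := z) (R := ρ)
        (by simpa using hlt')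
      have i1 : CircleIntegrable (fun a : ℂ => (a - 0)⁻¹) 0 ρ := by
        apply ContinuousOn.circleIntegrable hρ.le
        intro a ha
        have : a - 0 ≠ 0 := by
          intro h0; simp at h0; simp [h0] at ha; linarith
        apply ContinuousAt.continuousWithinAt; fun_prop (disch := assumption)
      have i2 : CircleIntegrable (fun a : ℂ => (a - z)⁻¹) 0 ρ := by
        apply ContinuousOn.circleIntegrable hρ.le
        intro a ha
        have : a - z ≠ 0 := by
          intro h0; simp at ha; rw [sub_eq_zero] at h0; rw [h0] at ha; linarith
        apply ContinuousAt.continuousWithinAt; fun_prop (disch := assumption)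
      have e3 := circleIntegral.integral_sub i1 i2
      rw [e1, e2, sub_self] at e3
      have e4 : (∮ a in C(0, ρ), (a - 0)⁻¹ • (z - a)⁻¹)
          = ∮ a in C(0, ρ), z⁻¹ • ((a - 0)⁻¹ - (a - z)⁻¹) := by
        apply circleIntegral.integral_congr hρ.le
        intro a ha
        have h5 : a ≠ 0 := by
          intro h0; simp [h0] at ha; linarith
        have h6 : a - z ≠ 0 := by
          intro h0; simp at ha; rw [sub_eq_zero] at h0; rw [h0] at ha; linarith
        have h7 : z - a ≠ 0 := by
          intro h0; apply h6; linear_combination - h0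
        simp only [smul_eq_mul, sub_zero]
        field_simp
        ring
      rw [e4, circleIntegral.integral_smul, e3, smul_zero]

lemma integrable_translate (z : ℂ) (r : ℝ) :
    IntegrableOn (fun a : ℂ => (z - a)⁻¹) (closedBall 0 r) := by
  have h1 : Integrable ((closedBall (0 : ℂ) (‖z‖ + r)).indicator fun b : ℂ => ‖b‖⁻¹) :=
    (integrable_indicator_iff measurableSet_closedBall).2 (integrableOn_inv_norm _)
  have h2 := h1.comp_sub_left z
  refine Integrable.mono' h2.integrableOn ?_ ?_
  · exact (by fun_prop : Measurable (fun a : ℂ => (z - a)⁻¹)).aestronglyMeasurable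
  · refine (ae_restrict_iff' measurableSet_closedBall).2 (Filter.Eventually.of_forall ?_)
    intro a ha
    have : z - a ∈ closedBall (0 : ℂ) (‖z‖ + r) := by
      simp at ha ⊢
      exact (norm_sub_le _ _).trans (by linarith)
    rw [Set.indicator_of_mem this, norm_inv]

lemma cauchy_disc (z : ℂ) (r : ℝ) (hz : ‖z‖ ≤ r) :
    ∫ a in closedBall (0 : ℂ) r, (z - a)⁻¹ = Real.pi * conj z := by
  rw [← integral_indicator measurableSet_closedBall]
  set f : ℂ → ℂ := (closedBall (0 : ℂ) r).indicator fun a => (z - a)⁻¹ with hf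
  have hfm : Measurable f := by
    apply Measurable.indicator _ measurableSet_closedBall
    fun_prop
  have hfi : Integrable f :=
    (integrable_indicator_iff measurableSet_closedBall).2 (integrable_translate z r)
  rw [← Complex.integral_comp_polarCoord_symm]
  have hpm : Measurable (fun p : ℝ × ℝ => Complex.polarCoord.symm p) := by
    simp only [Complex.polarCoord_symm_apply]
    fun_prop
  have hintg : IntegrableOn (fun p : ℝ × ℝ => p.1 • f (Complex.polarCoord.symm p))
      polarCoord.target := by
    refine ⟨(Measurable.aestronglyMeasurable (by fun_prop)), ?_⟩
    rw [HasFiniteIntegral]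
    have : ∫⁻ p in polarCoord.target, ‖p.1 • f (Complex.polarCoord.symm p)‖ₑ
       = ∫⁻ p in polarCoord.target, ENNReal.ofReal p.1 • ‖f (Complex.polarCoord.symm p)‖ₑ := by
      apply setLIntegral_congr_fun polarCoord.open_target.measurableSet
      intro p hp
      have : 0 < p.1 := hp.1
      simp only [enorm_smul, smul_eq_mul]
      rw [Real.enorm_of_nonneg this.le]
    rw [this, Complex.lintegral_comp_polarCoord_symm (fun p => ‖f p‖ₑ)]
    exact hfi.2
  have htgt : polarCoord.target = Set.Ioi (0 : ℝ) ×ˢ Set.Ioo (-Real.pi) Real.pi := rfl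
  rw [htgt] at hintg ⊢
  rw [Measure.volume_eq_prod] at hintg ⊢
  rw [setIntegral_prod _ hintg]
  have hin : ∀ᵐ ρ : ℝ, ρ ∈ Set.Ioi (0 : ℝ) →
      ∫ θ in Set.Ioo (-Real.pi) Real.pi, ρ • f (Complex.polarCoord.symm (ρ, θ))
        = (Set.Ioo 0 ‖z‖).indicator (fun ρ : ℝ => (ρ : ℂ) * (2 * Real.pi / z)) ρ := by
    have hne : ∀ᵐ ρ : ℝ, ρ ≠ ‖z‖ := by
      exact (Set.countable_singleton ‖z‖).ae_notMem _
    filter_upwards [hne] with ρ hρ hρ0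
    have hρ0 : 0 < ρ := hρ0
    rw [integral_smul]
    by_cases hρr : ρ ≤ r
    · have : ∀ θ : ℝ, f (Complex.polarCoord.symm (ρ, θ))
          = (z - Complex.polarCoord.symm (ρ, θ))⁻¹ := by
        intro θ
        apply Set.indicator_of_mem
        rw [mem_closedBall_zero_iff, norm_polarCoord_symm]
        simpa [abs_of_pos hρ0] using hρr
      simp only [this]
      rw [circle_inner z ρ hρ0 hρ]
      by_cases hlt : ρ < ‖z‖
      · rw [Set.indicator_of_mem (show ρ ∈ Set.Ioo 0 ‖z‖ from ⟨hρ0, hlt⟩)]; simp [hlt]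
      · rw [Set.indicator_of_notMem (fun h : ρ ∈ Set.Ioo 0 ‖z‖ => hlt h.2)]; simp [hlt]
    · have : ∀ θ : ℝ, f (Complex.polarCoord.symm (ρ, θ)) = 0 := by
        intro θ
        apply Set.indicator_of_notMem
        rw [mem_closedBall_zero_iff, norm_polarCoord_symm]
        simpa [abs_of_pos hρ0] using hρr
      simp only [this]
      rw [Set.indicator_of_notMem (fun h : ρ ∈ Set.Ioo 0 ‖z‖ => by linarith [h.2])]
      simp
  rw [setIntegral_congr_ae measurableSet_Ioi hin, setIntegral_indicator measurableSet_Ioo]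
  have hset : Set.Ioi (0 : ℝ) ∩ Set.Ioo 0 ‖z‖ = Set.Ioo 0 ‖z‖ := by
    ext; simp
  rw [hset, integral_mul_const, ← integral_Ioc_eq_integral_Ioo,
    ← intervalIntegral.integral_of_le (norm_nonneg z), intervalIntegral.integral_ofReal,
    integral_id]
  by_cases hz0 : z = 0
  · simp [hz0]
  · have := Complex.mul_conj' z
    field_simp
    push_cast
    rw [← this]
    ring

/-- the coordinate function on the disc -/
def zc (r : ℝ) : C(closedBall (0 : ℂ) r, ℂ) := ⟨fun z => (z : ℂ), by fun_prop⟩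

/-- the conjugate coordinate function on the disc -/
def zbar (r : ℝ) : C(closedBall (0 : ℂ) r, ℂ) := ⟨fun z => conj (z : ℂ), by fun_prop⟩

lemma integral_mem_closed {Y E : Type*} [TopologicalSpace Y] [CompactSpace Y] [MeasurableSpace Y]
    [BorelSpace Y] (μ : Measure Y) [IsFiniteMeasure μ] [NormedAddCommGroup E] [NormedSpace ℝ E]
    [CompleteSpace E] (S : Submodule ℝ E) (hS : IsClosed (S : Set E)) (f : C(Y, E))
    (hf : ∀ y, f y ∈ S) : ∫ y, f y ∂μ ∈ S := by
  have : CompleteSpace S := hS.completeSpace_coe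
  let g : C(Y, S) := ⟨fun y => ⟨f y, hf y⟩, by fun_prop⟩
  have hg : Integrable g μ := g.continuous.integrable_of_hasCompactSupport
    (HasCompactSupport.of_compactSpace _)
  have := S.subtypeL.integral_comp_comm hg
  have h2 : ∫ y, f y ∂μ = S.subtypeL (∫ y, g y ∂μ) := by rw [← this]; rfl
  rw [h2]
  exact (∫ y, g y ∂μ).2

/-- error kernel -/
def psi (m ε : ℝ) (b : ℂ) : ℝ := ‖b‖⁻¹ * (ε / (m * ‖b‖ ^ 2 + ε))

lemma psi_le {m ε : ℝ} (hm : 0 < m) (hε : 0 < ε) (b : ℂ) : psi m ε b ≤ ‖b‖⁻¹ := by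
  unfold psi
  apply mul_le_of_le_one_right (by positivity)
  rw [div_le_one (by positivity)]
  have : 0 ≤ m * ‖b‖ ^ 2 := by positivity
  linarith

lemma psi_nonneg {m ε : ℝ} (hm : 0 < m) (hε : 0 < ε) (b : ℂ) : 0 ≤ psi m ε b := by
  unfold psi; positivity

lemma psi_meas (m ε : ℝ) : Measurable (psi m ε) := by unfold psi; fun_prop

lemma psi_int {m ε : ℝ} (hm : 0 < m) (hε : 0 < ε) (R : ℝ) :
    IntegrableOn (psi m ε) (closedBall 0 R) := by
  refine Integrable.mono' (integrableOn_inv_norm R) (psi_meas m ε).aestronglyMeasurable ?_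
  refine Filter.Eventually.of_forall fun b => ?_
  rw [Real.norm_of_nonneg (psi_nonneg hm hε b)]
  exact psi_le hm hε b

lemma psi_lim {m : ℝ} (hm : 0 < m) (R : ℝ) :
    Filter.Tendsto (fun n : ℕ => ∫ b in closedBall (0 : ℂ) R, psi m (1 / ((n : ℝ) + 1)) b)
      Filter.atTop (nhds 0) := by
  have h := tendsto_integral_of_dominated_convergence
    (μ := (volume : Measure ℂ).restrict (closedBall 0 R))
    (F := fun (n : ℕ) b => psi m (1 / ((n : ℝ) + 1)) b) (f := fun _ => (0 : ℝ))
    (fun b => ‖b‖⁻¹) (fun n => (psi_meas m _).aestronglyMeasurable) (integrableOn_inv_norm R)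
    (fun n => Filter.Eventually.of_forall fun b => by
      have hn : (0 : ℝ) < 1 / ((n : ℝ) + 1) := by positivity
      rw [Real.norm_of_nonneg (psi_nonneg hm hn b)]
      exact psi_le hm hn b)
    (Filter.Eventually.of_forall fun b => by
      by_cases hb : b = 0
      · simp [hb, psi]
      · have h1 := tendsto_one_div_add_atTop_nhds_zero_nat (𝕜 := ℝ)
        have hpos : 0 < m * ‖b‖ ^ 2 := by
          have := norm_pos_iff.2 hb
          positivity
        have h2 : Filter.Tendsto (fun n : ℕ => psi m (1 / ((n : ℝ) + 1)) b) Filter.atTop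
            (nhds (‖b‖⁻¹ * (0 / (m * ‖b‖ ^ 2 + 0)))) :=
          (h1.div (h1.const_add _) (by linarith)).const_mul _
        simpa using h2)
  simpa using h

lemma wermer_kernel_bound {m ε : ℝ} (hm : 0 < m) (hε : 0 < ε) (d D : ℂ) (hD : d = 0 → D = 0)
    (h : m * ‖d‖ ^ 2 ≤ (d * D).re) : ‖d⁻¹ - D / (d * D + ε)‖ ≤ psi m ε d := by
  have hre : m * ‖d‖ ^ 2 + ε ≤ ‖d * D + ε‖ := by
    refine le_trans ?_ (Complex.re_le_norm _)
    simp at h ⊢; linarith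
  have hpos : 0 < m * ‖d‖ ^ 2 + ε := by positivity
  have hne : d * D + ε ≠ 0 := norm_pos_iff.1 (hpos.trans_le hre)
  by_cases hd : d = 0
  · simp [hd, hD hd, psi]
  · have : d⁻¹ - D / (d * D + ε) = d⁻¹ * (ε / (d * D + ε)) := by
      field_simp; ring
    rw [this, psi, norm_mul, norm_inv, norm_div, Complex.norm_real, Real.norm_of_nonneg hε.le]
    gcongr

lemma wermer_zbar (r : ℝ) (S : Subalgebra ℂ C(closedBall (0 : ℂ) r, ℂ))
    (hS : IsClosed (S : Set C(closedBall (0 : ℂ) r, ℂ))) (N : C(closedBall (0 : ℂ) r, ℂ))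
    (hz : zc r ∈ S) (hN : N ∈ S) (m : ℝ) (hm : 0 < m)
    (h : ∀ z a : closedBall (0 : ℂ) r,
      m * ‖(z : ℂ) - a‖ ^ 2 ≤ (((z : ℂ) - a) * (N z - N a)).re) :
    zbar r ∈ S := by
  let _ : MeasureSpace (closedBall (0 : ℂ) r) := Measure.Subtype.measureSpace
  -- the kernel
  have hre : ∀ ε : ℝ, 0 < ε → ∀ z a : closedBall (0 : ℂ) r,
      ((z : ℂ) - a) * (N z - N a) + ε ≠ 0 := by
    intro ε hε z a h0
    have h1 := congrArg Complex.re h0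
    rw [Complex.add_re, Complex.ofReal_re, Complex.zero_re] at h1
    have h2 := h z a
    have : 0 ≤ m * ‖(z : ℂ) - a‖ ^ 2 := by positivity
    linarith
  have key : ∀ ε : ℝ, 0 < ε → ∃ I ∈ S, ∀ z, ‖(Real.pi : ℂ) * zbar r z - I z‖ ≤
      ∫ b in closedBall (0 : ℂ) (2 * r), psi m ε b := by
    intro ε hε
    let K : C(closedBall (0 : ℂ) r × closedBall (0 : ℂ) r, ℂ) :=
      ⟨fun p => (N p.2 - N p.1) / (((p.2 : ℂ) - p.1) * (N p.2 - N p.1) + ε), by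
        apply Continuous.div (by fun_prop) (by fun_prop)
        intro p; exact hre ε hε p.2 p.1⟩
    have hKS : ∀ a, K.curry a ∈ S := by
      intro a
      have hNa : N - algebraMap ℂ _ (N a) ∈ S := S.sub_mem hN (S.algebraMap_mem _)
      have hq : (zc r - algebraMap ℂ _ (a : ℂ)) * (N - algebraMap ℂ _ (N a)) ∈ S :=
        S.mul_mem (S.sub_mem hz (S.algebraMap_mem _)) hNa
      obtain ⟨p, hp, hpx⟩ := aux_inv S hS _ hq (fun x s hs => by
        have := hre s hs x a
        simpa [zc, Algebra.algebraMap_eq_smul_one] using this) ε hε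
      have : K.curry a = (N - algebraMap ℂ _ (N a)) * p := by
        ext z
        have h1 := hpx z
        have h2 := hre ε hε z a
        simp [zc, Algebra.algebraMap_eq_smul_one] at h1
        simp [K, Algebra.algebraMap_eq_smul_one]
        rw [div_eq_iff h2]
        linear_combination -(N z - N a) * h1
      rw [this]
      exact S.mul_mem hNa hp
    have hfin : IsFiniteMeasure (volume : Measure (closedBall (0 : ℂ) r)) := by
      refine ⟨?_⟩
      rw [Measure.Subtype.volume_univ measurableSet_closedBall.nullMeasurableSet]
      exact measure_closedBall_lt_top
    have hKint : Integrable (fun a => K.curry a) (volume : Measure (closedBall (0 : ℂ) r)) :=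
      K.curry.continuous.integrable_of_hasCompactSupport (HasCompactSupport.of_compactSpace _)
    refine ⟨∫ a, K.curry a, ?_, fun z => ?_⟩
    · exact integral_mem_closed (volume : Measure (closedBall (0 : ℂ) r))
        ((Subalgebra.toSubmodule S).restrictScalars ℝ) hS K.curry hKS
    · have e1 : (∫ a, K.curry a) z = ∫ a, K (a, z) := by
        have := ContinuousMap.integral_apply hKint z
        simpa using this
      have e2 : (Real.pi : ℂ) * zbar r z = ∫ a : closedBall (0 : ℂ) r, ((z : ℂ) - a)⁻¹ := by
        rw [show zbar r z = conj (z : ℂ) from rfl, ← cauchy_disc z r (mem_closedBall_zero_iff.1 z.2)]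
        rw [← integral_subtype measurableSet_closedBall (fun a : ℂ => ((z : ℂ) - a)⁻¹)]
      have i1 : Integrable (fun a : closedBall (0 : ℂ) r => ((z : ℂ) - a)⁻¹) := by
        have := integrable_translate z r
        rw [integrableOn_iff_comap_subtypeVal measurableSet_closedBall] at this
        exact this
      have i2 : Integrable (fun a : closedBall (0 : ℂ) r => K (a, z)) :=
        (by fun_prop : Continuous (fun a : closedBall (0 : ℂ) r => K (a, z))
          ).integrable_of_hasCompactSupport (HasCompactSupport.of_compactSpace _)
      rw [e1, e2, ← integral_sub i1 i2]
      have hsub : ∀ a : closedBall (0 : ℂ) r, (z : ℂ) - a ∈ closedBall (0 : ℂ) (2 * r) := by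
        intro a
        have h1 := z.2
        have h2 := a.2
        simp only [mem_closedBall_zero_iff] at h1 h2 ⊢
        exact (norm_sub_le _ _).trans (by linarith)
      have j1 : Integrable ((closedBall (0 : ℂ) (2 * r)).indicator (psi m ε)) :=
        (integrable_indicator_iff measurableSet_closedBall).2 (psi_int hm hε _)
      have j2 := j1.comp_sub_left (z : ℂ)
      have j3 : Integrable (fun a : closedBall (0 : ℂ) r =>
          (closedBall (0 : ℂ) (2 * r)).indicator (psi m ε) ((z : ℂ) - a)) := by
        have := j2.integrableOn (s := closedBall (0 : ℂ) r)
        rw [integrableOn_iff_comap_subtypeVal measurableSet_closedBall] at this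
        exact this
      calc ‖∫ a : closedBall (0 : ℂ) r, (((z : ℂ) - a)⁻¹ - K (a, z))‖
          ≤ ∫ a : closedBall (0 : ℂ) r,
            (closedBall (0 : ℂ) (2 * r)).indicator (psi m ε) ((z : ℂ) - a) := by
            apply norm_integral_le_of_norm_le j3
            refine Filter.Eventually.of_forall fun a => ?_
            rw [Set.indicator_of_mem (hsub a)]
            apply wermer_kernel_bound hm hε _ _ _ (h z a)
            intro h0
            have : z = a := Subtype.ext (sub_eq_zero.1 h0)
            simp [this]
        _ = ∫ a in closedBall (0 : ℂ) r,
            (closedBall (0 : ℂ) (2 * r)).indicator (psi m ε) ((z : ℂ) - a) :=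
            integral_subtype measurableSet_closedBall
              (fun a : ℂ => (closedBall (0 : ℂ) (2 * r)).indicator (psi m ε) ((z : ℂ) - a))
        _ ≤ ∫ a, (closedBall (0 : ℂ) (2 * r)).indicator (psi m ε) ((z : ℂ) - a) := by
            apply setIntegral_le_integral j2
            refine Filter.Eventually.of_forall fun a => ?_
            exact Set.indicator_nonneg (fun b _ => psi_nonneg hm hε b) _
        _ = ∫ b in closedBall (0 : ℂ) (2 * r), psi m ε b := by
            rw [integral_sub_left_eq_self
              ((closedBall (0 : ℂ) (2 * r)).indicator (psi m ε)) volume (z : ℂ),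
              integral_indicator measurableSet_closedBall]
  have hpi : (Real.pi : ℂ) ≠ 0 := by exact_mod_cast Real.pi_ne_zero
  suffices hh : algebraMap ℂ _ (Real.pi : ℂ) * zbar r ∈ S by
    have := S.mul_mem (S.algebraMap_mem (Real.pi : ℂ)⁻¹) hh
    rwa [← mul_assoc, ← map_mul, inv_mul_cancel₀ hpi, map_one, one_mul] at this
  apply mem_of_approx S hS
  intro δ hδ
  obtain ⟨n, hn⟩ := ((psi_lim hm (2 * r)).eventually_lt_const hδ).exists
  obtain ⟨I, hI, hIx⟩ := key (1 / ((n : ℝ) + 1)) (by positivity)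
  refine ⟨I, hI, fun x => ?_⟩
  have := (hIx x).trans hn.le
  simpa [Algebra.algebraMap_eq_smul_one] using this

lemma stone_disc (r : ℝ) (S : Subalgebra ℂ C(closedBall (0 : ℂ) r, ℂ))
    (hS : IsClosed (S : Set C(closedBall (0 : ℂ) r, ℂ)))
    (hz : zc r ∈ S) (hzb : zbar r ∈ S) : S = ⊤ := by
  have h := ContinuousMap.elemental_id_eq_top (𝕜 := ℂ) (closedBall (0 : ℂ) r)
  have h0 : (ContinuousMap.restrict (closedBall (0 : ℂ) r) (.id ℂ)) = zc r := rfl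
  rw [h0] at h
  have h1 : (StarAlgebra.adjoin ℂ ({zc r} : Set C(closedBall (0 : ℂ) r, ℂ))).toSubalgebra ≤ S := by
    rw [StarAlgebra.adjoin_toSubalgebra]
    apply Algebra.adjoin_le
    rintro f (hf | hf)
    · rw [Set.mem_singleton_iff.1 hf]; exact hz
    · have : star f = zc r := by simpa using hf
      have h2 : f = zbar r := by
        rw [← star_star f, this]; rfl
      rw [h2]; exact hzb
  rw [eq_top_iff]
  intro f _
  have hf : f ∈ StarAlgebra.elemental ℂ (zc r) := by rw [h]; trivial
  have hf2 : f ∈ closure ((StarAlgebra.adjoin ℂ ({zc r} : Set C(closedBall (0 : ℂ) r, ℂ))) : Set _) := hf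
  exact closure_minimal (s := _) (fun x hx => h1 hx) hS hf2

lemma main_alg (r : ℝ) (S : Subalgebra ℂ C(closedBall (0 : ℂ) r, ℂ))
    (hS : IsClosed (S : Set C(closedBall (0 : ℂ) r, ℂ))) (N : C(closedBall (0 : ℂ) r, ℂ))
    (hz : zc r ∈ S) (hN : N * N ∈ S) (m : ℝ) (hm : 0 < m)
    (h : ∀ z a : closedBall (0 : ℂ) r,
      m * ‖(z : ℂ) - a‖ ^ 2 ≤ (((z : ℂ) - a) * (N z - N a)).re)
    (h0 : ∀ z : closedBall (0 : ℂ) r, m * ‖(z : ℂ)‖ ^ 2 ≤ ((z : ℂ) * N z).re) : S = ⊤ := by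
  have hQ : zc r * N ∈ S := by
    apply aux_sqrt_mem S hS
    · have := S.mul_mem (S.mul_mem hz hz) hN
      rwa [show zc r * N * (zc r * N) = zc r * zc r * (N * N) by ring]
    · intro x
      exact le_trans (by positivity) (h0 x)
    · intro x hx
      have h1 := h0 x
      have h2 : ((x : ℂ) * N x).re = 0 := hx
      rw [h2] at h1
      have h3 : ‖(x : ℂ)‖ ^ 2 ≤ 0 := by nlinarith [sq_nonneg ‖(x : ℂ)‖]
      have h4 : (x : ℂ) = 0 := by
        have : ‖(x : ℂ)‖ = 0 := by nlinarith [norm_nonneg (x : ℂ)]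
        simpa using this
      show (x : ℂ) * N x = 0
      rw [h4, zero_mul]
  -- the big algebra
  let S' : Subalgebra ℂ C(closedBall (0 : ℂ) r, ℂ) :=
    (Algebra.adjoin ℂ {zc r, N}).topologicalClosure
  have hS' : S' = ⊤ := by
    have hc : IsClosed (S' : Set C(closedBall (0 : ℂ) r, ℂ)) :=
      Subalgebra.isClosed_topologicalClosure _
    have h1 : zc r ∈ S' := Subalgebra.le_topologicalClosure _ (Algebra.subset_adjoin (by simp))
    have h2 : N ∈ S' := Subalgebra.le_topologicalClosure _ (Algebra.subset_adjoin (by simp))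
    exact stone_disc r S' hc h1 (wermer_zbar r S' hc N h1 h2 m hm h)
  have hadj : ∀ φ ∈ Algebra.adjoin ℂ {zc r, N}, zc r * φ ∈ S ∧ zc r * N * φ ∈ S := by
    intro φ hφ
    let U : Set C(closedBall (0 : ℂ) r, ℂ) := {φ | zc r * φ ∈ S ∧ zc r * N * φ ∈ S}
    have hmul : ∀ a ∈ Algebra.adjoin ℂ {zc r, N}, ∀ φ ∈ U, a * φ ∈ U := by
      intro a ha
      induction ha using Algebra.adjoin_induction with
      | mem x hx =>
        intro φ hφ
        rcases hx with rfl | rfl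
        · refine ⟨S.mul_mem hz hφ.1, ?_⟩
          have := S.mul_mem hz hφ.2
          rwa [show zc r * N * (zc r * φ) = zc r * (zc r * N * φ) by ring]
        · refine ⟨by rw [← mul_assoc]; exact hφ.2, ?_⟩
          have := S.mul_mem hN hφ.1
          rwa [show zc r * x * (x * φ) = x * x * (zc r * φ) by ring]
      | algebraMap c =>
        intro φ hφ
        have e1 := S.mul_mem (S.algebraMap_mem c) hφ.1
        have e2 := S.mul_mem (S.algebraMap_mem c) hφ.2
        refine ⟨?_, ?_⟩
        · rwa [show zc r * (algebraMap ℂ _ c * φ) = algebraMap ℂ _ c * (zc r * φ) by ring]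
        · rwa [show zc r * N * (algebraMap ℂ _ c * φ) = algebraMap ℂ _ c * (zc r * N * φ) by ring]
      | add x y _ _ hx hy =>
        intro φ hφ
        have e1 := S.add_mem (hx φ hφ).1 (hy φ hφ).1
        have e2 := S.add_mem (hx φ hφ).2 (hy φ hφ).2
        refine ⟨?_, ?_⟩
        · rwa [show zc r * ((x + y) * φ) = zc r * (x * φ) + zc r * (y * φ) by ring]
        · rwa [show zc r * N * ((x + y) * φ) = zc r * N * (x * φ) + zc r * N * (y * φ) by ring]
      | mul x y _ _ hx hy =>
        intro φ hφ
        rw [mul_assoc]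
        exact hx _ (hy φ hφ)
    have h1U : (1 : C(closedBall (0 : ℂ) r, ℂ)) ∈ U := by
      refine ⟨?_, ?_⟩
      · rwa [mul_one]
      · rwa [mul_one]
    have := hmul φ hφ 1 h1U
    rwa [mul_one] at this
  have hzφ : ∀ φ : C(closedBall (0 : ℂ) r, ℂ), zc r * φ ∈ S := by
    intro φ
    have hφ : φ ∈ closure ((Algebra.adjoin ℂ {zc r, N} : Subalgebra ℂ _) : Set _) := by
      have : φ ∈ S' := by rw [hS']; trivial
      exact this
    have hcl : IsClosed {φ : C(closedBall (0 : ℂ) r, ℂ) | zc r * φ ∈ S} :=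
      hS.preimage (by fun_prop : Continuous fun φ : C(closedBall (0 : ℂ) r, ℂ) => zc r * φ)
    exact closure_minimal (fun φ hφ => (hadj φ hφ).1) hcl hφ
  apply stone_disc r S hS hz
  apply mem_of_approx S hS
  intro δ hδ
  have hden : ∀ x : closedBall (0 : ℂ) r, ((‖(x : ℂ)‖ ^ 2 + δ ^ 2 : ℝ) : ℂ) ≠ 0 := by
    intro x
    have : 0 < ‖(x : ℂ)‖ ^ 2 + δ ^ 2 := by positivity
    exact_mod_cast this.ne'
  let φ : C(closedBall (0 : ℂ) r, ℂ) :=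
    ⟨fun x => conj (x : ℂ) ^ 2 / ((‖(x : ℂ)‖ ^ 2 + δ ^ 2 : ℝ) : ℂ), by
      apply Continuous.div (by fun_prop) (by fun_prop) hden⟩
  refine ⟨_, hzφ φ, fun x => ?_⟩
  have e : zbar r x - (zc r * φ) x = conj (x : ℂ) * (δ ^ 2 / (‖(x : ℂ)‖ ^ 2 + δ ^ 2) : ℝ) := by
    have h1 := hden x
    have h2 := Complex.mul_conj' (x : ℂ)
    show conj (x : ℂ) - (x : ℂ) * (conj (x : ℂ) ^ 2 / ((‖(x : ℂ)‖ ^ 2 + δ ^ 2 : ℝ) : ℂ)) = _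
    push_cast at h1 ⊢
    field_simp
    rw [← h2]; ring
  rw [e, norm_mul, RCLike.norm_conj, Complex.norm_real, Real.norm_of_nonneg (by positivity)]
  rw [mul_div_assoc', div_le_iff₀ (by positivity)]
  nlinarith [sq_nonneg (‖(x : ℂ)‖ - δ), norm_nonneg (x : ℂ)]

lemma clm_bound (T : ℂ →L[ℝ] ℂ) (B : ℝ) (h1 : ‖T 1‖ ≤ B) (hI : ‖T Complex.I‖ ≤ B) :
    ‖T‖ ≤ 2 * B := by
  have hB : 0 ≤ B := (norm_nonneg _).trans h1
  apply T.opNorm_le_bound (by positivity)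
  intro v
  have e : v = v.re • (1 : ℂ) + v.im • Complex.I := by simp
  have : T v = v.re • T 1 + v.im • T Complex.I := by
    conv_lhs => rw [e]
    rw [map_add, map_smul, map_smul]
  rw [this]
  refine (norm_add_le _ _).trans ?_
  rw [norm_smul, norm_smul, Real.norm_eq_abs, Real.norm_eq_abs]
  have h3 := Complex.abs_re_le_norm v
  have h4 := Complex.abs_im_le_norm v
  have h5 : |v.re| * ‖T 1‖ ≤ ‖v‖ * B := by gcongr
  have h6 : |v.im| * ‖T Complex.I‖ ≤ ‖v‖ * B := by gcongr
  linarith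

lemma F_lip {R r B : ℝ} (hr0 : 0 < r) (hrR : r ≤ R) {F : ℂ → ℂ}
    (hF : ContDiffOn ℝ (⊤ : ℕ∞) F (closedBall (0 : ℂ) R))
    (hF3 : ∀ k : ℕ, k ≤ 2 → iteratedFDeriv ℝ k F 0 = 0)
    (hC2 : IsC2Bound F (closedBall (0 : ℂ) r) B) :
    ∀ z ∈ closedBall (0 : ℂ) r, ∀ z' ∈ closedBall (0 : ℂ) r,
      ‖F z - F z'‖ ≤ 4 * B * max ‖z‖ ‖z'‖ * ‖z - z'‖ := by
  have h0r : (0 : ℂ) ∈ ball (0 : ℂ) r := mem_ball_self hr0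
  have hB : 0 ≤ B := (norm_nonneg _).trans (hC2 0 (ball_subset_closedBall h0r)).1
  have hsm : ∀ z ∈ ball (0 : ℂ) r, ContDiffAt ℝ (⊤ : ℕ∞) F z := by
    intro z hz
    apply hF.contDiffAt
    exact Filter.mem_of_superset (isOpen_ball.mem_nhds hz)
      (ball_subset_closedBall.trans (closedBall_subset_closedBall hrR))
  have hfd0 : fderiv ℝ F 0 = 0 := by
    have h := hF3 1 (by norm_num)
    rw [← norm_eq_zero, ← norm_iteratedFDeriv_one, h, norm_zero]
  have hpd : ∀ u : ℂ, (∀ z ∈ closedBall (0 : ℂ) r, ‖pd 1 (pd u F) z‖ ≤ B ∧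
      ‖pd Complex.I (pd u F) z‖ ≤ B) → ∀ z ∈ ball (0 : ℂ) r, ‖pd u F z‖ ≤ 2 * B * ‖z‖ := by
    intro u hu z hz
    have hd : ∀ x ∈ ball (0 : ℂ) r, DifferentiableAt ℝ (pd u F) x := by
      intro x hx
      have h1 : ContDiffAt ℝ 1 (fderiv ℝ F) x :=
        (hsm x hx).fderiv_right (m := 1) (by norm_cast)
      have h2 : DifferentiableAt ℝ (fderiv ℝ F) x := h1.differentiableAt (by norm_num)
      exact h2.clm_apply (differentiableAt_const u)
    have hb : ∀ x ∈ ball (0 : ℂ) r, ‖fderiv ℝ (pd u F) x‖ ≤ 2 * B := by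
      intro x hx
      have := hu x (ball_subset_closedBall hx)
      exact clm_bound _ B this.1 this.2
    have h3 := (convex_ball (0 : ℂ) r).norm_image_sub_le_of_norm_fderiv_le (𝕜 := ℝ) hd hb h0r hz
    have h4 : pd u F 0 = 0 := by simp [pd, hfd0]
    rwa [h4, sub_zero, sub_zero] at h3
  have hfd : ∀ z ∈ ball (0 : ℂ) r, ‖fderiv ℝ F z‖ ≤ 4 * B * ‖z‖ := by
    intro z hz
    have h1 := hpd 1 (fun x hx => ⟨(hC2 x hx).2.2.2.1, (hC2 x hx).2.2.2.2.1⟩) z hz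
    have h2 := hpd Complex.I
      (fun x hx => ⟨(hC2 x hx).2.2.2.2.2.1, (hC2 x hx).2.2.2.2.2.2⟩) z hz
    have := clm_bound (fderiv ℝ F z) _ h1 h2
    linarith
  have hopen : ∀ p ∈ ball (0 : ℂ) r ×ˢ ball (0 : ℂ) r,
      ‖F p.1 - F p.2‖ ≤ 4 * B * max ‖p.1‖ ‖p.2‖ * ‖p.1 - p.2‖ := by
    rintro ⟨z, z'⟩ ⟨hz, hz'⟩
    simp only [mem_ball_zero_iff] at hz hz' ⊢
    have hsub : ∀ x ∈ closedBall (0 : ℂ) (max ‖z‖ ‖z'‖), x ∈ ball (0 : ℂ) r := by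
      intro x hx
      simp only [mem_closedBall_zero_iff, mem_ball_zero_iff] at hx ⊢
      exact hx.trans_lt (max_lt hz hz')
    refine (convex_closedBall (0 : ℂ) (max ‖z‖ ‖z'‖)).norm_image_sub_le_of_norm_fderiv_le (𝕜 := ℝ)
      (f := F) (fun x hx => (hsm x (hsub x hx)).differentiableAt (by simp)) (fun x hx => ?_)
      (by simp) (by simp)
    refine (hfd x (hsub x hx)).trans ?_
    have := mem_closedBall_zero_iff.1 hx
    gcongr
  intro z hz z' hz'
  have hcl : (z, z') ∈ closure (ball (0 : ℂ) r ×ˢ ball (0 : ℂ) r) := by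
    rw [closure_prod_eq, closure_ball _ hr0.ne']
    exact ⟨hz, hz'⟩
  have hcont : ContinuousOn F (closedBall (0 : ℂ) r) :=
    hF.continuousOn.mono (closedBall_subset_closedBall hrR)
  have hc1 : ContinuousOn (fun p : ℂ × ℂ => F p.1 - F p.2)
      (closedBall (0 : ℂ) r ×ˢ closedBall (0 : ℂ) r) :=
    (hcont.comp continuousOn_fst (fun p hp => hp.1)).sub
      (hcont.comp continuousOn_snd (fun p hp => hp.2))
  have hc2 : ContinuousWithinAt (fun p : ℂ × ℂ => ‖F p.1 - F p.2‖)
      (ball (0 : ℂ) r ×ˢ ball (0 : ℂ) r) (z, z') :=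
    (hc1.norm (z, z') ⟨hz, hz'⟩).mono
      (Set.prod_mono ball_subset_closedBall ball_subset_closedBall)
  exact ContinuousWithinAt.closure_le hcl hc2
    (by fun_prop : Continuous fun p : ℂ × ℂ =>
      4 * B * max ‖p.1‖ ‖p.2‖ * ‖p.1 - p.2‖).continuousWithinAt hopen

lemma ell_lower {γ : ℝ} (hγ : 1 / 2 < γ) (z : ℂ) :
    (2 * γ - 1) * ‖z‖ ≤ ‖z + 2 * (γ : ℂ) * conj z‖ := by
  have h1 : ‖2 * (γ : ℂ) * conj z‖ = 2 * γ * ‖z‖ := by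
    rw [norm_mul, norm_mul, RCLike.norm_conj, Complex.norm_real, Real.norm_of_nonneg (by linarith)]
    simp
  have h2 := norm_sub_norm_le (2 * (γ : ℂ) * conj z) (-z)
  rw [h1, norm_neg, sub_neg_eq_add, add_comm _ z] at h2
  linarith

lemma ell_upper {γ : ℝ} (hγ : 1 / 2 < γ) (z : ℂ) :
    ‖z + 2 * (γ : ℂ) * conj z‖ ≤ 4 * γ * ‖z‖ := by
  have h1 : ‖2 * (γ : ℂ) * conj z‖ = 2 * γ * ‖z‖ := by
    rw [norm_mul, norm_mul, RCLike.norm_conj, Complex.norm_real, Real.norm_of_nonneg (by linarith)]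
    simp
  have h2 := norm_add_le z (2 * (γ : ℂ) * conj z)
  rw [h1] at h2
  nlinarith [norm_nonneg z]

lemma e_exists {γ L δ : ℝ} (hγ : 1 / 2 < γ) (hδ : δ * (2 * γ - 1) = 4 * γ * L)
    (hδ2 : δ ≤ (2 * γ - 1) / 256) (z f : ℂ) (hf : ‖f‖ ≤ L * ‖z‖ ^ 2) :
    ∃ e : ℂ, e * (2 * (z + 2 * (γ : ℂ) * conj z) + e) = 4 * (γ : ℂ) * f ∧ ‖e‖ ≤ δ * ‖z‖ := by
  by_cases hz : z = 0
  · refine ⟨0, ?_, by simp [hz]⟩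
    have : f = 0 := by simpa [hz] using hf
    simp [this]
  have hd : 0 < 2 * γ - 1 := by linarith
  have hzp : 0 < ‖z‖ := norm_pos_iff.2 hz
  have hl := ell_lower hγ z
  set l : ℂ := z + 2 * (γ : ℂ) * conj z with hldef
  have hlp : 0 < ‖l‖ := lt_of_lt_of_le (by positivity) hl
  have hl0 : l ≠ 0 := norm_pos_iff.1 hlp
  set s : ℂ := 4 * (γ : ℂ) * f / l ^ 2 with hs
  have hn4 : ‖4 * (γ : ℂ) * f‖ ≤ δ * (2 * γ - 1) * ‖z‖ ^ 2 := by
    rw [norm_mul, norm_mul, Complex.norm_real, Real.norm_of_nonneg (by linarith), hδ]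
    simp only [RCLike.norm_ofNat]
    have := mul_le_mul_of_nonneg_left hf (by linarith : (0 : ℝ) ≤ 4 * γ)
    linarith
  have hδ0 : 0 ≤ δ := by
    have h1 := (norm_nonneg _).trans hn4
    by_contra hneg
    push Not at hneg
    have h2 : δ * (2 * γ - 1) * ‖z‖ ^ 2 < 0 := by
      have : δ * (2 * γ - 1) < 0 := mul_neg_of_neg_of_pos hneg hd
      exact mul_neg_of_neg_of_pos this (by positivity)
    linarith
  have hsl : ‖s‖ * ‖l‖ ≤ δ * ‖z‖ := by
    have e1 : ‖s‖ * ‖l‖ * ‖l‖ = ‖4 * (γ : ℂ) * f‖ := by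
      rw [← norm_mul, ← norm_mul, hs]
      congr 1
      field_simp
    have e2 : ‖s‖ * ‖l‖ * ‖l‖ ≤ δ * ‖z‖ * ‖l‖ := by
      rw [e1]
      refine hn4.trans ?_
      have := mul_le_mul_of_nonneg_left hl (by positivity : 0 ≤ δ * ‖z‖)
      nlinarith
    exact le_of_mul_le_mul_right e2 hlp
  have hs1 : ‖s‖ < 1 := by
    have h1 : δ * ‖z‖ < ‖l‖ := by
      refine lt_of_lt_of_le ?_ hl
      apply mul_lt_mul_of_pos_right _ hzp
      linarith
    have : ‖s‖ * ‖l‖ < 1 * ‖l‖ := by linarith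
    exact lt_of_mul_lt_mul_right this hlp.le
  have hslit : 1 + s ∈ slitPlane := by
    left
    have := Complex.abs_re_le_norm s
    have := abs_le.1 this
    simp; linarith
  obtain ⟨hq0, hq⟩ := csqrt_spec hslit
  set q : ℂ := (1 + s) ^ (1 / 2 : ℂ) with hqdef
  have hqn : ‖q - 1‖ ≤ ‖s‖ := by
    have e1 : (q - 1) * (q + 1) = s := by linear_combination hq
    have e2 : 1 ≤ ‖q + 1‖ := by
      refine le_trans ?_ (Complex.re_le_norm _)
      simp; linarith
    rw [← e1, norm_mul]
    exact le_mul_of_one_le_right (norm_nonneg _) e2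
  refine ⟨l * (q - 1), ?_, ?_⟩
  · have : s * l ^ 2 = 4 * (γ : ℂ) * f := by rw [hs]; field_simp
    rw [← this]
    linear_combination l ^ 2 * hq
  · rw [norm_mul]
    refine le_trans ?_ hsl
    rw [mul_comm]
    gcongr

lemma e_lip_aux {γ L δ : ℝ} (hγ : 1 / 2 < γ) (hδ0 : 0 ≤ δ) (hδ : δ * (2 * γ - 1) = 4 * γ * L)
    (hδ2 : δ ≤ (2 * γ - 1) / 256) (hδ3 : δ * γ ≤ (2 * γ - 1) ^ 2 / 512)
    (z z' f f' e e' : ℂ) (hff : ‖f - f'‖ ≤ L * ‖z‖ * ‖z - z'‖) (hzz : ‖z'‖ ≤ ‖z‖)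
    (h1 : e * (2 * (z + 2 * (γ : ℂ) * conj z) + e) = 4 * (γ : ℂ) * f)
    (h1' : e' * (2 * (z' + 2 * (γ : ℂ) * conj z') + e') = 4 * (γ : ℂ) * f')
    (h2 : ‖e‖ ≤ δ * ‖z‖) (h2' : ‖e'‖ ≤ δ * ‖z'‖) :
    ‖e - e'‖ ≤ (2 * γ - 1) / 2 * ‖z - z'‖ := by
  have hd : 0 < 2 * γ - 1 := by linarith
  by_cases hz : z = 0
  · have hz' : z' = 0 := by simpa [hz] using hzz
    have h3 : e = 0 := by simpa [hz] using h2
    have h4 : e' = 0 := by simpa [hz'] using h2'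
    simp [h3, h4, hz, hz']
  have hzp : 0 < ‖z‖ := norm_pos_iff.2 hz
  have hl := ell_lower hγ z
  have hu := ell_upper hγ (z - z')
  set l : ℂ := z + 2 * (γ : ℂ) * conj z with hldef
  set l' : ℂ := z' + 2 * (γ : ℂ) * conj z' with hldef'
  have hul : z - z' + 2 * (γ : ℂ) * conj (z - z') = l - l' := by
    rw [hldef, hldef', map_sub]; ring
  rw [hul] at hu
  have key : (e - e') * (2 * l + (e + e')) = 4 * (γ : ℂ) * (f - f') - 2 * e' * (l - l') := by
    linear_combination h1 - h1'
  have hn4 : ‖4 * (γ : ℂ) * (f - f')‖ ≤ δ * (2 * γ - 1) * ‖z‖ * ‖z - z'‖ := by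
    rw [norm_mul, norm_mul, Complex.norm_real, Real.norm_of_nonneg (by linarith), hδ]
    simp only [RCLike.norm_ofNat]
    have := mul_le_mul_of_nonneg_left hff (by linarith : (0 : ℝ) ≤ 4 * γ)
    linarith
  have hn5 : ‖2 * e' * (l - l')‖ ≤ 2 * (δ * ‖z‖) * (4 * γ * ‖z - z'‖) := by
    rw [norm_mul, norm_mul]
    simp only [RCLike.norm_ofNat]
    have : ‖e'‖ ≤ δ * ‖z‖ := h2'.trans (by gcongr)
    gcongr
  have hden : (2 * γ - 1) * ‖z‖ ≤ ‖2 * l + (e + e')‖ := by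
    have a1 := norm_sub_norm_le (2 * l) (-(e + e'))
    rw [norm_neg, sub_neg_eq_add, norm_mul] at a1
    simp only [RCLike.norm_ofNat] at a1
    have a2 := norm_add_le e e'
    have a3 : ‖e'‖ ≤ δ * ‖z‖ := h2'.trans (by gcongr)
    have a4 : δ * ‖z‖ ≤ (2 * γ - 1) / 256 * ‖z‖ := by gcongr
    nlinarith
  have hprod : ‖e - e'‖ * ((2 * γ - 1) * ‖z‖) ≤
      δ * (2 * γ - 1) * ‖z‖ * ‖z - z'‖ + 2 * (δ * ‖z‖) * (4 * γ * ‖z - z'‖) := by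
    calc ‖e - e'‖ * ((2 * γ - 1) * ‖z‖) ≤ ‖e - e'‖ * ‖2 * l + (e + e')‖ := by gcongr
      _ = ‖4 * (γ : ℂ) * (f - f') - 2 * e' * (l - l')‖ := by rw [← norm_mul, key]
      _ ≤ _ := (norm_sub_le _ _).trans (add_le_add hn4 hn5)
  have hfin : δ * (2 * γ - 1) * ‖z‖ * ‖z - z'‖ + 2 * (δ * ‖z‖) * (4 * γ * ‖z - z'‖) ≤
      ((2 * γ - 1) / 2 * ‖z - z'‖) * ((2 * γ - 1) * ‖z‖) := by
    have b0 : δ * (2 * γ - 1) + 8 * (δ * γ) ≤ (2 * γ - 1) / 2 * (2 * γ - 1) := by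
      have b2 := mul_le_mul_of_nonneg_right hδ2 hd.le
      nlinarith
    have b1 := mul_le_mul_of_nonneg_right b0 (by positivity : 0 ≤ ‖z‖ * ‖z - z'‖)
    nlinarith
  exact le_of_mul_le_mul_right (hprod.trans hfin) (by positivity)

lemma N_exists {γ r : ℝ} (hγ : 1 / 2 < γ) {F : ℂ → ℂ} (hF0 : F 0 = 0) (hr : 0 < r)
    (hL : ∀ z ∈ closedBall (0 : ℂ) r, ∀ z' ∈ closedBall (0 : ℂ) r,
      ‖F z - F z'‖ ≤ 4 * ((2 * γ - 1) ^ 3 / (2 ^ 14 * γ ^ 3)) * max ‖z‖ ‖z'‖ * ‖z - z'‖) :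
    ∃ N : C(closedBall (0 : ℂ) r, ℂ),
      (∀ z : closedBall (0 : ℂ) r, N z * N z =
        ((z : ℂ) + 2 * (γ : ℂ) * conj (z : ℂ)) ^ 2 + 4 * (γ : ℂ) * F z) ∧
      (∀ z a : closedBall (0 : ℂ) r,
        (2 * γ - 1) / 2 * ‖(z : ℂ) - a‖ ^ 2 ≤ (((z : ℂ) - a) * (N z - N a)).re) ∧
      (∀ z : closedBall (0 : ℂ) r, (2 * γ - 1) / 2 * ‖(z : ℂ)‖ ^ 2 ≤ ((z : ℂ) * N z).re) := by
  have hd : 0 < 2 * γ - 1 := by linarith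
  have hγ0 : 0 < γ := by linarith
  set L : ℝ := 4 * ((2 * γ - 1) ^ 3 / (2 ^ 14 * γ ^ 3)) with hLdef
  set δ : ℝ := (2 * γ - 1) ^ 2 / (1024 * γ ^ 2) with hδdef
  have hδ0 : 0 ≤ δ := by positivity
  have hδ : δ * (2 * γ - 1) = 4 * γ * L := by
    rw [hδdef, hLdef]; field_simp; norm_num
  have hδ2 : δ ≤ (2 * γ - 1) / 256 := by
    rw [hδdef, div_le_div_iff₀ (by positivity) (by norm_num)]
    nlinarith [mul_pos hd hγ0]
  have hδ3 : δ * γ ≤ (2 * γ - 1) ^ 2 / 512 := by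
    have : δ * γ = (2 * γ - 1) ^ 2 / (1024 * γ) := by rw [hδdef]; field_simp
    rw [this]
    apply div_le_div_of_nonneg_left (by positivity) (by norm_num)
    linarith
  have h00 : (0 : ℂ) ∈ closedBall (0 : ℂ) r := mem_closedBall_self hr.le
  have hFz : ∀ z : closedBall (0 : ℂ) r, ‖F z‖ ≤ L * ‖(z : ℂ)‖ ^ 2 := by
    intro z
    have := hL z z.2 0 h00
    rw [hF0, sub_zero, sub_zero, norm_zero, max_eq_left (norm_nonneg _)] at this
    linarith
  choose e he he2 using fun z : closedBall (0 : ℂ) r =>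
    e_exists hγ hδ hδ2 (z : ℂ) (F z) (hFz z)
  have hlip : ∀ z a : closedBall (0 : ℂ) r, ‖e z - e a‖ ≤ (2 * γ - 1) / 2 * ‖(z : ℂ) - a‖ := by
    have hhalf : ∀ z a : closedBall (0 : ℂ) r, ‖(a : ℂ)‖ ≤ ‖(z : ℂ)‖ →
        ‖e z - e a‖ ≤ (2 * γ - 1) / 2 * ‖(z : ℂ) - a‖ := by
      intro z a hza
      have h1 := hL z z.2 a a.2
      rw [max_eq_left hza] at h1
      exact e_lip_aux hγ hδ0 hδ hδ2 hδ3 z a (F z) (F a) (e z) (e a) h1 hza (he z) (he a)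
        (he2 z) (he2 a)
    intro z a
    rcases le_total ‖(a : ℂ)‖ ‖(z : ℂ)‖ with h | h
    · exact hhalf z a h
    · rw [norm_sub_rev, norm_sub_rev (z : ℂ)]
      exact hhalf a z h
  have hecont : Continuous e := by
    have : LipschitzWith (Real.toNNReal ((2 * γ - 1) / 2)) e := by
      apply LipschitzWith.of_dist_le_mul
      intro z a
      rw [Real.coe_toNNReal _ (by positivity), dist_eq_norm, Subtype.dist_eq, dist_eq_norm]
      exact hlip z a
    exact this.continuous
  have hquad : ∀ v E : ℂ, ‖E‖ ≤ (2 * γ - 1) / 2 * ‖v‖ →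
      (2 * γ - 1) / 2 * ‖v‖ ^ 2 ≤ (v * (v + 2 * (γ : ℂ) * conj v + E)).re := by
    intro v E hE
    have e1 : (v * (v + 2 * (γ : ℂ) * conj v + E)).re =
        (v * v).re + 2 * γ * ‖v‖ ^ 2 + (v * E).re := by
      have : v * (v + 2 * (γ : ℂ) * conj v + E) =
          v * v + ((2 * γ * ‖v‖ ^ 2 : ℝ) : ℂ) + v * E := by
        push_cast
        rw [← Complex.mul_conj']; ring
      rw [this, Complex.add_re, Complex.add_re, Complex.ofReal_re]
    have e2 := (abs_le.1 (Complex.abs_re_le_norm (v * v))).1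
    have e3 := (abs_le.1 (Complex.abs_re_le_norm (v * E))).1
    rw [norm_mul] at e2 e3
    have e4 := mul_le_mul_of_nonneg_left hE (norm_nonneg v)
    rw [e1]
    nlinarith
  refine ⟨⟨fun z => (z : ℂ) + 2 * (γ : ℂ) * conj (z : ℂ) + e z, by fun_prop⟩, ?_, ?_, ?_⟩
  · intro z
    simp only [ContinuousMap.coe_mk]
    linear_combination he z
  · intro z a
    have h1 := hquad ((z : ℂ) - a) (e z - e a) (hlip z a)
    simp only [ContinuousMap.coe_mk]
    have h2 : (z : ℂ) + 2 * (γ : ℂ) * conj (z : ℂ) + e z -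
        ((a : ℂ) + 2 * (γ : ℂ) * conj (a : ℂ) + e a) =
        ((z : ℂ) - a) + 2 * (γ : ℂ) * conj ((z : ℂ) - a) + (e z - e a) := by
      rw [map_sub]; ring
    rw [h2]; exact h1
  · intro z
    apply hquad
    refine (he2 z).trans ?_
    gcongr
    linarith

lemma polyConvex_of_dense {K : Set (Fin 2 → ℂ)} (hK : Bornology.IsBounded K)
    (h : PolyDenseInC K) : IsPolyConvex K := by
  intro w hw
  obtain ⟨C, hC⟩ := hK.exists_norm_le
  have hC0 : 0 < |C| + ‖w‖ + 1 := by positivity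
  have hpos : ∀ p : K, 0 < ‖(p : Fin 2 → ℂ) 0 - w 0‖ ^ 2 + ‖(p : Fin 2 → ℂ) 1 - w 1‖ ^ 2 := by
    intro p
    by_contra hneg
    apply hw
    have h0 : (p : Fin 2 → ℂ) 0 = w 0 := by
      rw [← sub_eq_zero, ← norm_eq_zero]
      nlinarith [sq_nonneg ‖(p : Fin 2 → ℂ) 0 - w 0‖, sq_nonneg ‖(p : Fin 2 → ℂ) 1 - w 1‖]
    have h1 : (p : Fin 2 → ℂ) 1 = w 1 := by
      rw [← sub_eq_zero, ← norm_eq_zero]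
      nlinarith [sq_nonneg ‖(p : Fin 2 → ℂ) 0 - w 0‖, sq_nonneg ‖(p : Fin 2 → ℂ) 1 - w 1‖]
    have : w = p := by
      ext i; fin_cases i
      · exact h0.symm
      · exact h1.symm
    rw [this]; exact p.2
  let D : K → ℂ := fun p =>
    ((‖(p : Fin 2 → ℂ) 0 - w 0‖ ^ 2 + ‖(p : Fin 2 → ℂ) 1 - w 1‖ ^ 2 : ℝ) : ℂ)
  have hD : ∀ p, D p ≠ 0 := fun p => Complex.ofReal_ne_zero.2 (hpos p).ne'
  have hpi : ∀ i : Fin 2, Continuous fun p : K => (p : Fin 2 → ℂ) i - w i := fun i =>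
    ((continuous_apply i).comp continuous_subtype_val).sub continuous_const
  have hDc : Continuous D :=
    Complex.continuous_ofReal.comp (((hpi 0).norm.pow 2).add ((hpi 1).norm.pow 2))
  have hg : ∀ i : Fin 2, ∃ P : MvPolynomial (Fin 2) ℂ, ∀ z : K,
      ‖MvPolynomial.eval (z : Fin 2 → ℂ) P - conj ((z : Fin 2 → ℂ) i - w i) / D z‖ <
        1 / (4 * (|C| + ‖w‖ + 1)) := by
    intro i
    apply h (fun z => conj ((z : Fin 2 → ℂ) i - w i) / D z)
    · exact Continuous.div (Complex.continuous_conj.comp (hpi i)) hDc hD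
    · positivity
  choose P hP using hg
  refine ⟨1 - (P 0 * (MvPolynomial.X 0 - MvPolynomial.C (w 0)) +
    P 1 * (MvPolynomial.X 1 - MvPolynomial.C (w 1))), ?_⟩
  intro z hz
  have hw1 : MvPolynomial.eval w (1 - (P 0 * (MvPolynomial.X 0 - MvPolynomial.C (w 0)) +
    P 1 * (MvPolynomial.X 1 - MvPolynomial.C (w 1)))) = 1 := by simp
  rw [hw1, norm_one]
  simp only [map_sub, map_one, map_add, map_mul, MvPolynomial.eval_X, MvPolynomial.eval_C]
  have hone : conj (z 0 - w 0) / D ⟨z, hz⟩ * (z 0 - w 0) +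
      conj (z 1 - w 1) / D ⟨z, hz⟩ * (z 1 - w 1) = 1 := by
    have h1 := hD ⟨z, hz⟩
    have h2 : D ⟨z, hz⟩ = conj (z 0 - w 0) * (z 0 - w 0) + conj (z 1 - w 1) * (z 1 - w 1) := by
      simp only [D]
      push_cast
      rw [Complex.conj_mul', Complex.conj_mul']
    rw [div_mul_eq_mul_div, div_mul_eq_mul_div, ← add_div, ← h2, div_self h1]
  have hsmall : ∀ i : Fin 2, ‖(conj (z i - w i) / D ⟨z, hz⟩ - MvPolynomial.eval z (P i)) *
      (z i - w i)‖ ≤ 1 / 4 := by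
    intro i
    have h1 := (hP i ⟨z, hz⟩).le
    rw [norm_sub_rev] at h1
    have h2 : ‖z i - w i‖ ≤ |C| + ‖w‖ + 1 := by
      have a1 := norm_le_pi_norm z i
      have a2 := norm_le_pi_norm w i
      have a3 := hC z hz
      have a4 := le_abs_self C
      have a5 := norm_sub_le (z i) (w i)
      linarith
    rw [norm_mul]
    calc _ ≤ 1 / (4 * (|C| + ‖w‖ + 1)) * (|C| + ‖w‖ + 1) := by gcongr
      _ = 1 / 4 := by field_simp
  have heq : 1 - (MvPolynomial.eval z (P 0) * (z 0 - w 0) + MvPolynomial.eval z (P 1) * (z 1 - w 1))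
      = (conj (z 0 - w 0) / D ⟨z, hz⟩ - MvPolynomial.eval z (P 0)) * (z 0 - w 0) +
        (conj (z 1 - w 1) / D ⟨z, hz⟩ - MvPolynomial.eval z (P 1)) * (z 1 - w 1) := by
    rw [← hone]; ring
  rw [heq]
  have := norm_add_le ((conj (z 0 - w 0) / D ⟨z, hz⟩ - MvPolynomial.eval z (P 0)) * (z 0 - w 0))
    ((conj (z 1 - w 1) / D ⟨z, hz⟩ - MvPolynomial.eval z (P 1)) * (z 1 - w 1))
  have h0 := hsmall 0
  have h1 := hsmall 1
  linarith

/-- Let `γ > 1/2`, `R > 0`, and `F : D̄_R(0) → ℂ` smooth, vanishing to order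
three at `0` (i.e. all partial derivatives of order `≤ 2` vanish at `0`). If `r ∈ (0,R]`
satisfies `‖F‖_{C²(D̄_r(0))} ≤ (2γ−1)³/(2¹⁴γ³)`, then
`M_r = {(z, z z̄ + γ(z² + z̄²) + F(z)) : z ∈ D̄_r(0)} ⊆ ℂ²` is polynomially convex and
satisfies `𝒫(M_r) = 𝒞(M_r)`. -/
theorem polyConvex_hyperbolic_graph_C2 (γ R : ℝ) (hγ : 1/2 < γ) (hR : 0 < R)
    (F : ℂ → ℂ) (hF : ContDiffOn ℝ (⊤ : ℕ∞) F (closedBall (0 : ℂ) R))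
    (hF3 : ∀ k : ℕ, k ≤ 2 → iteratedFDeriv ℝ k F 0 = 0)
    (r : ℝ) (hr0 : 0 < r) (hrR : r ≤ R)
    (hC2 : IsC2Bound F (closedBall (0 : ℂ) r) ((2*γ - 1)^3 / (2^14 * γ^3)))
    (M : Set (Fin 2 → ℂ))
    (hM : M = { p : Fin 2 → ℂ | ∃ z : ℂ, ‖z‖ ≤ r ∧
      p = ![z, z * conj z + (γ:ℂ) * (z^2 + (conj z)^2) + F z] }) :
    IsPolyConvex M ∧ PolyDenseInC M := by
  have hFc : ContinuousOn F (closedBall (0 : ℂ) r) :=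
    hF.continuousOn.mono (closedBall_subset_closedBall hrR)
  have hF0 : F 0 = 0 := by
    have h := hF3 0 (by norm_num)
    rw [← norm_eq_zero, ← norm_iteratedFDeriv_zero (𝕜 := ℝ), h, norm_zero]
  obtain ⟨N, hN1, hN2, hN3⟩ := N_exists hγ hF0 hr0 (F_lip hr0 hrR hF hF3 hC2)
  have hFc' : Continuous (fun z : closedBall (0 : ℂ) r => F z) :=
    continuousOn_iff_continuous_domRestrict.1 hFc
  let W : C(closedBall (0 : ℂ) r, ℂ) :=
    ⟨fun z => (z : ℂ) * conj (z : ℂ) + (γ : ℂ) * ((z : ℂ) ^ 2 + (conj (z : ℂ)) ^ 2) + F z,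
      Continuous.add (by fun_prop) hFc'⟩
  let A : MvPolynomial (Fin 2) ℂ →ₐ[ℂ] C(closedBall (0 : ℂ) r, ℂ) :=
    MvPolynomial.aeval ![zc r, W]
  have hA : ∀ P z, A P z = MvPolynomial.eval ![(z : ℂ), W z] P := by
    intro P z
    induction P using MvPolynomial.induction_on with
    | C c => simp [A, Algebra.algebraMap_eq_smul_one]
    | add p q hp hq => simp [hp, hq]
    | mul_X p i hp =>
      rw [map_mul, map_mul, ContinuousMap.mul_apply, hp]
      congr 1
      fin_cases i <;> simp [A, zc]
  let S : Subalgebra ℂ C(closedBall (0 : ℂ) r, ℂ) := A.range.topologicalClosure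
  have hS : IsClosed (S : Set C(closedBall (0 : ℂ) r, ℂ)) :=
    Subalgebra.isClosed_topologicalClosure _
  have hzS : zc r ∈ S :=
    Subalgebra.le_topologicalClosure _ ⟨MvPolynomial.X 0, by simp [A]⟩
  have hWS : W ∈ S :=
    Subalgebra.le_topologicalClosure _ ⟨MvPolynomial.X 1, by simp [A]⟩
  have hNS : N * N ∈ S := by
    have : N * N = algebraMap ℂ _ (4 * (γ : ℂ)) * W +
        algebraMap ℂ _ (1 - 4 * (γ : ℂ) ^ 2) * (zc r * zc r) := by
      ext z
      have := hN1 z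
      rw [ContinuousMap.mul_apply, this]
      simp only [ContinuousMap.add_apply, ContinuousMap.mul_apply, Algebra.algebraMap_eq_smul_one,
        ContinuousMap.smul_apply, ContinuousMap.one_apply,
        zc, W, ContinuousMap.coe_mk, smul_eq_mul, mul_one]
      ring
    rw [this]
    exact S.add_mem (S.mul_mem (S.algebraMap_mem _) hWS)
      (S.mul_mem (S.algebraMap_mem _) (S.mul_mem hzS hzS))
  have hST : S = ⊤ := main_alg r S hS N hzS hNS ((2 * γ - 1) / 2) (by linarith) hN2 hN3
  have hparam : ∀ z : closedBall (0 : ℂ) r, ![(z : ℂ), W z] ∈ M := by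
    intro z
    rw [hM]
    exact ⟨z, mem_closedBall_zero_iff.1 z.2, rfl⟩
  have hsurj : ∀ p ∈ M, ∃ z : closedBall (0 : ℂ) r, p = ![(z : ℂ), W z] := by
    intro p hp
    rw [hM] at hp
    obtain ⟨z, hz, rfl⟩ := hp
    exact ⟨⟨z, mem_closedBall_zero_iff.2 hz⟩, rfl⟩
  have hpc : Continuous (fun z : closedBall (0 : ℂ) r => (![(z : ℂ), W z] : Fin 2 → ℂ)) := by
    apply continuous_pi
    intro i
    fin_cases i
    · exact continuous_subtype_val
    · exact W.continuous
  have hdense : PolyDenseInC M := by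
    intro g hg ε hε
    let G : C(closedBall (0 : ℂ) r, ℂ) :=
      ⟨fun z => g ⟨![(z : ℂ), W z], hparam z⟩, hg.comp (hpc.subtype_mk hparam)⟩
    have hG : G ∈ closure (A.range : Set C(closedBall (0 : ℂ) r, ℂ)) := by
      have : G ∈ S := by rw [hST]; trivial
      exact this
    obtain ⟨_, ⟨P, rfl⟩, hP⟩ := Metric.mem_closure_iff.1 hG ε hε
    refine ⟨P, ?_⟩
    rintro ⟨p, hp⟩
    obtain ⟨z, rfl⟩ := hsurj p hp
    have h1 := (ContinuousMap.dist_apply_le_dist z).trans_lt hP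
    rw [dist_comm, dist_eq_norm] at h1
    have h2 := hA P z
    show ‖MvPolynomial.eval ![(z : ℂ), W z] P - _‖ < ε
    rw [← h2]
    exact h1
  have hbdd : Bornology.IsBounded M := by
    have : M = Set.range (fun z : closedBall (0 : ℂ) r => (![(z : ℂ), W z] : Fin 2 → ℂ)) := by
      ext p
      constructor
      · intro hp
        obtain ⟨z, hz⟩ := hsurj p hp
        exact ⟨z, hz.symm⟩
      · rintro ⟨z, rfl⟩
        exact hparam z
    rw [this]
    exact (isCompact_range hpc).isBounded
  exact ⟨polyConvex_of_dense hbdd hdense, hdense⟩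
end
end
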